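/- arXiv:math/0406301 — 3 statements merged into one kernel-verified Lean document; each statement's English description precedes it below -/
import Mathlib

section
/- The number of domino tilings of the 2n-by-2n square equals the double product ∏_{j=1}^{n} ∏_{k=1}^{n} (4 cos²(πj/(2n+1)) + 4 cos²(πk/(2n+1))). -/
/-- Two cells of the `m×m` square grid are adjacent if they differ by one step
horizontally or vertically. -/
def gridAdj {m : ℕ} (a b : Fin m × Fin m) : Prop :=
  (a.1 = b.1 ∧ ((a.2 : ℕ) + 1 = b.2 ∨ (b.2 : ℕ) + 1 = a.2)) ∨
  (a.2 = b.2 ∧ ((a.1 : ℕ) + 1 = b.1 ∨ (b.1 : ℕ) + 1 = a.1))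

instance {m : ℕ} (a b : Fin m × Fin m) : Decidable (gridAdj a b) := by
  unfold gridAdj; infer_instance

/-- The number of domino tilings of the `m×m` square (perfect matchings of the grid
graph on its cells, encoded as fixed-point-free adjacency-respecting involutions). -/
def squareTilingCount (m : ℕ) : ℕ :=
  (Finset.univ.filter fun f : (Fin m × Fin m) → (Fin m × Fin m) =>
    ∀ v, f (f v) = v ∧ f v ≠ v ∧ gridAdj v (f v)).card


lemma zmod2_of_parity {a b : ℕ} (h : a % 2 = b % 2) : (a : ZMod 2) = b :=
  (ZMod.natCast_eq_natCast_iff' a b 2).2 h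

lemma sign_eq_neg_one_pow_inv {M : ℕ} (π : Equiv.Perm (Fin M)) :
    (Equiv.Perm.sign π : ℤˣ) =
      (-1) ^ (∑ k, ∑ l, if (k < l ∧ π l < π k) then 1 else 0 : ℕ) := by
  rw [Equiv.Perm.sign_eq_prod_prod_Ioi, ← Finset.prod_pow_eq_pow_sum]
  refine Finset.prod_congr rfl fun k _ => ?_
  rw [← Finset.prod_pow_eq_pow_sum, ← Finset.prod_subset (Finset.subset_univ (Finset.Ioi k))]
  · refine Finset.prod_congr rfl fun l hl => ?_
    have hl : k < l := by simpa using hl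
    have : π k ≠ π l := fun h => hl.ne (π.injective h)
    rcases lt_or_gt_of_ne this with h | h
    · simp [h, hl, h.le]
    · simp [h, hl, h.le]
  · intro l _ hl
    have hl : ¬ k < l := by simpa using hl
    simp [hl]

/-- Crossing indicator of the two arcs from black cells to white cells. -/
def crossNum {M : ℕ} (π : Equiv.Perm (Fin M)) (k l : Fin M) : ℕ :=
  (if (2 * (k : ℕ) < 2 * l ∧ 2 * (l : ℕ) < 2 * π k + 1 ∧ 2 * (π k : ℕ) + 1 < 2 * π l + 1) then 1 else 0) +
  (if (2 * (k : ℕ) < 2 * π l + 1 ∧ 2 * (π l : ℕ) + 1 < 2 * π k + 1 ∧ 2 * (π k : ℕ) + 1 < 2 * l) then 1 else 0) +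
  (if (2 * (π k : ℕ) + 1 < 2 * l ∧ 2 * (l : ℕ) < 2 * k ∧ 2 * (k : ℕ) < 2 * π l + 1) then 1 else 0) +
  (if (2 * (π k : ℕ) + 1 < 2 * π l + 1 ∧ 2 * (π l : ℕ) + 1 < 2 * k ∧ 2 * (k : ℕ) < 2 * l) then 1 else 0)

lemma card_aux1 {M : ℕ} (a : Fin M) (b : Fin M) :
    (∑ l : Fin M, if (a < l ∧ l ≤ b) then 1 else 0 : ℕ) = (b : ℕ) - a := by
  rw [← Fin.card_Ioc, Finset.card_eq_sum_ones, ← Finset.sum_filter]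
  congr 1
  ext; simp

lemma card_aux2 {M : ℕ} (a : Fin M) (b : Fin M) :
    (∑ l : Fin M, if (a < l ∧ l < b) then 1 else 0 : ℕ) = (b : ℕ) - a - 1 := by
  rw [← Fin.card_Ioo, Finset.card_eq_sum_ones, ← Finset.sum_filter]
  congr 1
  ext; simp

lemma parity_cross {M : ℕ} (π : Equiv.Perm (Fin M)) :
    (((∑ k, ∑ l, if (k < l ∧ π l < π k) then 1 else 0) + ∑ k, (if k ≤ π k then 0 else 1) : ℕ) : ZMod 2)
      = ((∑ k, ∑ l, crossNum π k l : ℕ) : ZMod 2) := by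
  have hC : (∑ k, ∑ l, crossNum π k l) = ∑ k, ∑ l, (
      (if (k < l ∧ l ≤ π k ∧ π k < π l) then 1 else 0) +
      (if (k ≤ π l ∧ π l < π k ∧ π k < l) then 1 else 0) +
      (if (π l < k ∧ k < l ∧ l ≤ π k) then 1 else 0) +
      (if (π k < π l ∧ π l < k ∧ k < l) then 1 else 0)) := by
    unfold crossNum
    simp only [Finset.sum_add_distrib]
    congr 1
    · congr 1
      · congr 1
        · refine Finset.sum_congr rfl fun k _ => Finset.sum_congr rfl fun l _ => ?_
          congr 1
          simp only [Fin.lt_def, Fin.le_def, eq_iff_iff]; omega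
        · refine Finset.sum_congr rfl fun k _ => Finset.sum_congr rfl fun l _ => ?_
          congr 1
          simp only [Fin.lt_def, Fin.le_def, eq_iff_iff]; omega
      · rw [Finset.sum_comm]
        refine Finset.sum_congr rfl fun k _ => Finset.sum_congr rfl fun l _ => ?_
        congr 1
        simp only [Fin.lt_def, Fin.le_def, eq_iff_iff]; omega
    · refine Finset.sum_congr rfl fun k _ => Finset.sum_congr rfl fun l _ => ?_
      congr 1
      simp only [Fin.lt_def, eq_iff_iff]; omega
  have hpt : ∀ k l : Fin M,
      (((if (k < l ∧ π l < π k) then 1 else 0) + (if (k < l ∧ l ≤ π k) then 1 else 0) +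
        (if (π l < k ∧ k < l) then 1 else 0) : ℕ) : ZMod 2) = ((
      (if (k < l ∧ l ≤ π k ∧ π k < π l) then 1 else 0) +
      (if (k ≤ π l ∧ π l < π k ∧ π k < l) then 1 else 0) +
      (if (π l < k ∧ k < l ∧ l ≤ π k) then 1 else 0) +
      (if (π k < π l ∧ π l < k ∧ k < l) then 1 else 0) : ℕ) : ZMod 2) := by
    intro k l
    apply zmod2_of_parity
    by_cases hkl : k = l
    · subst hkl; simp
    have hne : (π k : ℕ) ≠ π l := fun h => hkl (π.injective (Fin.ext h))
    have hkl' : (k : ℕ) ≠ l := fun h => hkl (Fin.ext h)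
    simp only [Fin.lt_def, Fin.le_def]
    split_ifs <;> omega
  have hE : ((∑ k, ∑ l, (if (k < l ∧ l ≤ π k) then 1 else 0) +
      ∑ k, ∑ l, (if (π l < k ∧ k < l) then 1 else 0) + ∑ k, (if k ≤ π k then 0 else 1) : ℕ) : ZMod 2) = 0 := by
    rw [Finset.sum_comm (f := fun k l => (if (π l < k ∧ k < l) then 1 else 0 : ℕ))]
    simp only [card_aux1, card_aux2]
    rw [← Finset.sum_add_distrib, ← Finset.sum_add_distrib]
    have : ∀ k : Fin M, (((π k : ℕ) - k + (k - π k - 1) + (if k ≤ π k then 0 else 1) : ℕ) : ZMod 2)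
        = ((π k : ℕ) : ZMod 2) + ((k : ℕ) : ZMod 2) := by
      intro k
      rw [← Nat.cast_add]
      apply zmod2_of_parity
      simp only [Fin.le_def]
      split_ifs <;> omega
    rw [Nat.cast_sum, Finset.sum_congr rfl (fun k _ => this k), Finset.sum_add_distrib,
      Equiv.sum_comp π (fun k : Fin M => ((k : ℕ) : ZMod 2))]
    exact CharTwo.add_self_eq_zero _
  have hsum := Finset.sum_congr (rfl : (Finset.univ : Finset (Fin M)) = _)
    (fun k _ => Finset.sum_congr (rfl : (Finset.univ : Finset (Fin M)) = _) (fun l _ => hpt k l))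
  simp only [← Nat.cast_sum] at hsum
  rw [← hC] at hsum
  rw [← hsum]
  simp only [Finset.sum_add_distrib, Nat.cast_add] at hE ⊢
  generalize ((∑ k, ∑ l, (if (k < l ∧ l ≤ π k) then 1 else 0) : ℕ) : ZMod 2) = a at *
  generalize ((∑ k, ∑ l, (if (π l < k ∧ k < l) then 1 else 0) : ℕ) : ZMod 2) = b at *
  have h2 : (2 : ZMod 2) = 0 := rfl
  have hE' : ((∑ k, (if k ≤ π k then 0 else 1) : ℕ) : ZMod 2) = a + b := by
    linear_combination hE - (a + b) * h2
  rw [hE']; ring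

lemma sign_cross {M : ℕ} (π : Equiv.Perm (Fin M)) (h : Even (∑ k, ∑ l, crossNum π k l)) :
    ((Equiv.Perm.sign π : ℤˣ) : ℤ) * ∏ k, (if k ≤ π k then (1 : ℤ) else -1) = 1 := by
  have h1 : (∏ k, (if k ≤ π k then (1 : ℤ) else -1)) =
      (-1) ^ (∑ k, (if k ≤ π k then 0 else 1) : ℕ) := by
    rw [← Finset.prod_pow_eq_pow_sum]
    refine Finset.prod_congr rfl fun k _ => ?_
    split_ifs <;> simp
  rw [h1, sign_eq_neg_one_pow_inv]
  push_cast
  rw [← pow_add]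
  apply Even.neg_one_pow
  rw [← ZMod.natCast_eq_zero_iff_even] at h ⊢
  rw [← h, ← parity_cross]
/-- The property of being (the involution of) a domino tiling. -/
def IsTil {m : ℕ} (f : (Fin m × Fin m) → (Fin m × Fin m)) : Prop :=
  ∀ v, f (f v) = v ∧ f v ≠ v ∧ gridAdj v (f v)

/-- Position inside a row, read in boustrophedon order. -/
def snq (m r c : ℕ) : ℕ := if r % 2 = 0 then c else m - 1 - c

/-- Boustrophedon position of a cell. -/
def spos {m : ℕ} (v : Fin m × Fin m) : ℕ := m * v.1 + snq m v.1 v.2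

lemma snq_lt {m r c : ℕ} (h : c < m) : snq m r c < m := by
  unfold snq; split_ifs <;> omega

lemma spos_lt_iff {m : ℕ} (x y : Fin m × Fin m) :
    spos x < spos y ↔ (x.1 : ℕ) < y.1 ∨ ((x.1 : ℕ) = y.1 ∧ snq m x.1 x.2 < snq m y.1 y.2) := by
  have hx := snq_lt (r := x.1) x.2.isLt
  have hy := snq_lt (r := y.1) y.2.isLt
  unfold spos
  rcases lt_trichotomy (x.1 : ℕ) y.1 with h | h | h
  · have : m * ((x.1 : ℕ) + 1) ≤ m * y.1 := Nat.mul_le_mul_left m h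
    rw [Nat.mul_add] at this
    constructor
    · intro _; left; exact h
    · intro _; omega
  · rw [h] at *
    constructor
    · intro _; right; refine ⟨rfl, by omega⟩
    · intro _; omega
  · have : m * ((y.1 : ℕ) + 1) ≤ m * x.1 := Nat.mul_le_mul_left m h
    rw [Nat.mul_add] at this
    constructor
    · intro _; omega
    · intro _; omega

lemma cross_iff {m : ℕ} {f : (Fin m × Fin m) → (Fin m × Fin m)} (hf : IsTil f) (u y : Fin m × Fin m) :
    (spos (f u) < spos y ∧ spos y < spos u ∧ spos u < spos (f y)) ↔
      (y.1 = u.1 ∧ ((f y).1 : ℕ) = y.1 + 1 ∧ ((f u).1 : ℕ) + 1 = u.1 ∧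
        snq m y.1 y.2 < snq m y.1 u.2) := by
  obtain ⟨-, -, h1⟩ := hf u
  obtain ⟨-, -, h2⟩ := hf y
  simp only [spos_lt_iff]
  unfold gridAdj at h1 h2
  simp only [Fin.ext_iff] at *
  have b1 := u.2.isLt
  have b2 := y.2.isLt
  have b3 := (f u).2.isLt
  have b4 := (f y).2.isLt
  generalize (u.1 : ℕ) = ur at *
  generalize (u.2 : ℕ) = uc at *
  generalize (y.1 : ℕ) = yr at *
  generalize (y.2 : ℕ) = yc at *
  generalize ((f u).1 : ℕ) = fur at *
  generalize ((f u).2 : ℕ) = fuc at *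
  generalize ((f y).1 : ℕ) = fyr at *
  generalize ((f y).2 : ℕ) = fyc at *
  unfold snq
  rcases h1 with ⟨rfl, h1 | h1⟩ | ⟨rfl, h1 | h1⟩ <;> rcases h2 with ⟨rfl, h2 | h2⟩ | ⟨rfl, h2 | h2⟩ <;>
  split_ifs <;> omega

section row
variable {m : ℕ} (f : (Fin m × Fin m) → (Fin m × Fin m)) (r : Fin m)

/-- Columns where row `r` has a domino going down. -/
def dn : Finset (Fin m) := Finset.univ.filter fun c => ((f (r, c)).1 : ℕ) = r + 1
/-- Columns where row `r` has a domino going up. -/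
def up : Finset (Fin m) := Finset.univ.filter fun c => ((f (r, c)).1 : ℕ) + 1 = r
/-- Columns where row `r` has a horizontal domino. -/
def hz : Finset (Fin m) := Finset.univ.filter fun c => (f (r, c)).1 = r
end row

lemma row_split {m : ℕ} {f : (Fin m × Fin m) → (Fin m × Fin m)} (hf : IsTil f) (r : Fin m)
    {R : Type*} [AddCommMonoid R] (g : Fin m → R) :
    ∑ c, g c = ∑ c ∈ dn f r, g c + ∑ c ∈ up f r, g c + ∑ c ∈ hz f r, g c := by
  simp only [dn, up, hz, Finset.sum_filter, ← Finset.sum_add_distrib]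
  refine Finset.sum_congr rfl fun c _ => ?_
  obtain ⟨-, -, h⟩ := hf (r, c)
  unfold gridAdj at h
  simp only [Fin.ext_iff] at *
  rcases h with ⟨h, h'⟩ | ⟨h, h' | h'⟩
  · rw [if_neg (by omega), if_neg (by omega), if_pos (by omega)]; simp
  · rw [if_pos (by omega), if_neg (by omega), if_neg (by omega)]; simp
  · rw [if_neg (by omega), if_pos (by omega), if_neg (by omega)]; simp

/-- sums over horizontal cells cancel in pairs. -/
lemma hz_sum {m : ℕ} {f : (Fin m × Fin m) → (Fin m × Fin m)} (hf : IsTil f) (r : Fin m)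
    {R : Type*} [AddCommMonoid R] (g : Fin m → R)
    (hg : ∀ c c' : Fin m, f (r, c) = (r, c') → ((c : ℕ) + 1 = c' ∨ (c' : ℕ) + 1 = c) → g c + g c' = 0)  :
    ∑ c ∈ hz f r, g c = 0 := by
  have key : ∀ c ∈ hz f r, f (r, c) = (r, (f (r, c)).2) := by
    intro c hc
    have hc : (f (r, c)).1 = r := by simpa [hz] using hc
    ext
    · simp [hc]
    · simp
  refine Finset.sum_involution (fun c _ => (f (r, c)).2) ?_ ?_ ?_ ?_
  · intro c hc
    apply hg _ _ (key c hc)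
    obtain ⟨-, h0, h⟩ := hf (r, c)
    have hc' : (f (r, c)).1 = r := by simpa [hz] using hc
    unfold gridAdj at h
    simp only [Fin.ext_iff] at *
    omega
  · intro c hc _ h
    have := key c hc
    rw [h] at this
    exact (hf (r, c)).2.1 this
  · intro c hc
    have h1 := (hf (r, c)).1
    rw [key c hc] at h1
    simp [hz, h1]
  · intro c hc
    have h1 := (hf (r, c)).1
    rw [key c hc] at h1
    simp [h1]

lemma up_succ {m : ℕ} {f : (Fin m × Fin m) → (Fin m × Fin m)} (hf : IsTil f) (r r' : Fin m)
    (h : (r' : ℕ) = r + 1) : up f r' = dn f r := by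
  ext c
  simp only [up, dn, Finset.mem_filter, Finset.mem_univ, true_and]
  constructor
  · intro h1
    obtain ⟨h3, -, h2⟩ := hf (r', c)
    unfold gridAdj at h2
    have : f (r', c) = (r, c) := by
      simp only [Fin.ext_iff, Prod.ext_iff] at *; omega
    rw [this] at h3
    rw [h3]; exact h
  · intro h1
    obtain ⟨h3, -, h2⟩ := hf (r, c)
    unfold gridAdj at h2
    have : f (r, c) = (r', c) := by
      simp only [Fin.ext_iff, Prod.ext_iff] at *; omega
    rw [this] at h3
    rw [h3]; exact h.symm

lemma alt_sum (n : ℕ) : ∑ c : Fin (2 * n), (-1 : ℤ) ^ (c : ℕ) = 0 := by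
  rw [Fin.sum_univ_eq_sum_range (fun c => (-1 : ℤ) ^ c)]
  induction n with
  | zero => simp
  | succ k ih =>
    rw [show 2 * (k + 1) = 2 * k + 1 + 1 by ring, Finset.sum_range_succ, Finset.sum_range_succ, ih]
    simp [pow_succ]

lemma balance {n : ℕ} {f : (Fin (2 * n) × Fin (2 * n)) → (Fin (2 * n) × Fin (2 * n))} (hf : IsTil f) :
    ∀ (k : ℕ) (r : Fin (2 * n)), (r : ℕ) = k → ∑ c ∈ dn f r, (-1 : ℤ) ^ (c : ℕ) = 0 := by
  intro k
  induction k with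
  | zero =>
    intro r hr
    have h := row_split hf r (fun c => (-1 : ℤ) ^ (c : ℕ))
    rw [alt_sum, hz_sum hf r] at h
    · have : up f r = ∅ := by
        ext c; simp [up, hr]
      rw [this] at h
      simpa using h.symm
    · rintro c c' - (h | h) <;> rw [← h] <;> simp [pow_succ]
  | succ k ih =>
    intro r hr
    have h := row_split hf r (fun c => (-1 : ℤ) ^ (c : ℕ))
    rw [alt_sum, hz_sum hf r] at h
    · have hk : k < 2 * n := by omega
      rw [up_succ hf ⟨k, hk⟩ r hr, ih ⟨k, hk⟩ rfl] at h
      simpa using h.symm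
    · rintro c c' - (h | h) <;> rw [← h] <;> simp [pow_succ]

lemma even_odd_balance {m : ℕ} (D : Finset (Fin m)) (h : ∑ c ∈ D, (-1 : ℤ) ^ (c : ℕ) = 0) :
    D.card = 2 * ∑ c ∈ D, (c : ℕ) % 2 := by
  have h1 : ∑ c ∈ D, (-1 : ℤ) ^ (c : ℕ) = ∑ c ∈ D, (1 - 2 * (((c : ℕ) % 2 : ℕ) : ℤ)) := by
    refine Finset.sum_congr rfl fun c _ => ?_
    rcases Nat.even_or_odd (c : ℕ) with h | h
    · rw [h.neg_one_pow, Nat.even_iff.1 h]; simp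
    · rw [h.neg_one_pow, Nat.odd_iff.1 h]; simp
  rw [h1, Finset.sum_sub_distrib, ← Finset.mul_sum, ← Nat.cast_sum] at h
  simp only [Finset.sum_const, nsmul_eq_mul, mul_one] at h
  omega

lemma pairs_count {m : ℕ} (D : Finset (Fin m)) (q : Fin m → ℕ) (hq : Function.Injective q) :
    2 * (∑ c ∈ D, ∑ c' ∈ D, if q c < q c' then 1 else 0) + D.card = D.card * D.card := by
  have h1 : D.card * D.card = ∑ c ∈ D, ∑ c' ∈ D,
      ((if q c < q c' then 1 else 0) + (if q c' < q c then 1 else 0) + (if c = c' then 1 else 0)) := by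
    rw [Finset.card_eq_sum_ones, Finset.sum_mul_sum]
    refine Finset.sum_congr rfl fun c _ => Finset.sum_congr rfl fun c' _ => ?_
    rcases lt_trichotomy (q c) (q c') with h | h | h
    · have : c ≠ c' := by rintro rfl; omega
      simp [h, h.le, this]
    · simp [hq h]
    · have : c ≠ c' := by rintro rfl; omega
      simp [h, h.le, this]
  rw [h1]
  simp only [Finset.sum_add_distrib]
  rw [Finset.sum_comm (f := fun c c' => if q c' < q c then 1 else 0)]
  simp
  ring

lemma snq_inj {m : ℕ} (r : ℕ) : Function.Injective (fun c : Fin m => snq m r c) := by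
  intro a b h
  have := a.isLt
  have := b.isLt
  simp only [snq] at h
  ext
  split_ifs at h <;> omega

lemma count_after {m : ℕ} (r : ℕ) (c : Fin m) :
    (∑ c' : Fin m, if snq m r c < snq m r c' then 1 else 0 : ℕ) = m - 1 - snq m r c := by
  have hc := c.isLt
  rw [← Finset.sum_filter, ← Finset.card_eq_sum_ones]
  by_cases hr : r % 2 = 0
  · simp only [snq, hr, if_true]
    rw [← Fin.card_Ioi]
    congr 1; ext; simp
  · simp only [snq, hr, if_false]
    rw [show m - 1 - (m - 1 - (c : ℕ)) = c by omega]
    conv_rhs => rw [← Fin.card_Iio c]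
    congr 1; ext c'
    have := c'.isLt
    simp only [Finset.mem_filter, Finset.mem_univ, true_and, Finset.mem_Iio, Fin.lt_def]; omega

lemma row_even {n : ℕ} {f : (Fin (2 * n) × Fin (2 * n)) → (Fin (2 * n) × Fin (2 * n))} (hf : IsTil f)
    (r : Fin (2 * n)) :
    ((∑ c ∈ dn f r, ∑ c' ∈ up f r,
      if snq (2 * n) r c < snq (2 * n) r c' then 1 else 0 : ℕ) : ZMod 2) = 0 := by
  have hb := even_odd_balance _ (balance hf r r rfl)
  have hp := pairs_count (dn f r) (fun c => snq (2 * n) r c) (snq_inj r)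
  have h1 : ((∑ c ∈ dn f r, ∑ c' : Fin (2 * n),
      if snq (2 * n) r c < snq (2 * n) r c' then 1 else 0 : ℕ) : ZMod 2) =
      ((∑ c ∈ dn f r, (c : ℕ) % 2 : ℕ) : ZMod 2) := by
    simp only [count_after]
    by_cases hr : (r : ℕ) % 2 = 0
    · have : ((∑ c ∈ dn f r, (2 * n - 1 - snq (2 * n) r c) : ℕ) : ZMod 2) =
        (((dn f r).card + ∑ c ∈ dn f r, (c : ℕ) % 2 : ℕ) : ZMod 2) := by
        rw [Finset.card_eq_sum_ones, ← Finset.sum_add_distrib, Nat.cast_sum, Nat.cast_sum]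
        refine Finset.sum_congr rfl fun c _ => ?_
        apply zmod2_of_parity
        have := c.isLt
        simp only [snq, hr, if_true]
        omega
      rw [this, hb]
      apply zmod2_of_parity
      omega
    · rw [Nat.cast_sum, Nat.cast_sum]
      refine Finset.sum_congr rfl fun c _ => ?_
      apply zmod2_of_parity
      have := c.isLt
      simp only [snq, hr, if_false]
      omega
  have h2 : ((∑ c ∈ dn f r, ∑ c' : Fin (2 * n),
      if snq (2 * n) r c < snq (2 * n) r c' then 1 else 0 : ℕ) : ZMod 2) =
      ((∑ c ∈ dn f r, ∑ c' ∈ dn f r, if snq (2 * n) r c < snq (2 * n) r c' then 1 else 0 : ℕ) : ZMod 2)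
      + ((∑ c ∈ dn f r, ∑ c' ∈ up f r,
          if snq (2 * n) r c < snq (2 * n) r c' then 1 else 0 : ℕ) : ZMod 2) := by
    rw [← Nat.cast_add, ← Finset.sum_add_distrib, Nat.cast_sum, Nat.cast_sum]
    refine Finset.sum_congr rfl fun c hc => ?_
    rw [row_split hf r, Nat.cast_add]
    have hc : ((f (r, c)).1 : ℕ) = r + 1 := by simpa [dn] using hc
    have : ((∑ c' ∈ hz f r, if snq (2 * n) r c < snq (2 * n) r c' then 1 else 0 : ℕ) : ZMod 2) = 0 := by
      rw [Nat.cast_sum]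
      apply hz_sum hf r
      intro a b hab hadj
      have hac : a ≠ c := by
        rintro rfl; rw [hab] at hc; simp at hc
      have hbc : b ≠ c := by
        rintro rfl
        have h5 := (hf (r, a)).1
        rw [hab] at h5; rw [h5] at hc; simp at hc
      rw [← Nat.cast_add]
      apply zmod2_of_parity (b := 0)
      have := a.isLt
      have := b.isLt
      have := c.isLt
      simp only [Fin.ext_iff, ne_eq] at hac hbc
      unfold snq
      split_ifs <;> omega
    rw [this, add_zero]
  rw [h1] at h2
  set E := ∑ c ∈ dn f r, (c : ℕ) % 2
  set Y := (∑ c ∈ dn f r, ∑ c' ∈ dn f r, if snq (2 * n) r c < snq (2 * n) r c' then 1 else 0 : ℕ)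
  have hY : Y + E = 2 * (E * E) := by
    rw [hb] at hp
    have : 2 * E * (2 * E) = 4 * (E * E) := by ring
    change 2 * Y + _ = _ at hp
    omega
  have hYE : (Y : ZMod 2) = E := by
    apply zmod2_of_parity
    omega
  rw [hYE] at h2
  simpa using h2.symm

lemma cross_even {n : ℕ} {f : (Fin (2 * n) × Fin (2 * n)) → (Fin (2 * n) × Fin (2 * n))} (hf : IsTil f) :
    Even (∑ x, ∑ y, if (spos x < spos y ∧ spos y < spos (f x) ∧ spos (f x) < spos (f y)) then 1 else 0) := by
  have hinv : Function.Involutive f := fun v => (hf v).1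
  rw [← Equiv.sum_comp hinv.toPerm]
  simp only [Function.Involutive.coe_toPerm, (hf _).1]
  simp only [cross_iff hf]
  rw [← ZMod.natCast_eq_zero_iff_even, Finset.sum_comm, Fintype.sum_prod_type, Nat.cast_sum]
  refine Finset.sum_eq_zero fun r _ => ?_
  rw [← row_even hf r]
  congr 1
  rw [dn, Finset.sum_filter]
  refine Finset.sum_congr rfl fun c _ => ?_
  rw [Fintype.sum_prod_type, Finset.sum_eq_single r]
  · split_ifs with h
    · rw [up, Finset.sum_filter]
      refine Finset.sum_congr rfl fun c' _ => ?_
      simp [h, ite_and]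
    · simp [h]
  · intro b _ hb
    simp [hb.symm]
  · simp
/-- The cell at a given boustrophedon position. -/
def cellOf (n x : ℕ) (hx : x < 2 * n * (2 * n)) : Fin (2 * n) × Fin (2 * n) :=
  (⟨x / (2 * n), Nat.div_lt_of_lt_mul hx⟩,
   ⟨snq (2 * n) (x / (2 * n)) (x % (2 * n)),
    snq_lt (Nat.mod_lt _ (Nat.pos_of_ne_zero (by rintro h; simp [h] at hx)))⟩)

lemma spos_cellOf (n x : ℕ) (hx : x < 2 * n * (2 * n)) : spos (cellOf n x hx) = x := by
  have h0 : 0 < 2 * n := Nat.pos_of_ne_zero (by rintro h; simp [h] at hx)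
  have h1 := Nat.mod_lt x h0
  have h2 : snq (2 * n) (x / (2 * n)) (snq (2 * n) (x / (2 * n)) (x % (2 * n))) = x % (2 * n) := by
    unfold snq; split_ifs <;> omega
  simp only [spos, cellOf, h2]
  exact Nat.div_add_mod x (2 * n)

/-- Black cells (even position) and white cells (odd position). -/
def colFun (n : ℕ) : Fin (2 * n * n) ⊕ Fin (2 * n * n) → Fin (2 * n) × Fin (2 * n)
  | Sum.inl k => cellOf n (2 * k) (by have := k.isLt; nlinarith)
  | Sum.inr k => cellOf n (2 * k + 1) (by
      have := k.isLt
      have h : 2 * n * (2 * n) = 2 * (2 * n * n) := by ring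
      omega)

lemma spos_inl {n : ℕ} (k : Fin (2 * n * n)) : spos (colFun n (Sum.inl k)) = 2 * k := by
  simp only [colFun]; apply spos_cellOf

lemma spos_inr {n : ℕ} (k : Fin (2 * n * n)) : spos (colFun n (Sum.inr k)) = 2 * k + 1 := by
  simp only [colFun]; apply spos_cellOf

lemma colFun_bij (n : ℕ) : Function.Bijective (colFun n) := by
  rw [Fintype.bijective_iff_injective_and_card]
  constructor
  · intro a b h
    have h := congrArg spos h
    rcases a with a | a <;> rcases b with b | b <;> simp only [spos_inl, spos_inr] at h
    · congr 1; ext; omega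
    · omega
    · omega
    · congr 1; ext; omega
  · simp; ring

/-- The colouring equivalence. -/
noncomputable def colE (n : ℕ) : Fin (2 * n * n) ⊕ Fin (2 * n * n) ≃ Fin (2 * n) × Fin (2 * n) :=
  Equiv.ofBijective _ (colFun_bij n)

lemma spos_colE_inl {n : ℕ} (k : Fin (2 * n * n)) : spos (colE n (Sum.inl k)) = 2 * k := spos_inl k
lemma spos_colE_inr {n : ℕ} (k : Fin (2 * n * n)) : spos (colE n (Sum.inr k)) = 2 * k + 1 := spos_inr k

lemma gridAdj_symm {m : ℕ} {a b : Fin m × Fin m} (h : gridAdj a b) : gridAdj b a := by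
  unfold gridAdj at *
  rcases h with ⟨h1, h2⟩ | ⟨h1, h2⟩
  · exact Or.inl ⟨h1.symm, h2.symm⟩
  · exact Or.inr ⟨h1.symm, h2.symm⟩

lemma gridAdj_parity {n : ℕ} {a b : Fin (2 * n) × Fin (2 * n)} (h : gridAdj a b) :
    spos a % 2 ≠ spos b % 2 := by
  have h1 : ∀ v : Fin (2 * n) × Fin (2 * n), spos v % 2 = ((v.1 : ℕ) + v.2) % 2 := by
    intro v
    have := v.2.isLt
    unfold spos
    rw [Nat.mul_assoc]
    unfold snq
    split_ifs <;> omega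
  rw [h1, h1]
  unfold gridAdj at h
  simp only [Fin.ext_iff] at h
  omega

lemma not_adj_inl {n : ℕ} (k l : Fin (2 * n * n)) :
    ¬ gridAdj (colE n (Sum.inl k)) (colE n (Sum.inl l)) := by
  intro h
  have := gridAdj_parity h
  simp only [spos_colE_inl] at this
  omega

lemma not_adj_inr {n : ℕ} (k l : Fin (2 * n * n)) :
    ¬ gridAdj (colE n (Sum.inr k)) (colE n (Sum.inr l)) := by
  intro h
  have := gridAdj_parity h
  simp only [spos_colE_inr] at this
  omega

/-- Matching associated with a bijection black → white. -/
noncomputable def tilOf {n : ℕ} (π : Equiv.Perm (Fin (2 * n * n))) (v : Fin (2 * n) × Fin (2 * n)) :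
    Fin (2 * n) × Fin (2 * n) :=
  colE n (Sum.elim (fun k => Sum.inr (π k)) (fun k => Sum.inl (π.symm k)) ((colE n).symm v))

lemma tilOf_inl {n : ℕ} (π : Equiv.Perm (Fin (2 * n * n))) (k) :
    tilOf π (colE n (Sum.inl k)) = colE n (Sum.inr (π k)) := by simp [tilOf]

lemma tilOf_inr {n : ℕ} (π : Equiv.Perm (Fin (2 * n * n))) (k) :
    tilOf π (colE n (Sum.inr k)) = colE n (Sum.inl (π.symm k)) := by simp [tilOf]

/-- Bijections black → white along edges. -/
def ValidPerm {n : ℕ} (π : Equiv.Perm (Fin (2 * n * n))) : Prop :=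
  ∀ k, gridAdj (colE n (Sum.inl k)) (colE n (Sum.inr (π k)))

lemma tilOf_isTil {n : ℕ} {π : Equiv.Perm (Fin (2 * n * n))} (h : ValidPerm π) : IsTil (tilOf π) := by
  intro v
  obtain ⟨w, rfl⟩ := (colE n).surjective v
  rcases w with k | k
  · simp only [tilOf_inl, tilOf_inr, Equiv.symm_apply_apply, true_and]
    exact ⟨by simp, h k⟩
  · simp only [tilOf_inl, tilOf_inr, Equiv.apply_symm_apply, true_and]
    refine ⟨by simp, gridAdj_symm ?_⟩
    have := h (π.symm k)
    simpa using this

lemma exists_perm {n : ℕ} {f : (Fin (2 * n) × Fin (2 * n)) → (Fin (2 * n) × Fin (2 * n))} (hf : IsTil f) :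
    ∃ π : Equiv.Perm (Fin (2 * n * n)), ValidPerm π ∧ tilOf π = f := by
  have h1 : ∀ k, ∃ l, f (colE n (Sum.inl k)) = colE n (Sum.inr l) := by
    intro k
    obtain ⟨w, hw⟩ := (colE n).surjective (f (colE n (Sum.inl k)))
    rcases w with l | l
    · have := (hf (colE n (Sum.inl k))).2.2
      rw [← hw] at this
      exact absurd this (not_adj_inl _ _)
    · exact ⟨l, hw.symm⟩
  have h2 : ∀ k, ∃ l, f (colE n (Sum.inr k)) = colE n (Sum.inl l) := by
    intro k
    obtain ⟨w, hw⟩ := (colE n).surjective (f (colE n (Sum.inr k)))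
    rcases w with l | l
    · exact ⟨l, hw.symm⟩
    · have := (hf (colE n (Sum.inr k))).2.2
      rw [← hw] at this
      exact absurd this (not_adj_inr _ _)
  choose a ha using h1
  choose b hb using h2
  have hab : ∀ k, b (a k) = k := by
    intro k
    have := (hf (colE n (Sum.inl k))).1
    rw [ha, hb] at this
    simpa using this
  have hba : ∀ k, a (b k) = k := by
    intro k
    have := (hf (colE n (Sum.inr k))).1
    rw [hb, ha] at this
    simpa using this
  refine ⟨⟨a, b, hab, hba⟩, ?_, ?_⟩
  · intro k
    have := (hf (colE n (Sum.inl k))).2.2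
    rwa [ha] at this
  · funext v
    obtain ⟨w, rfl⟩ := (colE n).surjective v
    rcases w with k | k
    · rw [tilOf_inl, ha]; rfl
    · rw [tilOf_inr, hb]; rfl

lemma tilOf_inj {n : ℕ} : Function.Injective (tilOf (n := n)) := by
  intro π ρ h
  ext k
  have := congrFun h (colE n (Sum.inl k))
  simp only [tilOf_inl] at this
  have := Sum.inr_injective ((colE n).injective this)
  rw [this]

open Classical in
lemma count_eq_card_valid (n : ℕ) :
    squareTilingCount (2 * n) =
      (Finset.univ.filter fun π : Equiv.Perm (Fin (2 * n * n)) => ValidPerm π).card := by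
  unfold squareTilingCount
  symm
  refine Finset.card_bij (fun π _ => tilOf π) ?_ ?_ ?_
  · intro π hπ
    simp only [Finset.mem_filter, Finset.mem_univ, true_and] at hπ ⊢
    exact tilOf_isTil hπ
  · intro π _ ρ _ h
    exact tilOf_inj h
  · intro f hf
    simp only [Finset.mem_filter, Finset.mem_univ, true_and] at hf
    obtain ⟨π, h1, h2⟩ := exists_perm (f := f) hf
    exact ⟨π, by simpa using h1, h2⟩

lemma sum_colE {n : ℕ} (π : Equiv.Perm (Fin (2 * n * n))) (g : Fin (2 * n) × Fin (2 * n) → ℕ) :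
    ∑ x, g x = ∑ k, (g (colE n (Sum.inl k)) + g (colE n (Sum.inr (π k)))) := by
  rw [← Equiv.sum_comp (colE n), Fintype.sum_sum_type, Finset.sum_add_distrib]
  congr 1
  exact (Equiv.sum_comp π (fun k => g (colE n (Sum.inr k)))).symm

lemma cross_sum_eq {n : ℕ} (π : Equiv.Perm (Fin (2 * n * n))) :
    (∑ x, ∑ y, if (spos x < spos y ∧ spos y < spos (tilOf π x) ∧ spos (tilOf π x) < spos (tilOf π y))
      then 1 else 0) = ∑ k, ∑ l, crossNum π k l := by
  rw [sum_colE π]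
  refine Finset.sum_congr rfl fun k _ => ?_
  rw [sum_colE π, sum_colE π, ← Finset.sum_add_distrib]
  refine Finset.sum_congr rfl fun l _ => ?_
  simp only [tilOf_inl, tilOf_inr, Equiv.symm_apply_apply, spos_colE_inl, spos_colE_inr]
  unfold crossNum
  ring

/-- The Kasteleyn matrix. -/
noncomputable def kast (n : ℕ) : Matrix (Fin (2 * n * n)) (Fin (2 * n * n)) ℂ := fun k l =>
  if gridAdj (colE n (Sum.inl k)) (colE n (Sum.inr l)) then (if k ≤ l then 1 else -1) else 0

lemma det_kast (n : ℕ) : (kast n).det = (squareTilingCount (2 * n) : ℂ) := by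
  classical
  rw [count_eq_card_valid, ← Matrix.det_transpose, Matrix.det_apply', Finset.card_eq_sum_ones,
    Finset.sum_filter, Nat.cast_sum]
  refine Finset.sum_congr rfl fun π _ => ?_
  simp only [Matrix.transpose_apply]
  split_ifs with h
  · have h1 := sign_cross π (by rw [← cross_sum_eq]; exact cross_even (tilOf_isTil h))
    have h2 : ∏ k, kast n k (π k) = ((∏ k, (if k ≤ π k then (1 : ℤ) else -1) : ℤ) : ℂ) := by
      rw [Int.cast_prod]
      refine Finset.prod_congr rfl fun k _ => ?_
      unfold kast
      rw [if_pos (h k)]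
      split_ifs <;> simp
    rw [h2, ← Int.cast_mul, h1]; simp
  · unfold ValidPerm at h
    push Not at h
    obtain ⟨k, hk⟩ := h
    rw [Finset.prod_eq_zero (Finset.mem_univ k)]
    · simp
    · unfold kast; rw [if_neg hk]
section linalg
open Matrix Kronecker

/-- Antisymmetric path matrix. -/
noncomputable def pathT (m : ℕ) : Matrix (Fin m) (Fin m) ℂ := fun a b =>
  (if (a : ℕ) + 1 = b then 1 else 0) - (if (b : ℕ) + 1 = a then 1 else 0)

/-- Alternating sign matrix. -/
noncomputable def altZ (m : ℕ) : Matrix (Fin m) (Fin m) ℂ := Matrix.diagonal fun r => (-1) ^ (r : ℕ)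

/-- Signed adjacency matrix of the grid. -/
noncomputable def gridA (m : ℕ) : Matrix (Fin m × Fin m) (Fin m × Fin m) ℂ := fun u v =>
  if gridAdj u v then (if spos u < spos v then 1 else -1) else 0

lemma gridA_eq (m : ℕ) : gridA m = altZ m ⊗ₖ pathT m + pathT m ⊗ₖ (1 : Matrix (Fin m) (Fin m) ℂ) := by
  ext ⟨r, c⟩ ⟨r', c'⟩
  simp only [gridA, spos_lt_iff, altZ, pathT, Matrix.add_apply, Matrix.kroneckerMap_apply,
    Matrix.diagonal_apply, Matrix.one_apply, gridAdj]
  have hr := r.isLt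
  have hr' := r'.isLt
  have hc := c.isLt
  have hc' := c'.isLt
  simp only [Fin.ext_iff]
  generalize (r : ℕ) = r at *
  generalize (r' : ℕ) = r' at *
  generalize (c : ℕ) = c at *
  generalize (c' : ℕ) = c' at *
  have hx : ∀ x : ℕ, (x + 1 + 1 = x) = False := by intro x; simp only [eq_iff_iff, iff_false]; omega
  by_cases h1 : r = r'
  · subst h1
    by_cases h2 : c + 1 = c'
    · subst h2
      rcases Nat.mod_two_eq_zero_or_one r with h | h
      · have h4 : snq m r c < snq m r (c + 1) := by simp [snq, h]
        simp [hx, h4, (Nat.even_iff.2 h).neg_one_pow]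
      · have h4 : ¬ snq m r c < snq m r (c + 1) := by simp [snq, h]; omega
        simp [hx, h4, (Nat.odd_iff.2 h).neg_one_pow]
    · by_cases h3 : c' + 1 = c
      · subst h3
        rcases Nat.mod_two_eq_zero_or_one r with h | h
        · have h4 : ¬ snq m r (c' + 1) < snq m r c' := by simp [snq, h]
          simp [hx, h4, (Nat.even_iff.2 h).neg_one_pow]
        · have h4 : snq m r (c' + 1) < snq m r c' := by simp [snq, h]; omega
          simp [hx, h4, (Nat.odd_iff.2 h).neg_one_pow]
      · simp [h2, h3]
  · by_cases h2 : c = c'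
    · subst h2
      by_cases h3 : r + 1 = r'
      · subst h3; simp [hx]
      · by_cases h4 : r' + 1 = r
        · subst h4; simp [hx]
        · simp [h1, h3, h4]
    · simp [h1, h2]

lemma altZ_sq (m : ℕ) : altZ m * altZ m = 1 := by
  unfold altZ
  rw [Matrix.diagonal_mul_diagonal, ← Matrix.diagonal_one]
  congr 1; funext r
  rw [← mul_pow]; simp

lemma altZ_anti (m : ℕ) : altZ m * pathT m = - (pathT m * altZ m) := by
  ext a b
  simp only [altZ, Matrix.diagonal_mul, Matrix.neg_apply, Matrix.mul_diagonal, pathT]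
  generalize (a : ℕ) = a at *
  generalize (b : ℕ) = b at *
  by_cases h : a + 1 = b
  · subst h
    have : ¬ (a + 1 + 1 = a) := by omega
    simp [this, pow_succ]
  · by_cases h' : b + 1 = a
    · subst h'
      have : ¬ (b + 1 + 1 = b) := by omega
      simp [this, pow_succ]
    · simp [h, h']

lemma gridA_sq (m : ℕ) : gridA m * gridA m =
    (pathT m * pathT m) ⊗ₖ (1 : Matrix (Fin m) (Fin m) ℂ) +
    (1 : Matrix (Fin m) (Fin m) ℂ) ⊗ₖ (pathT m * pathT m) := by
  rw [gridA_eq, Matrix.add_mul, Matrix.mul_add, Matrix.mul_add, ← Matrix.mul_kronecker_mul,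
    ← Matrix.mul_kronecker_mul, ← Matrix.mul_kronecker_mul, ← Matrix.mul_kronecker_mul, altZ_sq,
    altZ_anti]
  have : (-(pathT m * altZ m)) ⊗ₖ (pathT m * (1 : Matrix (Fin m) (Fin m) ℂ)) =
      - ((pathT m * altZ m) ⊗ₖ (pathT m)) := by
    ext ⟨a, b⟩ ⟨c, d⟩
    simp [Matrix.kroneckerMap_apply]
  rw [this]
  simp only [Matrix.one_mul]
  abel

/-- eigenangle. -/
noncomputable def ang (m : ℕ) (j : ℕ) : ℝ := Real.pi * (j + 1) / (m + 1)

/-- Eigenvector matrix. -/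
noncomputable def eigS (m : ℕ) : Matrix (Fin m) (Fin m) ℂ := fun j c =>
  Complex.I ^ (c : ℕ) * (Real.sin (ang m j * ((c : ℕ) + 1)) : ℝ)

/-- Eigenvalues. -/
noncomputable def eigMu (m : ℕ) (j : Fin m) : ℂ := -2 * Complex.I * (Real.cos (ang m j) : ℝ)

lemma sum_pathT (m : ℕ) (g : ℕ → ℂ) (c : Fin m) :
    ∑ a : Fin m, g a * pathT m a c =
      (if (c : ℕ) = 0 then 0 else g (c - 1)) - (if (c : ℕ) + 1 < m then g (c + 1) else 0) := by
  have hc := c.isLt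
  simp only [pathT, mul_sub, Finset.sum_sub_distrib]
  congr 1
  · rw [Fin.sum_univ_eq_sum_range (fun a => g a * (if a + 1 = (c : ℕ) then 1 else 0))]
    split_ifs with h
    · apply Finset.sum_eq_zero; intro a _; rw [if_neg (by omega)]; simp
    · rw [Finset.sum_eq_single ((c : ℕ) - 1)]
      · rw [if_pos (by omega)]; simp
      · intro b _ hb; rw [if_neg (by omega)]; simp
      · intro hb; simp at hb; omega
  · rw [Fin.sum_univ_eq_sum_range (fun a => g a * (if (c : ℕ) + 1 = a then 1 else 0))]
    split_ifs with h
    · rw [Finset.sum_eq_single ((c : ℕ) + 1)]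
      · simp
      · intro b _ hb; rw [if_neg (by omega)]; simp
      · intro hb; simp at hb; omega
    · apply Finset.sum_eq_zero; intro a ha
      have := Finset.mem_range.1 ha
      rw [if_neg (by omega)]; simp

lemma eigS_row (m : ℕ) (j c : Fin m) :
    ∑ a : Fin m, eigS m j a * pathT m a c = eigMu m j * eigS m j c := by
  have hc := c.isLt
  have h := sum_pathT m (fun a => Complex.I ^ a * (Real.sin (ang m j * ((a : ℕ) + 1)) : ℝ)) c
  unfold eigS
  rw [h]
  have e1 : (if (c : ℕ) = 0 then (0 : ℂ) else
      Complex.I ^ ((c : ℕ) - 1) * (Real.sin (ang m j * ((((c : ℕ) - 1 : ℕ) : ℝ) + 1)) : ℝ)) =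
      - Complex.I ^ ((c : ℕ) + 1) * (Real.sin (ang m j * (c : ℕ)) : ℝ) := by
    split_ifs with h0
    · simp [h0]
    · obtain ⟨d, hd⟩ := Nat.exists_eq_succ_of_ne_zero h0
      rw [hd]
      simp only [Nat.succ_eq_add_one, Nat.add_sub_cancel, pow_succ, Nat.cast_add, Nat.cast_one]
      linear_combination (Complex.I ^ d * (Real.sin (ang m j * ((d : ℝ) + 1)) : ℂ)) * Complex.I_mul_I
  have e2 : (if (c : ℕ) + 1 < m then
      Complex.I ^ ((c : ℕ) + 1) * (Real.sin (ang m j * ((((c : ℕ) + 1 : ℕ) : ℝ) + 1)) : ℝ) else (0 : ℂ)) =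
      Complex.I ^ ((c : ℕ) + 1) * (Real.sin (ang m j * ((c : ℕ) + 2)) : ℝ) := by
    split_ifs with h0
    · congr 4; push_cast; ring
    · have hm : ((c : ℕ) : ℝ) = m - 1 := by
        have : m = (c : ℕ) + 1 := by omega
        rw [eq_sub_iff_add_eq]; exact_mod_cast this.symm
      have : ang m j * (((c : ℕ) : ℝ) + 2) = ((j + 1 : ℕ) : ℝ) * Real.pi := by
        rw [hm, ang]
        have : (m : ℝ) + 1 ≠ 0 := by positivity
        field_simp
        push_cast; ring
      rw [this, Real.sin_nat_mul_pi]; simp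
  rw [e1, e2]
  have hs : Real.sin (ang m j * (c : ℕ)) + Real.sin (ang m j * ((c : ℕ) + 2)) =
      2 * Real.cos (ang m j) * Real.sin (ang m j * ((c : ℕ) + 1)) := by
    rw [show ang m j * ((c : ℕ) : ℝ) = ang m j * ((c : ℕ) + 1) - ang m j by ring,
      show ang m j * (((c : ℕ) : ℝ) + 2) = ang m j * ((c : ℕ) + 1) + ang m j by ring,
      Real.sin_sub, Real.sin_add]
    ring
  have hs' : ((Real.sin (ang m j * (c : ℕ)) : ℝ) : ℂ) + (Real.sin (ang m j * ((c : ℕ) + 2)) : ℝ) =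
      2 * (Real.cos (ang m j) : ℝ) * (Real.sin (ang m j * ((c : ℕ) + 1)) : ℝ) := by
    exact_mod_cast hs
  rw [eigMu, pow_succ]
  linear_combination (-Complex.I ^ (c : ℕ) * Complex.I) * hs'

lemma ang_mem {m : ℕ} (j : Fin m) : 0 < ang m j ∧ ang m j < Real.pi := by
  have hj : ((j : ℕ) : ℝ) + 1 < m + 1 := by
    have := j.isLt
    have : ((j : ℕ) : ℝ) < m := by exact_mod_cast this
    linarith
  have hpi := Real.pi_pos
  unfold ang
  constructor
  · positivity
  · rw [div_lt_iff₀ (by positivity)]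
    exact mul_lt_mul_of_pos_left hj hpi

lemma eigMu_inj (m : ℕ) : Function.Injective (eigMu m) := by
  intro a b h
  have h1 : (Real.cos (ang m a) : ℂ) = (Real.cos (ang m b) : ℝ) := by
    unfold eigMu at h
    exact mul_left_cancel₀ (by simp) h
  have h1 : Real.cos (ang m a) = Real.cos (ang m b) := by exact_mod_cast h1
  have ha := ang_mem a
  have hb := ang_mem b
  have h2 := Real.injOn_cos ⟨ha.1.le, ha.2.le⟩ ⟨hb.1.le, hb.2.le⟩ h1
  unfold ang at h2
  have hm : (m : ℝ) + 1 ≠ 0 := by positivity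
  rw [div_left_inj' hm] at h2
  have h3 := mul_left_cancel₀ Real.pi_ne_zero h2
  ext
  have : ((a : ℕ) : ℝ) = (b : ℕ) := by linarith
  exact_mod_cast this

lemma eigS_det (m : ℕ) : (eigS m).det ≠ 0 := by
  have hli : LinearIndependent ℂ (eigS m).row := by
    refine Module.End.eigenvectors_linearIndependent' (pathT m).vecMulLinear (eigMu m)
      (eigMu_inj m) _ ?_
    intro j
    rw [Module.End.hasEigenvector_iff, Module.End.mem_eigenspace_iff]
    constructor
    · funext c
      simp only [Matrix.vecMulLinear_apply, Matrix.vecMul, dotProduct, Matrix.row, Pi.smul_apply,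
        smul_eq_mul]
      exact eigS_row m j c
    · intro h
      have h0 : 0 < m := j.pos
      have := congrFun h ⟨0, h0⟩
      simp only [Matrix.row, eigS, pow_zero, one_mul, Pi.zero_apply, Nat.cast_zero, zero_add, mul_one,
        Complex.ofReal_eq_zero] at this
      exact (Real.sin_pos_of_pos_of_lt_pi (ang_mem j).1 (ang_mem j).2).ne' this
  have := Matrix.linearIndependent_rows_iff_isUnit.1 hli
  rw [Matrix.isUnit_iff_isUnit_det] at this
  exact this.ne_zero

lemma eigS_mul (m : ℕ) : eigS m * pathT m = Matrix.diagonal (eigMu m) * eigS m := by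
  ext j c
  rw [Matrix.diagonal_mul, Matrix.mul_apply, eigS_row]

lemma eigS_mul_sq (m : ℕ) : eigS m * (pathT m * pathT m) =
    Matrix.diagonal (fun j => eigMu m j * eigMu m j) * eigS m := by
  rw [← Matrix.mul_assoc, eigS_mul, Matrix.mul_assoc, eigS_mul, ← Matrix.mul_assoc,
    Matrix.diagonal_mul_diagonal]

lemma det_gridA_sq (m : ℕ) : (gridA m * gridA m).det =
    ∏ p : Fin m × Fin m, (eigMu m p.1 * eigMu m p.1 + eigMu m p.2 * eigMu m p.2) := by
  have h1 : (eigS m ⊗ₖ eigS m) * (gridA m * gridA m) =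
      Matrix.diagonal (fun p : Fin m × Fin m =>
        (eigMu m p.1 * eigMu m p.1 + eigMu m p.2 * eigMu m p.2)) * (eigS m ⊗ₖ eigS m) := by
    rw [gridA_sq, Matrix.mul_add, ← Matrix.mul_kronecker_mul, ← Matrix.mul_kronecker_mul, eigS_mul_sq]
    ext ⟨a, b⟩ ⟨c, d⟩
    simp only [Matrix.mul_one, Matrix.add_apply, Matrix.kroneckerMap_apply, Matrix.diagonal_mul]
    ring
  have h2 := congrArg Matrix.det h1
  rw [Matrix.det_mul, Matrix.det_mul _ (eigS m ⊗ₖ eigS m), Matrix.det_diagonal, mul_comm] at h2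
  refine mul_right_cancel₀ ?_ h2
  rw [Matrix.det_kronecker]
  exact mul_ne_zero (pow_ne_zero _ (eigS_det m)) (pow_ne_zero _ (eigS_det m))

lemma gridA_blocks (n : ℕ) : (gridA (2 * n)).submatrix (colE n) (colE n) =
    Matrix.fromBlocks 0 (kast n) (-(kast n)ᵀ) 0 := by
  ext (k | k) (l | l)
  · simp [gridA, not_adj_inl]
  · simp only [Matrix.submatrix_apply, gridA, spos_colE_inl, spos_colE_inr, Matrix.fromBlocks_apply₁₂,
      kast]
    congr 2
    simp only [Fin.le_def, eq_iff_iff]; omega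
  · simp only [Matrix.submatrix_apply, gridA, spos_colE_inl, spos_colE_inr, Matrix.fromBlocks_apply₂₁,
      kast, Matrix.neg_apply, Matrix.transpose_apply]
    have h1 : gridAdj (colE n (Sum.inr k)) (colE n (Sum.inl l)) ↔
      gridAdj (colE n (Sum.inl l)) (colE n (Sum.inr k)) := ⟨gridAdj_symm, gridAdj_symm⟩
    rw [if_congr h1 rfl rfl]
    split_ifs with h2 h3 h4 h4
    · rw [Fin.le_def] at h4; omega
    · simp
    · simp
    · rw [Fin.le_def] at h4; omega
    · simp
  · simp [gridA, not_adj_inr]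

lemma kast_det_pow (n : ℕ) : (kast n).det ^ 4 = (gridA (2 * n) * gridA (2 * n)).det := by
  rw [← Matrix.det_submatrix_equiv_self (colE n) (gridA (2 * n) * gridA (2 * n)),
    ← Matrix.submatrix_mul_equiv _ _ _ (colE n), gridA_blocks, Matrix.fromBlocks_multiply]
  simp only [Matrix.mul_zero, Matrix.zero_mul, zero_add, add_zero]
  rw [Matrix.det_fromBlocks_zero₂₁, Matrix.mul_neg, Matrix.neg_mul, Matrix.det_neg, Matrix.det_neg,
    Matrix.det_mul, Matrix.det_mul, Matrix.det_transpose]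
  have : ((-1 : ℂ) ^ Fintype.card (Fin (2 * n * n))) * ((-1 : ℂ) ^ Fintype.card (Fin (2 * n * n))) = 1 := by
    rw [← mul_pow]; simp
  linear_combination (-(kast n).det ^ 4) * this

end linalg

lemma count_pow_four (n : ℕ) : (squareTilingCount (2 * n) : ℝ) ^ 4 =
    ∏ j : Fin (2 * n), ∏ k : Fin (2 * n),
      (4 * Real.cos (ang (2 * n) j) ^ 2 + 4 * Real.cos (ang (2 * n) k) ^ 2) := by
  have h := kast_det_pow n
  rw [det_kast, det_gridA_sq] at h
  have h2 : ∀ p : Fin (2 * n) × Fin (2 * n),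
      eigMu (2 * n) p.1 * eigMu (2 * n) p.1 + eigMu (2 * n) p.2 * eigMu (2 * n) p.2 =
      (-1) * (((4 * Real.cos (ang (2 * n) p.1) ^ 2 + 4 * Real.cos (ang (2 * n) p.2) ^ 2) : ℝ) : ℂ) := by
    intro p
    unfold eigMu
    push_cast
    linear_combination (4 * Complex.cos (ang (2 * n) p.1) ^ 2 + 4 * Complex.cos (ang (2 * n) p.2) ^ 2) *
      Complex.I_mul_I
  rw [Finset.prod_congr rfl (fun p _ => h2 p), Finset.prod_mul_distrib, Finset.prod_const,
    Finset.card_univ, Fintype.card_prod, Fintype.card_fin,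
    Even.neg_one_pow (by exact ⟨n * (2 * n), by ring⟩), one_mul, ← Complex.ofReal_prod,
    Fintype.prod_prod_type] at h
  exact_mod_cast h

lemma prod_fold (n : ℕ) (g : ℝ → ℝ) :
    ∏ j : Fin (2 * n), g (Real.cos (ang (2 * n) j) ^ 2) =
      (∏ j ∈ Finset.Icc 1 n, g (Real.cos (Real.pi * j / (2 * n + 1)) ^ 2)) ^ 2 := by
  rw [Fin.prod_univ_eq_prod_range (fun j => g (Real.cos (ang (2 * n) j) ^ 2)), two_mul,
    Finset.prod_range_add, sq]
  have h1 : ∏ j ∈ Finset.Icc 1 n, g (Real.cos (Real.pi * j / (2 * n + 1)) ^ 2) =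
      ∏ j ∈ Finset.range n, g (Real.cos (ang (n + n) j) ^ 2) := by
    have h2 := Finset.prod_Ico_add' (fun j : ℕ => g (Real.cos (Real.pi * j / (2 * n + 1)) ^ 2)) 0 n 1
    have h3 : Finset.Icc 1 n = Finset.Ico (0 + 1) (n + 1) := by
      ext x; simp only [Finset.mem_Icc, Finset.mem_Ico]; omega
    rw [h3, ← h2, Finset.range_eq_Ico]
    refine Finset.prod_congr rfl fun j _ => ?_
    unfold ang
    push_cast
    rw [two_mul]
  rw [h1]
  congr 1
  rw [← Finset.prod_range_reflect]
  refine Finset.prod_congr rfl fun j hj => ?_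
  have hj := Finset.mem_range.1 hj
  have h3 : ang (n + n) (n + (n - 1 - j)) = Real.pi - ang (n + n) j := by
    unfold ang
    have : ((n + (n - 1 - j) : ℕ) : ℝ) = 2 * n - 1 - j := by
      rw [eq_sub_iff_add_eq, eq_sub_iff_add_eq]
      have : n + (n - 1 - j) + j + 1 = 2 * n := by omega
      exact_mod_cast this
    rw [this]
    have : (((n + n : ℕ)) : ℝ) + 1 ≠ 0 := by positivity
    field_simp
    push_cast; ring
  rw [h3, Real.cos_pi_sub, neg_sq]

/-- Temperley–Fisher–Kasteleyn: the number of domino tilings of the `2n×2n` square is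
`∏_{j=1}^{n} ∏_{k=1}^{n} (4 cos²(πj/(2n+1)) + 4 cos²(πk/(2n+1)))`. -/
theorem squareTilingCount_eq_prod (n : ℕ) :
    (squareTilingCount (2 * n) : ℝ) =
      ∏ j ∈ Finset.Icc 1 n, ∏ k ∈ Finset.Icc 1 n,
        (4 * Real.cos (Real.pi * j / (2 * n + 1)) ^ 2 +
         4 * Real.cos (Real.pi * k / (2 * n + 1)) ^ 2) := by
  have h4 := count_pow_four n
  have h5 : ∀ j : Fin (2 * n), ∏ k : Fin (2 * n),
      (4 * Real.cos (ang (2 * n) j) ^ 2 + 4 * Real.cos (ang (2 * n) k) ^ 2) =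
      (∏ k ∈ Finset.Icc 1 n, (4 * Real.cos (ang (2 * n) j) ^ 2 +
        4 * Real.cos (Real.pi * k / (2 * n + 1)) ^ 2)) ^ 2 := fun j =>
    prod_fold n (fun x => 4 * Real.cos (ang (2 * n) j) ^ 2 + 4 * x)
  rw [Finset.prod_congr rfl (fun j _ => h5 j),
    prod_fold n (fun x => (∏ k ∈ Finset.Icc 1 n, (4 * x +
        4 * Real.cos (Real.pi * k / (2 * n + 1)) ^ 2)) ^ 2), Finset.prod_pow, ← pow_mul] at h4
  refine (pow_left_inj₀ (by positivity) ?_ (by norm_num)).1 h4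
  positivity
end

section
/- The number of perfect matchings of the Aztec diamond graph of order n is 2^(n(n+1)/2). -/
/-- A cell `(i,j)` (with `1 ≤ i,j ≤ 2n`) of the Aztec diamond of order `n`:
it satisfies `|2i−2n−1| + |2j−2n−1| ≤ 2n`. -/
def AztecCell (n : ℕ) :=
  {p : Fin (2 * n + 1) × Fin (2 * n + 1) //
    1 ≤ (p.1 : ℕ) ∧ 1 ≤ (p.2 : ℕ) ∧
    |2 * ((p.1 : ℕ) : ℤ) - (2 * n + 1)| + |2 * ((p.2 : ℕ) : ℤ) - (2 * n + 1)| ≤ 2 * n}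

instance (n : ℕ) : Fintype (AztecCell n) := by unfold AztecCell; infer_instance
instance (n : ℕ) : DecidableEq (AztecCell n) := by unfold AztecCell; infer_instance

/-- Adjacency of cells of the Aztec diamond: horizontally or vertically adjacent. -/
def aztecAdj {n : ℕ} (a b : AztecCell n) : Prop :=
  (a.1.1 = b.1.1 ∧ ((a.1.2 : ℕ) + 1 = b.1.2 ∨ (b.1.2 : ℕ) + 1 = a.1.2)) ∨
  (a.1.2 = b.1.2 ∧ ((a.1.1 : ℕ) + 1 = b.1.1 ∨ (b.1.1 : ℕ) + 1 = a.1.1))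

instance {n : ℕ} (a b : AztecCell n) : Decidable (aztecAdj a b) := by
  unfold aztecAdj; infer_instance

/-- The number of perfect matchings of the Aztec diamond graph of order `n`,
encoded as fixed-point-free adjacency-respecting involutions of its cells. -/
def aztecMatchingCount (n : ℕ) : ℕ :=
  (Finset.univ.filter fun f : AztecCell n → AztecCell n =>
    ∀ v, f (f v) = v ∧ f v ≠ v ∧ aztecAdj v (f v)).card

namespace AztecProof

/-- faces of the rotated grid -/
abbrev Face (m : ℕ) := Fin m × Fin m
/-- corners of a face -/
abbrev Corner := Bool × Bool

/-- numerical value of a Boolean -/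
def bi (b : Bool) : ℤ := if b then 1 else 0

/-- position of the corner `c` of the face `F` -/
def pos (m : ℕ) (F : Face m) (c : Corner) : ℤ × ℤ :=
  ((F.1 : ℕ) + (F.2 : ℕ) + 1 + bi c.1, (m : ℤ) + (F.1 : ℕ) - (F.2 : ℕ) + bi c.2)

/-- the neighbouring corner in one of the two directions -/
def flip (h : Bool) (c : Corner) : Corner := if h then (!c.1, c.2) else (c.1, !c.2)

/-- local consistency -/
def Loc (t : Corner → Option Bool) : Prop :=
  ∀ c h, t c = some h → t (flip h c) = some h

instance : DecidablePred Loc := fun t => by unfold Loc; infer_instance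

/-- global consistency -/
def Cond (m : ℕ) (B : Bool) (σ : Face m → Corner → Bool) : Prop :=
  (∀ F c G d, (F, c) ≠ (G, d) → pos m F c = pos m G d → σ G d = !(σ F c)) ∧
  (∀ F c, (∀ G d, pos m G d = pos m F c → (G, d) = (F, c)) → σ F c = B)

/-- number of local matchings -/
def w (S : Corner → Bool) : ℕ :=
  (Finset.univ.filter fun t : Corner → Option Bool => Loc t ∧ (fun c => (t c).isSome) = S).card

lemma w_compl (S : Corner → Bool) :
    w S ^ 2 * 4 = w (fun c => !(S c)) ^ 2 * 2 ^ (∑ c, (S c).toNat) := by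
  revert S
  decide +kernel

lemma flip_flip (h : Bool) (c : Corner) : flip h (flip h c) = c := by
  revert h c; decide

lemma pos_inj {m : ℕ} {F : Face m} {c d : Corner} (h : pos m F c = pos m F d) : c = d := by
  obtain ⟨c1, c2⟩ := c
  obtain ⟨d1, d2⟩ := d
  simp only [pos, Prod.mk.injEq] at h
  cases c1 <;> cases c2 <;> cases d1 <;> cases d2 <;> simp [bi] at h ⊢

lemma face_ext {m : ℕ} {F G : Face m} (h1 : (F.1 : ℕ) = (G.1 : ℕ)) (h2 : (F.2 : ℕ) = (G.2 : ℕ)) :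
    F = G := Prod.ext (Fin.ext h1) (Fin.ext h2)

lemma pos_three {m : ℕ} {F G H : Face m} {c d e : Corner} (h1 : pos m F c = pos m G d)
    (h2 : pos m F c = pos m H e) : (F, c) = (G, d) ∨ (F, c) = (H, e) ∨ (G, d) = (H, e) := by
  obtain ⟨c1, c2⟩ := c
  obtain ⟨d1, d2⟩ := d
  obtain ⟨e1, e2⟩ := e
  obtain ⟨⟨a, ha⟩, ⟨b, hb⟩⟩ := F
  obtain ⟨⟨a', ha'⟩, ⟨b', hb'⟩⟩ := G
  obtain ⟨⟨a'', ha''⟩, ⟨b'', hb''⟩⟩ := H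
  simp only [pos, Prod.mk.injEq] at h1 h2
  simp only [Prod.mk.injEq, Fin.mk.injEq]
  cases c1 <;> cases c2 <;> cases d1 <;> cases d2 <;> cases e1 <;> cases e2 <;>
    simp [bi] at h1 h2 ⊢ <;> omega

lemma pos_edge {m : ℕ} {F G : Face m} {c d : Corner} {h k : Bool} (h1 : pos m F c = pos m G d)
    (h2 : pos m F (flip h c) = pos m G (flip k d)) : (F, c) = (G, d) ∧ h = k := by
  obtain ⟨c1, c2⟩ := c
  obtain ⟨d1, d2⟩ := d
  obtain ⟨⟨a, ha⟩, ⟨b, hb⟩⟩ := F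
  obtain ⟨⟨a', ha'⟩, ⟨b', hb'⟩⟩ := G
  simp only [pos, Prod.mk.injEq] at h1 h2
  simp only [Prod.mk.injEq, Fin.mk.injEq]
  cases c1 <;> cases c2 <;> cases d1 <;> cases d2 <;> cases h <;> cases k <;>
    simp [bi, flip] at h1 h2 ⊢ <;> omega

/-- adjacency in the integer grid -/
def gadj (p q : ℤ × ℤ) : Prop :=
  (p.1 = q.1 ∧ (p.2 + 1 = q.2 ∨ q.2 + 1 = p.2)) ∨ (p.2 = q.2 ∧ (p.1 + 1 = q.1 ∨ q.1 + 1 = p.1))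

lemma gadj_flip {m : ℕ} (F : Face m) (c : Corner) (h : Bool) :
    gadj (pos m F c) (pos m F (flip h c)) := by
  obtain ⟨c1, c2⟩ := c
  cases c1 <;> cases c2 <;> cases h <;> simp [gadj, pos, flip, bi]

open Classical in
/-- The main bijection, stated abstractly. -/
lemma bij {V : Type} [Fintype V] [DecidableEq V] (adj : V → V → Prop) (m : ℕ) (B : Bool)
    (e : V → ℤ × ℤ) (he : Function.Injective e)
    (hadj : ∀ v u, adj v u ↔ gadj (e v) (e u))
    (H3 : ∀ F c G d, (F, c) ≠ (G, d) → pos m F c = pos m G d → ∃ v, e v = pos m F c)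
    (H4 : ∀ F c, (∀ G d, pos m G d = pos m F c → (G, d) = (F, c)) →
      ((∃ v, e v = pos m F c) ↔ B = true))
    (H5 : ∀ v u, adj v u → ∃ F c h, e v = pos m F c ∧ e u = pos m F (flip h c))
    (H6 : ∀ v, ∃ F c, e v = pos m F c) :
    (Finset.univ.filter fun f : V → V => ∀ v, f (f v) = v ∧ f v ≠ v ∧ adj v (f v)).card =
    (Finset.univ.filter fun τ : Face m → Corner → Option Bool =>
      (∀ F, Loc (τ F)) ∧ Cond m B (fun F c => (τ F c).isSome)).card := by
  -- the relation: f matches corner c of F in direction h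
  let R : (V → V) → Face m → Corner → Bool → Prop := fun f F c h =>
    ∃ v, e v = pos m F c ∧ e (f v) = pos m F (flip h c)
  let T : (V → V) → Face m → Corner → Option Bool := fun f F c =>
    if R f F c true then some true else if R f F c false then some false else none
  have hRu : ∀ f F c h k, R f F c h → R f F c k → h = k := by
    rintro f F c h k ⟨v, h1, h2⟩ ⟨u, h3, h4⟩
    have : v = u := he (h1.trans h3.symm)
    subst this
    exact (pos_edge rfl (h2.symm.trans h4)).2
  have hT : ∀ f F c h, T f F c = some h ↔ R f F c h := by
    intro f F c h
    by_cases ht : R f F c true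
    · have hf : ¬ R f F c false := fun hf => by simpa using hRu _ _ _ _ _ ht hf
      cases h <;> simp [T, ht, hf]
    · by_cases hf : R f F c false <;> cases h <;> simp [T, ht, hf]
  have hTs : ∀ f F c, (T f F c).isSome = true ↔ ∃ h, R f F c h := by
    intro f F c
    rw [Option.isSome_iff_exists]
    simp only [hT]
  refine Finset.card_bij (fun f _ => T f) ?_ ?_ ?_
  · intro f hf
    simp only [Finset.mem_filter, Finset.mem_univ, true_and] at hf ⊢
    refine ⟨?_, ?_, ?_⟩
    · intro F c h hh
      rw [hT] at hh ⊢
      obtain ⟨v, h1, h2⟩ := hh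
      exact ⟨f v, h2, by rw [(hf v).1, h1, flip_flip]⟩
    · intro F c G d hne hp
      obtain ⟨v, hv⟩ := H3 F c G d hne hp
      have hnb : ¬ ((T f F c).isSome = true ∧ (T f G d).isSome = true) := by
        rw [hTs, hTs]
        rintro ⟨⟨h, v1, a1, b1⟩, ⟨k, v2, a2, b2⟩⟩
        have : v1 = v2 := he (a1.trans (hp.trans a2.symm))
        subst this
        exact hne (pos_edge hp (b1.symm.trans b2)).1
      have hor : (T f F c).isSome = true ∨ (T f G d).isSome = true := by
        rw [hTs, hTs]
        obtain ⟨K, x, h, q1, q2⟩ := H5 v (f v) (hf v).2.2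
        rcases pos_three hp (hv.symm.trans q1) with h0 | h0 | h0
        · exact absurd h0 hne
        · simp only [Prod.mk.injEq] at h0
          obtain ⟨rfl, rfl⟩ := h0
          exact Or.inl ⟨h, v, q1, q2⟩
        · simp only [Prod.mk.injEq] at h0
          obtain ⟨rfl, rfl⟩ := h0
          exact Or.inr ⟨h, v, q1, q2⟩
      change (T f G d).isSome = !(T f F c).isSome
      revert hnb hor
      generalize (T f F c).isSome = p
      generalize (T f G d).isSome = q
      cases p <;> cases q <;> simp
    · intro F c hal
      have h4 := H4 F c hal
      rw [Bool.eq_iff_iff, ← h4, hTs]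
      constructor
      · rintro ⟨h, v, a, -⟩; exact ⟨v, a⟩
      · rintro ⟨v, hv⟩
        obtain ⟨K, x, h, q1, q2⟩ := H5 v (f v) (hf v).2.2
        have h0 := hal K x (q1.symm.trans hv)
        simp only [Prod.mk.injEq] at h0
        obtain ⟨rfl, rfl⟩ := h0
        exact ⟨h, v, q1, q2⟩
  · intro f hf g hg hfg
    simp only [Finset.mem_filter, Finset.mem_univ, true_and] at hf hg
    funext v
    obtain ⟨K, x, h, q1, q2⟩ := H5 v (f v) (hf v).2.2
    have h1 : T f K x = some h := (hT _ _ _ _).2 ⟨v, q1, q2⟩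
    have h2 : T g K x = some h := by rw [← h1]; exact (congrFun (congrFun hfg K) x).symm
    obtain ⟨u, r1, r2⟩ := (hT _ _ _ _).1 h2
    have : u = v := he (r1.trans q1.symm)
    subst this
    exact he (q2.trans r2.symm)
  · intro τ hτ
    simp only [Finset.mem_filter, Finset.mem_univ, true_and] at hτ
    obtain ⟨hl, hc1, hc2⟩ := hτ
    simp only at hc1 hc2
    -- active corner exists
    have hex : ∀ v, ∃ F c h, e v = pos m F c ∧ τ F c = some h := by
      intro v
      obtain ⟨F, c, hv⟩ := H6 v
      by_cases hal : ∀ G d, pos m G d = pos m F c → (G, d) = (F, c)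
      · have := hc2 F c hal
        rw [(H4 F c hal).1 ⟨v, hv⟩, Option.isSome_iff_exists] at this
        obtain ⟨h, hh⟩ := this
        exact ⟨F, c, h, hv, hh⟩
      · push Not at hal
        obtain ⟨G, d, hp, hne⟩ := hal
        have h1 := hc1 F c G d hne.symm hp.symm
        cases hF : τ F c with
        | some h => exact ⟨F, c, h, hv, hF⟩
        | none =>
          rw [hF] at h1
          simp only [Option.isSome_none, Bool.not_false] at h1
          rw [Option.isSome_iff_exists] at h1
          obtain ⟨h, hh⟩ := h1
          exact ⟨G, d, h, hv.trans hp.symm, hh⟩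
    have huniq : ∀ F c G d h k, pos m F c = pos m G d → τ F c = some h → τ G d = some k →
        (F, c) = (G, d) := by
      intro F c G d h k hp h1 h2
      by_contra hne
      have := hc1 F c G d hne hp
      rw [h1, h2] at this
      simp at this
    have hpos : ∀ F c h, τ F c = some h → ∃ v, e v = pos m F c := by
      intro F c h hh
      by_cases hal : ∀ G d, pos m G d = pos m F c → (G, d) = (F, c)
      · refine (H4 F c hal).2 ?_
        rw [← hc2 F c hal, hh]; rfl
      · push Not at hal
        obtain ⟨G, d, hp, hne⟩ := hal
        exact H3 F c G d hne.symm hp.symm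
    have hf : ∀ v, ∃ u, ∃ F c h, e v = pos m F c ∧ τ F c = some h ∧ e u = pos m F (flip h c) := by
      intro v
      obtain ⟨F, c, h, h1, h2⟩ := hex v
      obtain ⟨u, hu⟩ := hpos F (flip h c) h (hl F c h h2)
      exact ⟨u, F, c, h, h1, h2, hu⟩
    choose f hf using hf
    refine ⟨f, ?_, ?_⟩
    · simp only [Finset.mem_filter, Finset.mem_univ, true_and]
      intro v
      obtain ⟨F, c, h, h1, h2, h3⟩ := hf v
      have ha : gadj (e v) (e (f v)) := by rw [h1, h3]; exact gadj_flip F c h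
      refine ⟨?_, ?_, (hadj _ _).2 ha⟩
      · obtain ⟨G, d, k, g1, g2, g3⟩ := hf (f v)
        have h4 := hl F c h h2
        have h5 := huniq _ _ _ _ _ _ (h3.symm.trans g1) h4 g2
        simp only [Prod.mk.injEq] at h5
        obtain ⟨rfl, rfl⟩ := h5
        have : h = k := by rw [h4] at g2; exact Option.some.inj g2
        subst this
        apply he
        rw [g3, h1, flip_flip]
      · intro h0
        rw [h0] at ha
        unfold gadj at ha
        omega
    · funext F c
      have key : ∀ h, T f F c = some h ↔ τ F c = some h := by
        intro h
        rw [hT]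
        constructor
        · rintro ⟨v, h1, h2⟩
          obtain ⟨G, d, k, g1, g2, g3⟩ := hf v
          have h5 := pos_edge (h1.symm.trans g1) (h2.symm.trans g3)
          simp only [Prod.mk.injEq] at h5
          obtain ⟨⟨rfl, rfl⟩, rfl⟩ := h5
          exact g2
        · intro hh
          obtain ⟨v, hv⟩ := hpos F c h hh
          obtain ⟨G, d, k, g1, g2, g3⟩ := hf v
          have h5 := huniq _ _ _ _ _ _ (hv.symm.trans g1) hh g2
          simp only [Prod.mk.injEq] at h5
          obtain ⟨rfl, rfl⟩ := h5
          have : h = k := by rw [hh] at g2; exact Option.some.inj g2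
          subst this
          exact ⟨v, g1, g3⟩
      exact Option.ext key

open Classical in
/-- number of consistent local data -/
noncomputable def Z (m : ℕ) (B : Bool) : ℕ :=
  (Finset.univ.filter fun τ : Face m → Corner → Option Bool =>
      (∀ F, Loc (τ F)) ∧ Cond m B (fun F c => (τ F c).isSome)).card

open Classical in
lemma Z_eq (m : ℕ) (B : Bool) :
    Z m B = ∑ σ ∈ Finset.univ.filter (fun σ : Face m → Corner → Bool => Cond m B σ),
      ∏ F, w (σ F) := by
  unfold Z
  rw [Finset.card_eq_sum_card_fiberwise (f := fun τ : Face m → Corner → Option Bool =>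
    fun F c => (τ F c).isSome)
    (t := Finset.univ.filter (fun σ : Face m → Corner → Bool => Cond m B σ))]
  · refine Finset.sum_congr rfl fun σ hσ => ?_
    simp only [Finset.mem_filter, Finset.mem_univ, true_and] at hσ
    unfold w
    rw [← Fintype.card_piFinset]
    congr 1
    ext τ
    simp only [Finset.mem_filter, Finset.mem_univ, true_and, Fintype.mem_piFinset]
    constructor
    · rintro ⟨⟨h1, -⟩, h3⟩ F
      exact ⟨h1 F, congrFun h3 F⟩
    · intro h
      have h3 : (fun F c => (τ F c).isSome) = σ := funext fun F => (h F).2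
      exact ⟨⟨fun F => (h F).1, by rw [h3]; exact hσ⟩, h3⟩
  · intro τ hτ
    simp at hτ ⊢
    exact hτ.2

lemma Cond_not {m : ℕ} {B : Bool} {σ : Face m → Corner → Bool} (h : Cond m B σ) :
    Cond m (!B) (fun F c => !(σ F c)) := by
  refine ⟨fun F c G d h1 h2 => ?_, fun F c h1 => ?_⟩
  · simp only [h.1 F c G d h1 h2]
  · simp only [h.2 F c h1]

lemma sum_line (n : ℕ) (f g : Fin (n + 1) → ℕ) (h0 : f 0 = 1) (h1 : g (Fin.last n) = 1)
    (h : ∀ i : Fin n, f i.succ + g i.castSucc = 1) : ∑ i, f i + ∑ i, g i = n + 2 := by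
  rw [Fin.sum_univ_succ, Fin.sum_univ_castSucc, h0, h1]
  have : ∑ i : Fin n, f i.succ + ∑ i : Fin n, g i.castSucc = n := by
    rw [← Finset.sum_add_distrib]
    simp [h]
  omega

lemma alone {m : ℕ} {F : Face m} {c : Corner}
    (h : ∀ G d, pos m G d = pos m F c → d ≠ c → False) :
    ∀ G d, pos m G d = pos m F c → (G, d) = (F, c) := by
  intro G d hp
  by_cases hd : d = c
  · subst hd
    have : G = F := by
      simp only [pos, Prod.mk.injEq] at hp
      exact face_ext (by omega) (by omega)
    rw [this]
  · exact (h G d hp hd).elim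

lemma total {n : ℕ} {σ : Face (n + 1) → Corner → Bool} (h : Cond (n + 1) true σ) :
    ∑ F, ∑ c, (σ F c).toNat = 2 * ((n + 1) * (n + 2)) := by
  have hA : ∀ b : Fin (n + 1), ∑ a, (σ (a, b) (false, false)).toNat
      + ∑ a, (σ (a, b) (true, true)).toNat = n + 2 := by
    intro b
    apply sum_line
    · rw [h.2 (0, b) (false, false)]; · rfl
      apply alone
      rintro ⟨a', b'⟩ ⟨d1, d2⟩ hp hd
      cases d1 <;> cases d2 <;> simp [pos, bi] at hp hd <;> omega
    · rw [h.2 (Fin.last n, b) (true, true)]; · rfl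
      apply alone
      rintro ⟨a', b'⟩ ⟨d1, d2⟩ hp hd
      cases d1 <;> cases d2 <;> simp [pos, bi] at hp hd <;> omega
    · intro i
      rw [h.1 (i.succ, b) (false, false) (i.castSucc, b) (true, true) (by simp)
        (by simp [pos, bi]; constructor <;> ring)]
      cases σ (i.succ, b) (false, false) <;> rfl
  have hB : ∀ a : Fin (n + 1), ∑ b, (σ (a, b) (false, true)).toNat
      + ∑ b, (σ (a, b) (true, false)).toNat = n + 2 := by
    intro a
    apply sum_line
    · rw [h.2 (a, 0) (false, true)]; · rfl
      apply alone
      rintro ⟨a', b'⟩ ⟨d1, d2⟩ hp hd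
      cases d1 <;> cases d2 <;> simp [pos, bi] at hp hd <;> omega
    · rw [h.2 (a, Fin.last n) (true, false)]; · rfl
      apply alone
      rintro ⟨a', b'⟩ ⟨d1, d2⟩ hp hd
      cases d1 <;> cases d2 <;> simp [pos, bi] at hp hd <;> omega
    · intro i
      rw [h.1 (a, i.succ) (false, true) (a, i.castSucc) (true, false) (by simp)
        (by simp [pos, bi]; constructor <;> ring)]
      cases σ (a, i.succ) (false, true) <;> rfl
  have hc : ∀ F, ∑ c, (σ F c).toNat = ((σ F (false, false)).toNat + (σ F (true, true)).toNat) +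
      ((σ F (false, true)).toNat + (σ F (true, false)).toNat) := by
    intro F
    rw [Fintype.sum_prod_type]
    simp
    ring
  simp only [hc]
  rw [Finset.sum_add_distrib]
  have h1 : ∑ F, ((σ F (false, false)).toNat + (σ F (true, true)).toNat) = (n + 1) * (n + 2) := by
    rw [Fintype.sum_prod_type_right]
    simp only [Finset.sum_add_distrib]
    rw [← Finset.sum_add_distrib]
    simp [hA]
  have h2 : ∑ F, ((σ F (false, true)).toNat + (σ F (true, false)).toNat) = (n + 1) * (n + 2) := by
    rw [Fintype.sum_prod_type]
    simp only [Finset.sum_add_distrib]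
    rw [← Finset.sum_add_distrib]
    simp [hB]
  rw [h1, h2]; ring

lemma prod_w {n : ℕ} {σ : Face (n + 1) → Corner → Bool} (h : Cond (n + 1) true σ) :
    ∏ F, w (σ F) = 2 ^ (n + 1) * ∏ F, w (fun c => !(σ F c)) := by
  have h1 : ∏ F, (w (σ F) ^ 2 * 4) =
      ∏ F, (w (fun c => !(σ F c)) ^ 2 * 2 ^ (∑ c, (σ F c).toNat)) :=
    Finset.prod_congr rfl fun F _ => w_compl _
  rw [Finset.prod_mul_distrib, Finset.prod_mul_distrib, Finset.prod_pow, Finset.prod_pow,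
    Finset.prod_pow_eq_pow_sum, total h] at h1
  simp only [Finset.prod_const, Finset.card_univ, Fintype.card_prod, Fintype.card_fin] at h1
  have h4 : (4 : ℕ) ^ ((n + 1) * (n + 1)) = 2 ^ (2 * ((n + 1) * (n + 1))) := by
    rw [pow_mul 2 2]; norm_num
  have h5 : (2 : ℕ) ^ (2 * ((n + 1) * (n + 2))) =
      (2 ^ (n + 1)) ^ 2 * 2 ^ (2 * ((n + 1) * (n + 1))) := by
    rw [← pow_mul, ← pow_add]; congr 1; ring
  rw [h4, h5, ← mul_assoc (_ ^ 2) (_ ^ 2)] at h1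
  have hp : 0 < (2 : ℕ) ^ (2 * ((n + 1) * (n + 1))) := by positivity
  have h6 := Nat.eq_of_mul_eq_mul_right hp h1
  rw [← mul_pow] at h6
  have := Nat.pow_left_injective (n := 2) (by norm_num) h6
  rw [this, mul_comm]

lemma Z_step (n : ℕ) : Z (n + 1) true = 2 ^ (n + 1) * Z (n + 1) false := by
  classical
  rw [Z_eq, Z_eq, Finset.mul_sum]
  refine Finset.sum_bij' (fun σ _ => fun F c => !(σ F c)) (fun σ _ => fun F c => !(σ F c))
    ?_ ?_ ?_ ?_ ?_
  · intro σ hσ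
    simp only [Finset.mem_filter, Finset.mem_univ, true_and] at hσ ⊢
    exact Cond_not hσ
  · intro σ hσ
    simp only [Finset.mem_filter, Finset.mem_univ, true_and] at hσ ⊢
    exact Cond_not hσ
  · intro σ _; simp
  · intro σ _; simp
  · intro σ hσ
    simp only [Finset.mem_filter, Finset.mem_univ, true_and] at hσ
    exact prod_w hσ

lemma abs_four (x y k : ℤ) : |x| + |y| ≤ k ↔
    x + y ≤ k ∧ x - y ≤ k ∧ -x + y ≤ k ∧ -x - y ≤ k := by
  rcases abs_cases x with ⟨h, _⟩ | ⟨h, _⟩ <;> rcases abs_cases y with ⟨h', _⟩ | ⟨h', _⟩ <;>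
    rw [h, h'] <;> omega

/-- embedding of the cells into the integer grid -/
def emb (N k : ℕ) (v : AztecCell N) : ℤ × ℤ :=
  (((v.1.1 : ℕ) : ℤ) + k, ((v.1.2 : ℕ) : ℤ) + k)

/-- membership in the shifted diamond -/
def InD (N k : ℕ) (p : ℤ × ℤ) : Prop :=
  2 * p.1 + 2 * p.2 ≤ 6 * N + 2 + 4 * k ∧ 2 * p.1 - 2 * p.2 ≤ 2 * N ∧
  2 * p.2 - 2 * p.1 ≤ 2 * N ∧ 2 * N + 2 + 4 * k ≤ 2 * p.1 + 2 * p.2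

lemma emb_range (N k : ℕ) (p : ℤ × ℤ) : (∃ v, emb N k v = p) ↔ InD N k p := by
  obtain ⟨x, y⟩ := p
  unfold InD
  constructor
  · rintro ⟨⟨⟨i, j⟩, h1, h2, h3⟩, hv⟩
    rw [abs_four] at h3
    simp only [emb, Prod.mk.injEq] at hv h1 h2 h3 ⊢
    omega
  · intro h
    simp only at h
    refine ⟨⟨(⟨(x - k).toNat, by omega⟩, ⟨(y - k).toNat, by omega⟩), ?_, ?_, ?_⟩, ?_⟩
    · simp only; omega
    · simp only; omega
    · rw [abs_four]; simp only; omega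
    · simp only [emb, Prod.mk.injEq]; omega

lemma mk_slot (m : ℕ) (x y : ℤ) (c : Corner) (a b : ℤ) (ha : 0 ≤ a) (ha' : a < m) (hb : 0 ≤ b)
    (hb' : b < m) (hx : x = a + b + 1 + bi c.1) (hy : y = m + a - b + bi c.2) :
    ∃ F : Face m, (x, y) = pos m F c ∧ (F.1 : ℤ) = a ∧ (F.2 : ℤ) = b := by
  refine ⟨(⟨a.toNat, by omega⟩, ⟨b.toNat, by omega⟩), ?_, ?_, ?_⟩
  · simp only [pos, Prod.mk.injEq]; omega
  · simp only; omega
  · simp only; omega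

lemma aztec_eq_Z (N k m : ℕ) (B : Bool) (hm : N + k = m)
    (hB : (k = 0 ∧ B = true) ∨ (k = 1 ∧ B = false)) : aztecMatchingCount N = Z m B := by
  classical
  have hinj : Function.Injective (emb N k) := by
    rintro ⟨⟨i, j⟩, h1⟩ ⟨⟨i', j'⟩, h2⟩ h
    simp only [emb, Prod.mk.injEq] at h
    apply Subtype.ext
    exact Prod.ext (Fin.ext (by simp only; omega)) (Fin.ext (by simp only; omega))
  have hadj : ∀ v u : AztecCell N, aztecAdj v u ↔ gadj (emb N k v) (emb N k u) := by
    intro v u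
    simp only [aztecAdj, gadj, emb, Fin.ext_iff]
    omega
  have hD : ∀ v, InD N k (emb N k v) := fun v => (emb_range N k _).1 ⟨v, rfl⟩
  have hslot : ∀ p q : ℤ × ℤ, InD N k p → InD N k q → gadj p q →
      ∃ F c h, p = pos m F c ∧ q = pos m F (flip h c) := by
    rintro ⟨x, y⟩ ⟨x', y'⟩ hp hq hg
    simp only [InD] at hp hq
    simp only [gadj] at hg
    have main : ∀ (c : Corner) (h : Bool), x' = x + bi (flip h c).1 - bi c.1 →
        y' = y + bi (flip h c).2 - bi c.2 →
        (x - 1 - bi c.1 + (y - m - bi c.2)) % 2 = 0 →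
        ∃ F c h, (x, y) = pos m F c ∧ (x', y') = pos m F (flip h c) := by
      intro c h hx hy hpar
      obtain ⟨F, hF, ha, hb⟩ := mk_slot m x y c ((x - 1 - bi c.1 + (y - m - bi c.2)) / 2)
        ((x - 1 - bi c.1 - (y - m - bi c.2)) / 2)
        (by obtain ⟨c1, c2⟩ := c
            cases c1 <;> cases c2 <;> cases h <;> simp [bi, flip] at hx hy hpar ⊢ <;> omega)
        (by obtain ⟨c1, c2⟩ := c
            cases c1 <;> cases c2 <;> cases h <;> simp [bi, flip] at hx hy hpar ⊢ <;> omega)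
        (by obtain ⟨c1, c2⟩ := c
            cases c1 <;> cases c2 <;> cases h <;> simp [bi, flip] at hx hy hpar ⊢ <;> omega)
        (by obtain ⟨c1, c2⟩ := c
            cases c1 <;> cases c2 <;> cases h <;> simp [bi, flip] at hx hy hpar ⊢ <;> omega)
        (by omega) (by omega)
      refine ⟨F, c, h, hF, ?_⟩
      simp only [pos, Prod.mk.injEq] at hF ⊢
      omega
    have hpar : (x + y + m) % 2 = 1 ∨ (x + y + m) % 2 = 0 := by omega
    rcases hg with ⟨h1, h2 | h2⟩ | ⟨h1, h2 | h2⟩ <;> rcases hpar with h3 | h3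
    · exact main (false, false) false (by simp [bi, flip]; omega) (by simp [bi, flip]; omega)
        (by simp [bi]; omega)
    · exact main (true, false) false (by simp [bi, flip]; omega) (by simp [bi, flip]; omega)
        (by simp [bi]; omega)
    · exact main (true, true) false (by simp [bi, flip]; omega) (by simp [bi, flip]; omega)
        (by simp [bi]; omega)
    · exact main (false, true) false (by simp [bi, flip]; omega) (by simp [bi, flip]; omega)
        (by simp [bi]; omega)
    · exact main (false, false) true (by simp [bi, flip]; omega) (by simp [bi, flip]; omega)
        (by simp [bi]; omega)
    · exact main (false, true) true (by simp [bi, flip]; omega) (by simp [bi, flip]; omega)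
        (by simp [bi]; omega)
    · exact main (true, true) true (by simp [bi, flip]; omega) (by simp [bi, flip]; omega)
        (by simp [bi]; omega)
    · exact main (true, false) true (by simp [bi, flip]; omega) (by simp [bi, flip]; omega)
        (by simp [bi]; omega)
  unfold aztecMatchingCount Z
  have := bij (V := AztecCell N) aztecAdj m B (emb N k) hinj hadj ?_ ?_ ?_ ?_
  · rw [← this]
    congr!
  · rintro ⟨⟨a, ha⟩, ⟨b, hb⟩⟩ ⟨c1, c2⟩ ⟨⟨a', ha'⟩, ⟨b', hb'⟩⟩ ⟨d1, d2⟩ hne hp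
    rw [emb_range]
    simp only [ne_eq, Prod.mk.injEq, Fin.mk.injEq] at hne
    simp only [pos, Prod.mk.injEq] at hp
    simp only [InD, pos]
    cases c1 <;> cases c2 <;> cases d1 <;> cases d2 <;> simp [bi] at hne hp ⊢ <;> omega
  · rintro ⟨⟨a, ha⟩, ⟨b, hb⟩⟩ ⟨c1, c2⟩ hal
    rw [emb_range]
    rcases hB with ⟨rfl, rfl⟩ | ⟨rfl, rfl⟩
    · simp only [InD, pos, iff_true]
      cases c1 <;> cases c2 <;> simp [bi] <;> omega
    · simp only [InD, pos, Bool.false_eq_true, iff_false]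
      intro hin
      cases c1 <;> cases c2
      · have h1 : 1 ≤ a := by simp [bi] at hin; omega
        have := hal (⟨a - 1, by omega⟩, ⟨b, hb⟩) (true, true)
          (by simp [pos, bi]; omega)
        simp at this
      · have h1 : 1 ≤ b := by simp [bi] at hin; omega
        have := hal (⟨a, ha⟩, ⟨b - 1, by omega⟩) (true, false)
          (by simp [pos, bi]; omega)
        simp at this
      · have h1 : b + 1 < m := by simp [bi] at hin; omega
        have := hal (⟨a, ha⟩, ⟨b + 1, by omega⟩) (false, true)
          (by simp [pos, bi]; omega)
        simp at this
      · have h1 : a + 1 < m := by simp [bi] at hin; omega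
        have := hal (⟨a + 1, by omega⟩, ⟨b, hb⟩) (false, false)
          (by simp [pos, bi]; omega)
        simp at this
  · intro v u h
    exact hslot _ _ (hD v) (hD u) ((hadj v u).1 h)
  · intro v
    have h := hD v
    generalize emb N k v = p at h
    obtain ⟨x, y⟩ := p
    have hq : ∃ q, InD N k q ∧ gadj (x, y) q := by
      simp only [InD] at h
      by_cases h1 : x ≤ N + k
      · exact ⟨(x + 1, y), by simp only [InD]; omega, by simp [gadj]⟩
      · exact ⟨(x - 1, y), by simp only [InD]; omega, by simp [gadj]⟩
    obtain ⟨q, h1, h2⟩ := hq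
    obtain ⟨F, c, _, h3, _⟩ := hslot _ _ h h1 h2
    exact ⟨F, c, h3⟩

end AztecProof

/-- The Aztec diamond graph of order `n` has `2^(n(n+1)/2)` perfect matchings. -/
theorem aztecMatchingCount_eq (n : ℕ) :
    aztecMatchingCount n = 2 ^ (n * (n + 1) / 2) := by
  induction n with
  | zero => decide +kernel
  | succ n ih =>
    rw [AztecProof.aztec_eq_Z (n + 1) 0 (n + 1) true (by simp) (by simp), AztecProof.Z_step,
      ← AztecProof.aztec_eq_Z n 1 (n + 1) false rfl (by simp), ih, ← pow_add]
    congr 1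
    have : (n + 1) * (n + 1 + 1) = n * (n + 1) + (n + 1) * 2 := by ring
    rw [this, Nat.add_mul_div_right _ _ (by norm_num), add_comm]
end

section
/- Let M be the 2n-by-2n matrix with m_{i,j} = 1 when |2i−2n−1| + |2j−2n−1| ≤ 2n and m_{i,j} = 0 otherwise. Then the (+1)-determinant of M, computed by the Robbins–Rumsey recursion with λ = 1 and with the convention 0/0 = 0, equals the number of domino tilings of the 2n-by-2n square. -/
/-- The Robbins–Rumsey `λ`-determinant recursion. Note that in Lean division by zero
yields zero, so the convention `0/0 = 0` is built in. -/
def lamDet {F : Type*} [Field F] (lam : F) : (n : ℕ) → Matrix (Fin n) (Fin n) F → F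
  | 0, _ => 1
  | 1, M => M 0 0
  | (n + 2), M =>
      (lamDet lam (n + 1) (M.submatrix Fin.castSucc Fin.castSucc) *
         lamDet lam (n + 1) (M.submatrix Fin.succ Fin.succ) +
       lam * lamDet lam (n + 1) (M.submatrix Fin.castSucc Fin.succ) *
         lamDet lam (n + 1) (M.submatrix Fin.succ Fin.castSucc)) /
      lamDet lam n (M.submatrix (fun i => i.succ.castSucc) (fun j => j.succ.castSucc))

/-! ### Part 1: the octahedron recursion in rotated coordinates -/

/-- Octahedron recursion with Dirichlet boundary condition on the square `[-n,n]²`. -/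
def oct (n : ℤ) : ℕ → ℤ → ℤ → ℚ
  | 0, _, _ => 1
  | 1, p, q => if (-n ≤ p ∧ p ≤ n) ∧ (-n ≤ q ∧ q ≤ n) then 1 else 0
  | (s + 2), p, q =>
      (oct n (s + 1) (p - 1) q * oct n (s + 1) (p + 1) q +
        oct n (s + 1) p (q - 1) * oct n (s + 1) p (q + 1)) / oct n s p q

/-- The 0-1 matrix of the theorem, extended to all integer indices. -/
def aztecEntry (n : ℕ) (i j : ℤ) : ℚ :=
  if |2 * i + 1 - 2 * n| + |2 * j + 1 - 2 * n| ≤ 2 * n then 1 else 0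

theorem lamDet_window (n : ℕ) : ∀ (s : ℕ) (a b : ℤ),
    lamDet (1 : ℚ) s (fun i j => aztecEntry n (a + ((i : ℕ) : ℤ)) (b + ((j : ℕ) : ℤ))) =
      oct n s (a + b + s - 2 * n) (a - b)
  | 0, a, b => by simp [lamDet, oct]
  | 1, a, b => by
      simp only [lamDet, oct, aztecEntry]
      refine if_congr ?_ rfl rfl
      simp only [Fin.val_zero, Nat.cast_zero, add_zero, Nat.cast_one]
      constructor
      · intro h
        have h1 := le_abs_self (2 * a + 1 - 2 * (n : ℤ))
        have h2 := neg_abs_le (2 * a + 1 - 2 * (n : ℤ))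
        have h3 := le_abs_self (2 * b + 1 - 2 * (n : ℤ))
        have h4 := neg_abs_le (2 * b + 1 - 2 * (n : ℤ))
        omega
      · intro h
        rcases abs_cases (2 * a + 1 - 2 * (n : ℤ)) with h1 | h1 <;>
        rcases abs_cases (2 * b + 1 - 2 * (n : ℤ)) with h2 | h2 <;> omega
  | (s + 2), a, b => by
      have e1 := lamDet_window n (s + 1) a b
      have e2 := lamDet_window n (s + 1) (a + 1) (b + 1)
      have e3 := lamDet_window n (s + 1) a (b + 1)
      have e4 := lamDet_window n (s + 1) (a + 1) b
      have e5 := lamDet_window n s (a + 1) (b + 1)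
      simp only [lamDet, oct]
      have f1 : Matrix.submatrix (fun (i j : Fin (s + 2)) => aztecEntry n (a + ((i : ℕ) : ℤ))
          (b + ((j : ℕ) : ℤ))) Fin.castSucc Fin.castSucc =
          (fun (i j : Fin (s + 1)) => aztecEntry n (a + ((i : ℕ) : ℤ)) (b + ((j : ℕ) : ℤ))) := by
        ext i j; simp [Matrix.submatrix]
      have f2 : Matrix.submatrix (fun (i j : Fin (s + 2)) => aztecEntry n (a + ((i : ℕ) : ℤ))
          (b + ((j : ℕ) : ℤ))) Fin.succ Fin.succ =
          (fun (i j : Fin (s + 1)) => aztecEntry n (a + 1 + ((i : ℕ) : ℤ)) (b + 1 + ((j : ℕ) : ℤ))) := by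
        ext i j; simp only [Matrix.submatrix, Matrix.of_apply, Fin.val_succ]; congr 1 <;> push_cast <;> ring
      have f3 : Matrix.submatrix (fun (i j : Fin (s + 2)) => aztecEntry n (a + ((i : ℕ) : ℤ))
          (b + ((j : ℕ) : ℤ))) Fin.castSucc Fin.succ =
          (fun (i j : Fin (s + 1)) => aztecEntry n (a + ((i : ℕ) : ℤ)) (b + 1 + ((j : ℕ) : ℤ))) := by
        ext i j; simp only [Matrix.submatrix, Matrix.of_apply, Fin.val_succ, Fin.val_castSucc]; congr 1; push_cast; ring
      have f4 : Matrix.submatrix (fun (i j : Fin (s + 2)) => aztecEntry n (a + ((i : ℕ) : ℤ))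
          (b + ((j : ℕ) : ℤ))) Fin.succ Fin.castSucc =
          (fun (i j : Fin (s + 1)) => aztecEntry n (a + 1 + ((i : ℕ) : ℤ)) (b + ((j : ℕ) : ℤ))) := by
        ext i j; simp only [Matrix.submatrix, Matrix.of_apply, Fin.val_succ, Fin.val_castSucc]; congr 1; push_cast; ring
      have f5 : Matrix.submatrix (fun (i j : Fin (s + 2)) => aztecEntry n (a + ((i : ℕ) : ℤ))
          (b + ((j : ℕ) : ℤ))) (fun i : Fin s => i.succ.castSucc) (fun j : Fin s => j.succ.castSucc) =
          (fun (i j : Fin s) => aztecEntry n (a + 1 + ((i : ℕ) : ℤ)) (b + 1 + ((j : ℕ) : ℤ))) := by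
        ext i j; simp only [Matrix.submatrix, Matrix.of_apply, Fin.val_succ, Fin.val_castSucc]; congr 1 <;> push_cast <;> ring
      rw [f1, f2, f3, f4, f5, e1, e2, e3, e4, e5]
      have g1 : a + b + ((s + 1 : ℕ) : ℤ) - 2 * n = a + b + ((s + 2 : ℕ) : ℤ) - 2 * n - 1 := by
        push_cast; ring
      have g2 : a + 1 + (b + 1) + ((s + 1 : ℕ) : ℤ) - 2 * n =
        a + b + ((s + 2 : ℕ) : ℤ) - 2 * n + 1 := by push_cast; ring
      have g3 : a + (b + 1) + ((s + 1 : ℕ) : ℤ) - 2 * n =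
        a + b + ((s + 2 : ℕ) : ℤ) - 2 * n := by push_cast; ring
      have g4 : a + 1 + b + ((s + 1 : ℕ) : ℤ) - 2 * n =
        a + b + ((s + 2 : ℕ) : ℤ) - 2 * n := by push_cast; ring
      have g5 : a + 1 + (b + 1) + (s : ℤ) - 2 * n =
        a + b + ((s + 2 : ℕ) : ℤ) - 2 * n := by push_cast; ring
      have g6 : a + 1 - (b + 1) = a - b := by ring
      have g7 : a - (b + 1) = a - b - 1 := by ring
      have g8 : a + 1 - b = a - b + 1 := by ring
      rw [g1, g2, g3, g4, g5, g6, g7, g8, one_mul]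

theorem oct_zero (n : ℤ) : ∀ (s : ℕ) (p q : ℤ), 1 ≤ s →
    ¬ ((-n ≤ p ∧ p ≤ n) ∧ (-n ≤ q ∧ q ≤ n)) → oct n s p q = 0
  | 0, _, _, h, _ => by omega
  | 1, p, q, _, h => by simp only [oct]; rw [if_neg h]
  | 2, p, q, _, h => by
      simp only [oct]
      have A : ¬ (((-n ≤ p - 1 ∧ p - 1 ≤ n) ∧ (-n ≤ q ∧ q ≤ n)) ∧
          ((-n ≤ p + 1 ∧ p + 1 ≤ n) ∧ (-n ≤ q ∧ q ≤ n))) := by omega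
      have B : ¬ (((-n ≤ p ∧ p ≤ n) ∧ (-n ≤ q - 1 ∧ q - 1 ≤ n)) ∧
          ((-n ≤ p ∧ p ≤ n) ∧ (-n ≤ q + 1 ∧ q + 1 ≤ n))) := by omega
      rw [ite_zero_mul_ite_zero, ite_zero_mul_ite_zero, if_neg A, if_neg B]
      simp
  | (s + 3), p, q, _, h => by
      simp only [oct]
      rw [show oct n (s + 1) p q = 0 from oct_zero n (s + 1) p q (by omega) h, div_zero]

theorem oct_pos (n : ℤ) : ∀ (s : ℕ) (p q : ℤ), (-n ≤ p ∧ p ≤ n) → (-n ≤ q ∧ q ≤ n) →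
    -(2 * n - s) ≤ p + q → p + q ≤ 2 * n - s → -(2 * n - s) ≤ p - q → p - q ≤ 2 * n - s →
    0 < oct n s p q
  | 0, _, _, _, _, _, _, _, _ => by simp [oct]
  | 1, p, q, h1, h2, _, _, _, _ => by simp only [oct]; rw [if_pos ⟨h1, h2⟩]; norm_num
  | (s + 2), p, q, h1, h2, h3, h4, h5, h6 => by
      have nn : ∀ a b : ℤ, -(2 * n - ((s + 1 : ℕ) : ℤ)) ≤ a + b → a + b ≤ 2 * n - ((s + 1 : ℕ) : ℤ) →
          -(2 * n - ((s + 1 : ℕ) : ℤ)) ≤ a - b → a - b ≤ 2 * n - ((s + 1 : ℕ) : ℤ) →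
          0 ≤ oct n (s + 1) a b := by
        intro a b k1 k2 k3 k4
        by_cases hin : (-n ≤ a ∧ a ≤ n) ∧ (-n ≤ b ∧ b ≤ n)
        · exact (oct_pos n (s + 1) a b hin.1 hin.2 k1 k2 k3 k4).le
        · rw [oct_zero n (s + 1) a b (by omega) hin]
      have hd : 0 < oct n s p q := by
        apply oct_pos n s p q h1 h2 <;> push_cast at * <;> omega
      simp only [oct]
      apply div_pos _ hd
      by_cases hp : -n < p ∧ p < n
      · apply add_pos_of_pos_of_nonneg
        · apply mul_pos <;> apply oct_pos n (s + 1) <;> push_cast at * <;> omega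
        · apply mul_nonneg <;> apply nn <;> push_cast at * <;> omega
      · apply add_pos_of_nonneg_of_pos
        · apply mul_nonneg <;> apply nn <;> push_cast at * <;> omega
        · apply mul_pos <;> apply oct_pos n (s + 1) <;> push_cast at * <;> omega

/-! ### Part 2: tilings as sets of (midpoints of) dominoes, in doubled coordinates

Lattice points are stored undoubled as pairs `v`; cells are odd-odd points, and dominoes are
represented by the midpoint of the unit segment shared by the two cells. -/

/-- The four unit directions. -/
def dd : Fin 4 → ℤ × ℤ
  | 0 => (1, 0)
  | 1 => (0, 1)
  | 2 => (-1, 0)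
  | 3 => (0, -1)

/-- The `k`-th edge at the lattice point `v`. -/
def ee (v : ℤ × ℤ) (k : Fin 4) : ℤ × ℤ := (2 * v.1 + (dd k).1, 2 * v.2 + (dd k).2)

/-- The `k`-th cell at the lattice point `v`. -/
def cc (v : ℤ × ℤ) : Fin 4 → ℤ × ℤ
  | 0 => (2 * v.1 + 1, 2 * v.2 + 1)
  | 1 => (2 * v.1 - 1, 2 * v.2 + 1)
  | 2 => (2 * v.1 - 1, 2 * v.2 - 1)
  | 3 => (2 * v.1 + 1, 2 * v.2 - 1)

/-- `e` is a domino with both cells in `R`. -/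
def edgeOK (R : Finset (ℤ × ℤ)) (e : ℤ × ℤ) : Prop :=
  (e.1 % 2 = 1 ∧ e.2 % 2 = 0 ∧ (e.1, e.2 + 1) ∈ R ∧ (e.1, e.2 - 1) ∈ R) ∨
  (e.1 % 2 = 0 ∧ e.2 % 2 = 1 ∧ (e.1 + 1, e.2) ∈ R ∧ (e.1 - 1, e.2) ∈ R)

/-- `M` is a domino tiling of the region `R`. -/
def IsTiling (R M : Finset (ℤ × ℤ)) : Prop :=
  (∀ e ∈ M, edgeOK R e) ∧ ∀ c ∈ R, ∃! k : Fin 4, c + dd k ∈ M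

open Classical in
/-- The finite set of tilings of `R`. -/
noncomputable def tilings (R : Finset (ℤ × ℤ)) : Finset (Finset (ℤ × ℤ)) :=
  ((R.biUnion fun c => Finset.univ.image fun k => c + dd k).powerset).filter (IsTiling R)

theorem mem_tilings {R M : Finset (ℤ × ℤ)} : M ∈ tilings R ↔ IsTiling R M := by
  classical
  unfold tilings
  rw [Finset.mem_filter, Finset.mem_powerset]
  refine ⟨fun h => h.2, fun h => ⟨?_, h⟩⟩
  intro e he
  rw [Finset.mem_biUnion]
  rcases h.1 e he with ⟨_, _, h1, _⟩ | ⟨_, _, h1, _⟩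
  · refine ⟨_, h1, ?_⟩
    rw [Finset.mem_image]
    exact ⟨3, Finset.mem_univ _, by simp [dd]⟩
  · refine ⟨_, h1, ?_⟩
    rw [Finset.mem_image]
    exact ⟨2, Finset.mem_univ _, by simp [dd]⟩

/-- Weighted count of tilings. -/
noncomputable def tz (R : Finset (ℤ × ℤ)) (w : ℤ × ℤ → ℚ) : ℚ :=
  ∑ M ∈ tilings R, ∏ e ∈ M, w e

/-- The set `N` of edges at a point covers exactly the set `S` of cells at that point. -/
def Cov (N S : Finset (Fin 4)) : Prop :=
  ∀ j, (j ∈ S ↔ (j ∈ N ∨ j + 1 ∈ N)) ∧ ¬ (j ∈ N ∧ j + 1 ∈ N)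

instance (N S : Finset (Fin 4)) : Decidable (Cov N S) := by unfold Cov; infer_instance

/-- Local weight at a point. -/
def wloc (w : Fin 4 → ℚ) (S : Finset (Fin 4)) : ℚ :=
  ∑ N : Finset (Fin 4), if Cov N S then ∏ k ∈ N, w k else 0

theorem fin4_cases : ∀ k : Fin 4, k = 0 ∨ k = 1 ∨ k = 2 ∨ k = 3 := by decide

theorem ee_inj {v v' : ℤ × ℤ} {k k' : Fin 4} {r : ℤ} (h : (v.1 + v.2 - r) % 2 = 0)
    (h' : (v'.1 + v'.2 - r) % 2 = 0) (e : ee v k = ee v' k') : v = v' ∧ k = k' := by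
  obtain ⟨a, b⟩ := v
  obtain ⟨a', b'⟩ := v'
  rcases fin4_cases k with rfl | rfl | rfl | rfl <;>
  rcases fin4_cases k' with rfl | rfl | rfl | rfl <;>
  simp [ee, dd] at e h h' ⊢ <;> omega

theorem edge_cell {v c : ℤ × ℤ} {k k' : Fin 4} (hc1 : c.1 % 2 = 1) (hc2 : c.2 % 2 = 1)
    (e : ee v k' = c + dd k) :
    (c = cc v k' ∧ k = k' + 3) ∨ (c = cc v (k' + 3) ∧ k = k' + 1) := by
  obtain ⟨a, b⟩ := v
  obtain ⟨x, y⟩ := c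
  rcases fin4_cases k with rfl | rfl | rfl | rfl <;>
  rcases fin4_cases k' with rfl | rfl | rfl | rfl <;>
  simp [ee, dd, cc] at e hc1 hc2 ⊢ <;> omega

theorem ee_eq1 (v : ℤ × ℤ) (j : Fin 4) : ee v j = cc v j + dd (j + 3) := by
  rcases fin4_cases j with rfl | rfl | rfl | rfl <;> simp [ee, dd, cc, sub_eq_add_neg]

theorem ee_eq2 (v : ℤ × ℤ) (j : Fin 4) : ee v (j + 1) = cc v j + dd (j + 2) := by
  rcases fin4_cases j with rfl | rfl | rfl | rfl <;> simp [ee, dd, cc, sub_eq_add_neg]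

theorem edgeOK_ee (R : Finset (ℤ × ℤ)) (v : ℤ × ℤ) (k : Fin 4) :
    edgeOK R (ee v k) ↔ cc v k ∈ R ∧ cc v (k + 3) ∈ R := by
  have p1 : (2 * v.1 + 1) % 2 = 1 := by omega
  have p2 : (2 * v.2 + 1) % 2 = 1 := by omega
  have p3 : (2 * v.1 + -1) % 2 = 1 := by omega
  have p4 : (2 * v.2 + -1) % 2 = 1 := by omega
  rcases fin4_cases k with rfl | rfl | rfl | rfl <;>
  simp [edgeOK, ee, dd, cc, p1, p2, p3, p4, and_comm] <;> simp [sub_eq_add_neg]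

/-- Validity of a family of local cell sets. -/
def Valid (V R : Finset (ℤ × ℤ)) (S : V → Finset (Fin 4)) : Prop :=
  (∀ v k, k ∈ S v → cc v k ∈ R) ∧
    ∀ c ∈ R, ∃! p : V × Fin 4, p.2 ∈ S p.1 ∧ cc p.1 p.2 = c

open Classical in
theorem tz_group (V R : Finset (ℤ × ℤ)) (w : ℤ × ℤ → ℚ) (r : ℤ)
    (hpar : ∀ v ∈ V, (v.1 + v.2 - r) % 2 = 0)
    (hodd : ∀ c ∈ R, c.1 % 2 = 1 ∧ c.2 % 2 = 1)
    (hcov : ∀ e, edgeOK R e → ∃ v ∈ V, ∃ k, ee v k = e) :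
    tz R w = ∑ S : V → Finset (Fin 4), if Valid V R S then
      ∏ v : V, wloc (fun k => w (ee v k)) (S v) else 0 := by
  have inj : ∀ (v v' : V) (k k' : Fin 4), ee v k = ee v' k' → v = v' ∧ k = k' := by
    intro v v' k k' h
    have := ee_inj (hpar v v.2) (hpar v' v'.2) h
    exact ⟨Subtype.ext this.1, this.2⟩
  have step1 : ∀ S : V → Finset (Fin 4),
      (if Valid V R S then ∏ v : V, wloc (fun k => w (ee v k)) (S v) else 0) =
      ∑ N : V → Finset (Fin 4), if Valid V R S ∧ ∀ v, Cov (N v) (S v) then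
        ∏ v : V, ∏ k ∈ N v, w (ee v k) else 0 := by
    intro S
    unfold wloc
    rw [Finset.prod_univ_sum, Fintype.piFinset_univ]
    by_cases hS : Valid V R S
    · simp only [hS, true_and, if_true]
      apply Finset.sum_congr rfl
      intro N _
      rw [Finset.prod_ite_zero]
      simp
    · simp [hS]
  simp_rw [step1]
  rw [← Finset.sum_product', ← Finset.sum_filter]
  unfold tz
  symm
  refine Finset.sum_bij'
    (i := fun p _ => (Finset.univ.sigma p.2).image (fun x : (_ : V) × Fin 4 => ee x.1 x.2))
    (j := fun M _ => (fun v => Finset.univ.filter fun k => ee v k ∈ M ∨ ee v (k + 1) ∈ M,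
      fun v => Finset.univ.filter fun k => ee v k ∈ M)) ?_ ?_ ?_ ?_ ?_
  · rintro ⟨S, N⟩ h
    simp only [Finset.mem_filter, Finset.mem_product, Finset.mem_univ, true_and] at h
    obtain ⟨⟨hV1, hV2⟩, hC⟩ := h
    rw [mem_tilings]
    constructor
    · intro e he
      simp only [Finset.mem_image, Finset.mem_sigma, Finset.mem_univ, true_and] at he
      obtain ⟨⟨v, k⟩, hk, rfl⟩ := he
      rw [edgeOK_ee]
      refine ⟨hV1 v k (((hC v k).1).2 (Or.inl hk)), hV1 v (k + 3) (((hC v (k + 3)).1).2 (Or.inr ?_))⟩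
      have : k + 3 + 1 = k := by rw [add_assoc]; exact add_zero k
      rw [this]; exact hk
    · intro c hc
      obtain ⟨⟨v, j⟩, ⟨hj, hcj⟩, huniq⟩ := hV2 c hc
      simp only at hj hcj
      have key : ∀ y, c + dd y ∈ (Finset.univ.sigma N).image
          (fun x : (_ : V) × Fin 4 => ee x.1 x.2) →
          (y = j + 3 ∧ j ∈ N v) ∨ (y = j + 2 ∧ j + 1 ∈ N v) := by
        intro y hy
        simp only [Finset.mem_image, Finset.mem_sigma, Finset.mem_univ, true_and] at hy
        obtain ⟨⟨v', k'⟩, hk', he⟩ := hy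
        simp only at hk' he
        rcases edge_cell (hodd c hc).1 (hodd c hc).2 he with ⟨h1, h2⟩ | ⟨h1, h2⟩
        · have h3 := huniq (v', k') ⟨((hC v' k').1).2 (Or.inl hk'), h1.symm⟩
          simp only [Prod.mk.injEq] at h3
          obtain ⟨rfl, rfl⟩ := h3
          exact Or.inl ⟨h2, hk'⟩
        · have h4 : k' + 3 + 1 = k' := by rw [add_assoc]; exact add_zero k'
          have h3 := huniq (v', k' + 3)
            ⟨((hC v' (k' + 3)).1).2 (Or.inr (by rw [h4]; exact hk')), h1.symm⟩
          simp only [Prod.mk.injEq] at h3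
          obtain ⟨rfl, rfl⟩ := h3
          right
          rw [h4]
          refine ⟨?_, hk'⟩
          rw [h2, add_assoc]; rfl
      rcases ((hC v j).1).1 hj with h | h
      · refine ⟨j + 3, ?_, ?_⟩
        · simp only [Finset.mem_image, Finset.mem_sigma, Finset.mem_univ, true_and]
          exact ⟨⟨v, j⟩, h, by rw [← hcj]; exact ee_eq1 v j⟩
        · intro y hy
          rcases key y hy with h1 | h1
          · exact h1.1
          · exact absurd ⟨h, h1.2⟩ (hC v j).2
      · refine ⟨j + 2, ?_, ?_⟩
        · simp only [Finset.mem_image, Finset.mem_sigma, Finset.mem_univ, true_and]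
          exact ⟨⟨v, j + 1⟩, h, by rw [← hcj]; exact ee_eq2 v j⟩
        · intro y hy
          rcases key y hy with h1 | h1
          · exact absurd ⟨h1.2, h⟩ (hC v j).2
          · exact h1.1
  · intro M hM
    rw [mem_tilings] at hM
    obtain ⟨hM1, hM2⟩ := hM
    simp only [Finset.mem_filter, Finset.mem_product, Finset.mem_univ, true_and]
    refine ⟨⟨?_, ?_⟩, ?_⟩
    · intro v k hk
      simp only [Finset.mem_filter, Finset.mem_univ, true_and] at hk
      rcases hk with hk | hk
      · exact ((edgeOK_ee R v k).1 (hM1 _ hk)).1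
      · have h := ((edgeOK_ee R v (k + 1)).1 (hM1 _ hk)).2
        have h4 : k + 1 + 3 = k := by rw [add_assoc]; exact add_zero k
        rwa [h4] at h
    · intro c hc
      obtain ⟨y, hy, hyu⟩ := hM2 c hc
      have data : ∀ p : V × Fin 4,
          (p.2 ∈ (Finset.univ.filter fun k => ee p.1 k ∈ M ∨ ee p.1 (k + 1) ∈ M) ∧
            cc p.1 p.2 = c) →
          (ee p.1 p.2 = c + dd y ∧ y = p.2 + 3) ∨ (ee p.1 (p.2 + 1) = c + dd y ∧ y = p.2 + 2) := by
        rintro ⟨v, j⟩ ⟨h1, h2⟩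
        simp only [Finset.mem_filter, Finset.mem_univ, true_and] at h1 h2 ⊢
        rcases h1 with h1 | h1
        · left
          have h3 : ee v j = c + dd (j + 3) := by rw [← h2]; exact ee_eq1 v j
          have h4 := hyu (j + 3) (by show c + dd (j + 3) ∈ M; rw [← h3]; exact h1)
          rw [← h4]; exact ⟨h3, rfl⟩
        · right
          have h3 : ee v (j + 1) = c + dd (j + 2) := by rw [← h2]; exact ee_eq2 v j
          have h4 := hyu (j + 2) (by show c + dd (j + 2) ∈ M; rw [← h3]; exact h1)
          rw [← h4]; exact ⟨h3, rfl⟩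
      have ex : ∃ p : V × Fin 4,
          (p.2 ∈ (Finset.univ.filter fun k => ee p.1 k ∈ M ∨ ee p.1 (k + 1) ∈ M) ∧
            cc p.1 p.2 = c) := by
        obtain ⟨v, hv, k, hk⟩ := hcov _ (hM1 _ hy)
        rcases edge_cell (hodd c hc).1 (hodd c hc).2 hk with ⟨h1, h2⟩ | ⟨h1, h2⟩
        · refine ⟨(⟨v, hv⟩, k), ?_, h1.symm⟩
          simp only [Finset.mem_filter, Finset.mem_univ, true_and]
          left; rw [hk]; exact hy
        · refine ⟨(⟨v, hv⟩, k + 3), ?_, h1.symm⟩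
          simp only [Finset.mem_filter, Finset.mem_univ, true_and]
          have h4 : k + 3 + 1 = k := by rw [add_assoc]; exact add_zero k
          right; rw [h4, hk]; exact hy
      obtain ⟨p, hp⟩ := ex
      refine ⟨p, hp, ?_⟩
      intro p' hp'
      obtain ⟨v, j⟩ := p
      obtain ⟨v', j'⟩ := p'
      have D := data _ hp
      have D' := data _ hp'
      simp only at D D'
      have arith : ∀ a b : Fin 4, ¬ (a = b + 1 ∧ a + 3 = b + 2) := by decide
      rcases D with ⟨D1, D2⟩ | ⟨D1, D2⟩ <;> rcases D' with ⟨E1, E2⟩ | ⟨E1, E2⟩ <;>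
        obtain ⟨rfl, h5⟩ := inj _ _ _ _ (E1.trans D1.symm)
      · rw [h5]
      · exact absurd ⟨h5.symm, D2.symm.trans E2⟩ (arith _ _)
      · exact absurd ⟨h5, E2.symm.trans D2⟩ (arith _ _)
      · rw [add_right_cancel h5]
    · intro v j
      constructor
      · simp
      · simp only [Finset.mem_filter, Finset.mem_univ, true_and]
        rintro ⟨h1, h2⟩
        have hc := ((edgeOK_ee R v j).1 (hM1 _ h1)).1
        rw [ee_eq1] at h1
        rw [ee_eq2] at h2
        have h3 := (hM2 _ hc).unique h1 h2
        have arith : ∀ a : Fin 4, ¬ (a + 3 = a + 2) := by decide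
        exact arith j h3
  · rintro ⟨S, N⟩ h
    simp only [Finset.mem_filter, Finset.mem_product, Finset.mem_univ, true_and] at h
    obtain ⟨hV, hC⟩ := h
    have hN : ∀ v k, (ee (v : V) k ∈ (Finset.univ.sigma N).image
        (fun x : (_ : V) × Fin 4 => ee x.1 x.2)) ↔ k ∈ N v := by
      intro v k
      simp only [Finset.mem_image, Finset.mem_sigma, Finset.mem_univ, true_and]
      constructor
      · rintro ⟨⟨v', k'⟩, h1, h2⟩
        obtain ⟨rfl, rfl⟩ := inj _ _ _ _ h2
        exact h1
      · intro h1
        exact ⟨⟨v, k⟩, h1, rfl⟩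
    simp only [hN]
    refine Prod.ext ?_ ?_
    · funext v
      ext k
      simp only [Finset.mem_filter, Finset.mem_univ, true_and]
      exact ((hC v k).1).symm
    · funext v
      ext k
      simp
  · intro M hM
    rw [mem_tilings] at hM
    ext e
    simp only [Finset.mem_image, Finset.mem_sigma, Finset.mem_univ, true_and, Finset.mem_filter]
    constructor
    · rintro ⟨⟨v, k⟩, h1, h2⟩
      rw [← h2]; exact h1
    · intro he
      obtain ⟨v, hv, k, hk⟩ := hcov e (hM.1 e he)
      exact ⟨⟨⟨v, hv⟩, k⟩, by simp only [hk]; exact he, hk⟩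
  · rintro ⟨S, N⟩ h
    simp only
    rw [Finset.prod_image, Finset.prod_sigma]
    rintro ⟨v, k⟩ _ ⟨v', k'⟩ _ h
    obtain ⟨rfl, rfl⟩ := inj _ _ _ _ h
    rfl

/-! ### Part 3: the local (urban renewal) identity -/

theorem wloc_eq_filter (w : Fin 4 → ℚ) (S : Finset (Fin 4)) :
    wloc w S = ∑ N ∈ Finset.univ.filter (fun N => Cov N S), ∏ k ∈ N, w k := by
  unfold wloc
  rw [Finset.sum_filter]

theorem wloc_empty (w : Fin 4 → ℚ) : wloc w ∅ = 1 := by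
  have h : Finset.univ.filter (fun N => Cov N ∅) = {∅} := by decide
  rw [wloc_eq_filter, h]; simp

theorem wloc_univ (w : Fin 4 → ℚ) : wloc w Finset.univ = w 0 * w 2 + w 1 * w 3 := by
  have h : Finset.univ.filter (fun N => Cov N Finset.univ) = {{0, 2}, {1, 3}} := by decide
  rw [wloc_eq_filter, h, Finset.sum_pair (by decide), Finset.prod_pair (by decide),
    Finset.prod_pair (by decide)]

theorem wloc_pair (w : Fin 4 → ℚ) (k : Fin 4) : wloc w {k, k + 3} = w k := by
  have h : ∀ k : Fin 4, Finset.univ.filter (fun N => Cov N {k, k + 3}) = {{k}} := by decide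
  rw [wloc_eq_filter, h k]; simp

theorem wloc_bad (w : Fin 4 → ℚ) (S : Finset (Fin 4)) (h : ∀ N, ¬ Cov N S) : wloc w S = 0 := by
  unfold wloc
  exact Finset.sum_eq_zero fun N _ => if_neg (h N)

theorem local_id (mask : Finset (Fin 4)) (hm : mask = Finset.univ ∨ ∃ k, mask = {k, k + 3})
    (X : Fin 4 → ℚ) (Y Z : ℚ) (hX : ∀ k, (k ∈ mask ∨ k + 3 ∈ mask) → X k ≠ 0)
    (hX0 : ∀ k, ¬ (k ∈ mask ∨ k + 3 ∈ mask) → X k = 0) (hY : Y ≠ 0) (hZ : Z ≠ 0)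
    (hYZ : Y * Z = X 0 * X 2 + X 1 * X 3) (S : Finset (Fin 4)) (hS : S ⊆ mask) :
    wloc (fun k => 1 / (Y * X k)) S =
      (Z * (∏ k, if k ∈ mask ∧ k + 3 ∈ mask then X k else 1) /
          (if mask = Finset.univ then Y else 1)) *
        (∏ j ∈ S, 1 / (X j * X (j + 1))) * wloc (fun k => 1 / (Z * X k)) (mask \ S) := by
  rcases hm with rfl | ⟨k, rfl⟩
  · have cases16 : ∀ S : Finset (Fin 4), S = ∅ ∨ S = Finset.univ ∨ (∃ k, S = {k, k + 3}) ∨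
        ((∀ N, ¬ Cov N S) ∧ (∀ N, ¬ Cov N (Finset.univ \ S))) := by decide
    have n0 := hX 0 (by simp)
    have n1 := hX 1 (by simp)
    have n2 := hX 2 (by simp)
    have n3 := hX 3 (by simp)
    simp only [Finset.mem_univ, and_self, if_true, Fin.prod_univ_four]
    rcases cases16 S with rfl | rfl | ⟨k, rfl⟩ | ⟨h1, h2⟩
    · rw [Finset.sdiff_empty, wloc_empty, wloc_univ, Finset.prod_empty]
      field_simp
      linear_combination hYZ
    · rw [Finset.sdiff_self, wloc_empty, wloc_univ, Fin.prod_univ_four]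
      have e1 : (0 : Fin 4) + 1 = 1 := rfl
      have e2 : (1 : Fin 4) + 1 = 2 := rfl
      have e3 : (2 : Fin 4) + 1 = 3 := rfl
      have e4 : (3 : Fin 4) + 1 = 0 := rfl
      rw [e1, e2, e3, e4]
      field_simp
      linear_combination -hYZ
    · have hc : ∀ k : Fin 4, Finset.univ \ {k, k + 3} = ({k + 2, k + 2 + 3} : Finset (Fin 4)) := by
        decide
      have hne : ∀ k : Fin 4, k ≠ k + 3 := by decide
      rw [hc k, wloc_pair, wloc_pair, Finset.prod_pair (hne k)]
      rcases fin4_cases k with rfl | rfl | rfl | rfl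
      · have e1 : (0 : Fin 4) + 1 = 1 := rfl
        have e2 : (0 : Fin 4) + 2 = 2 := rfl
        have e3 : (0 : Fin 4) + 3 = 3 := rfl
        have e4 : (3 : Fin 4) + 1 = 0 := rfl
        rw [e1, e2, e3, e4]
        field_simp
      · have e1 : (1 : Fin 4) + 1 = 2 := rfl
        have e2 : (1 : Fin 4) + 2 = 3 := rfl
        have e3 : (1 : Fin 4) + 3 = 0 := rfl
        have e4 : (0 : Fin 4) + 1 = 1 := rfl
        rw [e1, e2, e3, e4]
        field_simp
      · have e1 : (2 : Fin 4) + 1 = 3 := rfl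
        have e2 : (2 : Fin 4) + 2 = 0 := rfl
        have e3 : (2 : Fin 4) + 3 = 1 := rfl
        have e4 : (1 : Fin 4) + 1 = 2 := rfl
        rw [e1, e2, e3, e4]
        field_simp
      · have e1 : (3 : Fin 4) + 1 = 0 := rfl
        have e2 : (3 : Fin 4) + 2 = 1 := rfl
        have e3 : (3 : Fin 4) + 3 = 2 := rfl
        have e4 : (2 : Fin 4) + 1 = 3 := rfl
        rw [e1, e2, e3, e4]
        field_simp
    · rw [wloc_bad _ _ h1, wloc_bad _ _ h2, mul_zero]
  · have cases4 : ∀ k : Fin 4, ∀ S : Finset (Fin 4), S ⊆ {k, k + 3} → S = ∅ ∨ S = {k, k + 3} ∨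
        ((∀ N, ¬ Cov N S) ∧ (∀ N, ¬ Cov N ({k, k + 3} \ S))) := by decide
    have hne : ∀ k : Fin 4, k ≠ k + 3 := by decide
    have hnu : ∀ k : Fin 4, ({k, k + 3} : Finset (Fin 4)) ≠ Finset.univ := by decide
    have hal : ∀ k i : Fin 4, (i ∈ ({k, k + 3} : Finset (Fin 4)) ∧
      i + 3 ∈ ({k, k + 3} : Finset (Fin 4))) ↔ i = k := by decide
    have ha0 : ∀ k : Fin 4, k ∈ ({k, k + 3} : Finset (Fin 4)) ∨
      k + 3 ∈ ({k, k + 3} : Finset (Fin 4)) := by decide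
    have ha1 : ∀ k : Fin 4, k + 1 ∈ ({k, k + 3} : Finset (Fin 4)) ∨
      k + 1 + 3 ∈ ({k, k + 3} : Finset (Fin 4)) := by decide
    have ha3 : ∀ k : Fin 4, k + 3 ∈ ({k, k + 3} : Finset (Fin 4)) ∨
      k + 3 + 3 ∈ ({k, k + 3} : Finset (Fin 4)) := by decide
    have ha2 : ∀ k : Fin 4, ¬ (k + 2 ∈ ({k, k + 3} : Finset (Fin 4)) ∨
      k + 2 + 3 ∈ ({k, k + 3} : Finset (Fin 4))) := by decide
    have n0 := hX k (ha0 k)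
    have n1 := hX _ (ha1 k)
    have n3 := hX _ (ha3 k)
    have n2 := hX0 _ (ha2 k)
    have hrec : Y * Z = X (k + 1) * X (k + 3) := by
      rw [hYZ]
      rcases fin4_cases k with rfl | rfl | rfl | rfl
      · have : X 2 = 0 := n2
        rw [this, mul_zero, zero_add]; rfl
      · have : X 3 = 0 := n2
        rw [this, mul_zero, add_zero, mul_comm]; rfl
      · have : X 0 = 0 := n2
        rw [this, zero_mul, zero_add, mul_comm]; rfl
      · have : X 1 = 0 := n2
        rw [this, zero_mul, add_zero]; rfl
    have hprod : (∏ i, if i ∈ ({k, k + 3} : Finset (Fin 4)) ∧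
        i + 3 ∈ ({k, k + 3} : Finset (Fin 4)) then X i else 1) = X k := by
      simp only [hal, Finset.prod_ite_eq', Finset.mem_univ, if_true]
    rw [hprod, if_neg (hnu k), div_one]
    rcases cases4 k S hS with rfl | rfl | ⟨h1, h2⟩
    · rw [Finset.sdiff_empty, wloc_empty, wloc_pair, Finset.prod_empty]
      field_simp
    · rw [Finset.sdiff_self, wloc_empty, wloc_pair, Finset.prod_pair (hne k)]
      have e4 : k + 3 + 1 = k := by rw [add_assoc]; exact add_zero k
      rw [e4]
      field_simp
      linear_combination -hrec
    · rw [wloc_bad _ _ h1, wloc_bad _ _ h2, mul_zero]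

/-! ### Part 4: the regions, and complementation of local cell sets -/

/-- Points of parity `m` in the intersection of the square and the Aztec diamond of order `m`. -/
noncomputable def pts (n m : ℤ) : Finset (ℤ × ℤ) :=
  ((Finset.Icc (-n) n) ×ˢ (Finset.Icc (-n) n)).filter fun v =>
    (v.1 + v.2 - m) % 2 = 0 ∧ -m ≤ v.1 + v.2 ∧ v.1 + v.2 ≤ m ∧ -m ≤ v.1 - v.2 ∧ v.1 - v.2 ≤ m

/-- Cells (doubled coordinates) of the intersection of the square and the Aztec diamond of
order `m`. -/
noncomputable def cells (n m : ℤ) : Finset (ℤ × ℤ) :=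
  ((Finset.Icc (-(2 * n - 1)) (2 * n - 1)) ×ˢ (Finset.Icc (-(2 * n - 1)) (2 * n - 1))).filter fun c =>
    c.1 % 2 = 1 ∧ c.2 % 2 = 1 ∧ -(2 * m) ≤ c.1 + c.2 ∧ c.1 + c.2 ≤ 2 * m ∧
      -(2 * m) ≤ c.1 - c.2 ∧ c.1 - c.2 ≤ 2 * m

theorem mem_pts {n m : ℤ} {v : ℤ × ℤ} : v ∈ pts n m ↔
    ((-n ≤ v.1 ∧ v.1 ≤ n) ∧ (-n ≤ v.2 ∧ v.2 ≤ n)) ∧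
    (v.1 + v.2 - m) % 2 = 0 ∧ -m ≤ v.1 + v.2 ∧ v.1 + v.2 ≤ m ∧ -m ≤ v.1 - v.2 ∧ v.1 - v.2 ≤ m := by
  simp [pts]

theorem mem_cells {n m : ℤ} {c : ℤ × ℤ} : c ∈ cells n m ↔
    ((-(2 * n - 1) ≤ c.1 ∧ c.1 ≤ 2 * n - 1) ∧ (-(2 * n - 1) ≤ c.2 ∧ c.2 ≤ 2 * n - 1)) ∧
    c.1 % 2 = 1 ∧ c.2 % 2 = 1 ∧ -(2 * m) ≤ c.1 + c.2 ∧ c.1 + c.2 ≤ 2 * m ∧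
      -(2 * m) ≤ c.1 - c.2 ∧ c.1 - c.2 ≤ 2 * m := by
  unfold cells
  rw [Finset.mem_filter, Finset.mem_product, Finset.mem_Icc, Finset.mem_Icc]

/-- The corners of a cell. -/
def corner (c : ℤ × ℤ) : Fin 4 → ℤ × ℤ
  | 0 => ((c.1 - 1) / 2, (c.2 - 1) / 2)
  | 1 => ((c.1 + 1) / 2, (c.2 - 1) / 2)
  | 2 => ((c.1 + 1) / 2, (c.2 + 1) / 2)
  | 3 => ((c.1 - 1) / 2, (c.2 + 1) / 2)

theorem corner_cc (v : ℤ × ℤ) (k : Fin 4) : corner (cc v k) k = v := by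
  obtain ⟨a, b⟩ := v
  rcases fin4_cases k with rfl | rfl | rfl | rfl <;> simp only [corner, cc, Prod.mk.injEq] <;> omega

theorem cc_corner (c : ℤ × ℤ) (h1 : c.1 % 2 = 1) (h2 : c.2 % 2 = 1) (k : Fin 4) :
    cc (corner c k) k = c := by
  obtain ⟨a, b⟩ := c
  simp only at h1 h2
  rcases fin4_cases k with rfl | rfl | rfl | rfl <;> simp only [corner, cc, Prod.mk.injEq] <;> omega

theorem edgeOK_mono {R R' : Finset (ℤ × ℤ)} (h : R' ⊆ R) {e : ℤ × ℤ} (he : edgeOK R' e) :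
    edgeOK R e := by
  rcases he with ⟨a, b, c, d⟩ | ⟨a, b, c, d⟩
  · exact Or.inl ⟨a, b, h c, h d⟩
  · exact Or.inr ⟨a, b, h c, h d⟩

theorem cells_mono (n m : ℤ) : cells n (m - 1) ⊆ cells n m := by
  intro c hc
  rw [mem_cells] at hc ⊢
  omega

theorem cells_hcov (n m : ℤ) (e : ℤ × ℤ) (h : edgeOK (cells n m) e) :
    ∃ v ∈ pts n (m - 1), ∃ k, ee v k = e := by
  obtain ⟨a, b⟩ := e
  simp only [edgeOK, mem_cells] at h
  rcases h with h | h
  · by_cases hp : ((a - 1) / 2 + b / 2 - (m - 1)) % 2 = 0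
    · refine ⟨((a - 1) / 2, b / 2), ?_, 0, ?_⟩
      · rw [mem_pts]; simp only; omega
      · simp only [ee, dd, Prod.mk.injEq]; omega
    · refine ⟨((a + 1) / 2, b / 2), ?_, 2, ?_⟩
      · rw [mem_pts]; simp only; omega
      · simp only [ee, dd, Prod.mk.injEq]; omega
  · by_cases hp : (a / 2 + (b - 1) / 2 - (m - 1)) % 2 = 0
    · refine ⟨(a / 2, (b - 1) / 2), ?_, 1, ?_⟩
      · rw [mem_pts]; simp only; omega
      · simp only [ee, dd, Prod.mk.injEq]; omega
    · refine ⟨(a / 2, (b + 1) / 2), ?_, 3, ?_⟩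
      · rw [mem_pts]; simp only; omega
      · simp only [ee, dd, Prod.mk.injEq]; omega

theorem forall_fin4 {p : Fin 4 → Prop} : (∀ k, p k) ↔ p 0 ∧ p 1 ∧ p 2 ∧ p 3 := by
  constructor
  · intro h; exact ⟨h 0, h 1, h 2, h 3⟩
  · rintro ⟨h0, h1, h2, h3⟩ k
    rcases fin4_cases k with rfl | rfl | rfl | rfl <;> assumption

theorem corner_two (n m : ℤ) (c : ℤ × ℤ) (h : c ∈ cells n (m - 1)) :
    ∃ k0 : Fin 4, ∀ k, corner c k ∈ pts n (m - 1) ↔ (k = k0 ∨ k = k0 + 2) := by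
  obtain ⟨a, b⟩ := c
  rw [mem_cells] at h
  simp only at h
  by_cases hp : ((a - 1) / 2 + (b - 1) / 2 - (m - 1)) % 2 = 0
  · refine ⟨0, ?_⟩
    rw [forall_fin4]
    simp only [corner, mem_pts]
    simp only [show ((0 : Fin 4) + 2) = 2 from rfl,
      show ¬ ((1 : Fin 4) = 0) by decide, show ¬ ((1 : Fin 4) = 2) by decide,
      show ¬ ((3 : Fin 4) = 0) by decide, show ¬ ((3 : Fin 4) = 2) by decide,
      true_or, or_true, or_false, iff_true, iff_false]
    omega
  · refine ⟨1, ?_⟩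
    rw [forall_fin4]
    simp only [corner, mem_pts]
    simp only [show ((1 : Fin 4) + 2) = 3 from rfl,
      show ¬ ((0 : Fin 4) = 1) by decide, show ¬ ((0 : Fin 4) = 3) by decide,
      show ¬ ((2 : Fin 4) = 1) by decide, show ¬ ((2 : Fin 4) = 3) by decide,
      true_or, or_true, or_false, iff_true, iff_false]
    omega

theorem corner_one (n m : ℤ) (c : ℤ × ℤ) (h : c ∈ cells n m) (h' : c ∉ cells n (m - 1)) :
    ∃ k0 : Fin 4, ∀ k, corner c k ∈ pts n (m - 1) ↔ k = k0 := by
  obtain ⟨a, b⟩ := c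
  rw [mem_cells] at h h'
  simp only at h h'
  have hc : a + b = 2 * m ∨ a + b = -(2 * m) ∨ a - b = 2 * m ∨ a - b = -(2 * m) := by omega
  rcases hc with hc | hc | hc | hc
  · refine ⟨0, ?_⟩
    rw [forall_fin4]
    simp only [corner, mem_pts, show ¬ ((1 : Fin 4) = 0) by decide,
      show ¬ ((2 : Fin 4) = 0) by decide, show ¬ ((3 : Fin 4) = 0) by decide, iff_true, iff_false]
    omega
  · refine ⟨2, ?_⟩
    rw [forall_fin4]
    simp only [corner, mem_pts, show ¬ ((1 : Fin 4) = 2) by decide,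
      show ¬ ((0 : Fin 4) = 2) by decide, show ¬ ((3 : Fin 4) = 2) by decide, iff_true, iff_false]
    omega
  · refine ⟨3, ?_⟩
    rw [forall_fin4]
    simp only [corner, mem_pts, show ¬ ((1 : Fin 4) = 3) by decide,
      show ¬ ((0 : Fin 4) = 3) by decide, show ¬ ((2 : Fin 4) = 3) by decide, iff_true, iff_false]
    omega
  · refine ⟨1, ?_⟩
    rw [forall_fin4]
    simp only [corner, mem_pts, show ¬ ((3 : Fin 4) = 1) by decide,
      show ¬ ((0 : Fin 4) = 1) by decide, show ¬ ((2 : Fin 4) = 1) by decide, iff_true, iff_false]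
    omega

/-- The cells of the region around a point. -/
noncomputable def mask (n m : ℤ) (v : ℤ × ℤ) : Finset (Fin 4) := Finset.univ.filter fun k => cc v k ∈ cells n m

theorem mem_mask {n m : ℤ} {v : ℤ × ℤ} {k : Fin 4} : k ∈ mask n m v ↔ cc v k ∈ cells n m := by
  simp [mask]

/-- The validity condition, at a single cell, in terms of corners. -/
theorem unique_pair_iff (V : Finset (ℤ × ℤ)) (S : V → Finset (Fin 4)) (c : ℤ × ℤ)
    (h1 : c.1 % 2 = 1) (h2 : c.2 % 2 = 1) :
    (∃! p : V × Fin 4, p.2 ∈ S p.1 ∧ cc p.1 p.2 = c) ↔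
      ∃! k : Fin 4, ∃ h : corner c k ∈ V, k ∈ S ⟨corner c k, h⟩ := by
  constructor
  · rintro ⟨⟨v, k⟩, ⟨hk, rfl⟩, hu⟩
    refine ⟨k, ⟨by rw [corner_cc]; exact v.2, ?_⟩, ?_⟩
    · have : (⟨corner (cc v k) k, by rw [corner_cc]; exact v.2⟩ : V) = v :=
        Subtype.ext (corner_cc _ _)
      rw [this]; exact hk
    · rintro k' ⟨hv', hk'⟩
      have := hu (⟨_, hv'⟩, k') ⟨hk', cc_corner _ h1 h2 k'⟩
      exact (Prod.ext_iff.1 this).2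
  · rintro ⟨k, ⟨hv, hk⟩, hu⟩
    refine ⟨(⟨_, hv⟩, k), ⟨hk, cc_corner _ h1 h2 k⟩, ?_⟩
    rintro ⟨v', k'⟩ ⟨hk', hc⟩
    simp only at hk' hc
    have e : corner c k' = v' := by rw [← hc, corner_cc]
    have hv' : corner c k' ∈ V := by rw [e]; exact v'.2
    have ev : (⟨corner c k', hv'⟩ : V) = v' := Subtype.ext e
    have := hu k' ⟨hv', by rw [ev]; exact hk'⟩
    subst this
    rw [← ev]

theorem valid_compl (n m : ℤ) (S : pts n (m - 1) → Finset (Fin 4))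
    (hS : ∀ v, S v ⊆ mask n m v) :
    Valid (pts n (m - 1)) (cells n m) S ↔
      Valid (pts n (m - 1)) (cells n (m - 1)) (fun v => mask n m v \ S v) := by
  have odd : ∀ c ∈ cells n m, c.1 % 2 = 1 ∧ c.2 % 2 = 1 := by
    intro c hc; rw [mem_cells] at hc; exact ⟨hc.2.1, hc.2.2.1⟩
  -- inner cells: exactly one of two corners
  have inner : ∀ c ∈ cells n (m - 1),
      ((∃! k : Fin 4, ∃ h : corner c k ∈ pts n (m - 1), k ∈ S ⟨corner c k, h⟩) ↔
       (∃! k : Fin 4, ∃ h : corner c k ∈ pts n (m - 1),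
          k ∈ mask n m (corner c k) \ S ⟨corner c k, h⟩)) := by
    intro c hc
    have hcm := cells_mono n m hc
    obtain ⟨k0, hk0⟩ := corner_two n m c hc
    have hk0ne : ∀ k : Fin 4, k ≠ k + 2 := by decide
    have m1 : ∀ k, k ∈ mask n m (corner c k) := by
      intro k
      rw [mem_mask, cc_corner c (odd c hcm).1 (odd c hcm).2]; exact hcm
    have a0 := (hk0 k0).2 (Or.inl rfl)
    have a2 := (hk0 (k0 + 2)).2 (Or.inr rfl)
    have red : ∀ q : ∀ k : Fin 4, corner c k ∈ pts n (m - 1) → Prop,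
        (∃! k : Fin 4, ∃ h : corner c k ∈ pts n (m - 1), q k h) ↔
          ((q k0 a0 ∧ ¬ q (k0 + 2) a2) ∨ (¬ q k0 a0 ∧ q (k0 + 2) a2)) := by
      intro q
      constructor
      · rintro ⟨k, ⟨hv, hk⟩, hu⟩
        rcases (hk0 k).1 hv with rfl | rfl
        · left
          refine ⟨hk, fun h => ?_⟩
          exact hk0ne k (hu (k + 2) ⟨a2, h⟩).symm
        · right
          refine ⟨fun h => ?_, hk⟩
          exact hk0ne k0 (hu k0 ⟨a0, h⟩)
      · rintro (⟨h1, h2⟩ | ⟨h1, h2⟩)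
        · refine ⟨k0, ⟨a0, h1⟩, ?_⟩
          rintro k ⟨hv, hk⟩
          rcases (hk0 k).1 hv with rfl | rfl
          · rfl
          · exact absurd hk h2
        · refine ⟨k0 + 2, ⟨a2, h2⟩, ?_⟩
          rintro k ⟨hv, hk⟩
          rcases (hk0 k).1 hv with rfl | rfl
          · exact absurd hk h1
          · rfl
    rw [red (fun k h => k ∈ S ⟨corner c k, h⟩),
      red (fun k h => k ∈ mask n m (corner c k) \ S ⟨corner c k, h⟩)]
    simp only [Finset.mem_sdiff, m1, true_and, not_not]
    tauto
  constructor
  · rintro ⟨_, h2⟩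
    constructor
    · intro v k hk
      simp only [Finset.mem_sdiff, mem_mask] at hk
      by_contra hc
      obtain ⟨k0, hk0⟩ := corner_one n m _ hk.1 hc
      have := h2 _ hk.1
      rw [unique_pair_iff _ _ _ (odd _ hk.1).1 (odd _ hk.1).2] at this
      obtain ⟨k1, ⟨hv1, hk1⟩, _⟩ := this
      have e1 := (hk0 k1).1 hv1
      have e2 := (hk0 k).1 (by rw [corner_cc]; exact v.2)
      have e3 : k1 = k := e1.trans e2.symm
      subst e3
      have : (⟨corner (cc v k1) k1, hv1⟩ : pts n (m - 1)) = v := Subtype.ext (corner_cc _ _)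
      rw [this] at hk1
      exact hk.2 hk1
    · intro c hc
      have hcm := cells_mono n m hc
      have := h2 c hcm
      exact (unique_pair_iff (pts n (m - 1)) (fun v => mask n m v \ S v) c
        (odd c hcm).1 (odd c hcm).2).2 ((inner c hc).1
        ((unique_pair_iff _ _ _ (odd c hcm).1 (odd c hcm).2).1 this))
  · rintro ⟨h1, h2⟩
    constructor
    · intro v k hk
      exact mem_mask.1 (hS v hk)
    · intro c hcm
      rw [unique_pair_iff _ _ _ (odd c hcm).1 (odd c hcm).2]
      by_cases hc : c ∈ cells n (m - 1)
      · have := h2 c hc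
        exact (inner c hc).2 ((unique_pair_iff (pts n (m - 1)) (fun v => mask n m v \ S v) c
          (odd c hcm).1 (odd c hcm).2).1 this)
      · obtain ⟨k0, hk0⟩ := corner_one n m _ hcm hc
        have hv0 := (hk0 k0).2 rfl
        refine ⟨k0, ⟨hv0, ?_⟩, ?_⟩
        · by_contra hn
          have := h1 ⟨_, hv0⟩ k0 (by
            rw [Finset.mem_sdiff, mem_mask]
            refine ⟨?_, hn⟩
            simp only
            rw [cc_corner c (odd c hcm).1 (odd c hcm).2]; exact hcm)
          simp only at this
          rw [cc_corner c (odd c hcm).1 (odd c hcm).2] at this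
          exact hc this
        · rintro k ⟨hv, _⟩
          exact (hk0 k).1 hv

theorem mask_cases (n m : ℤ) (hm : m ≤ 2 * n - 1) (v : ℤ × ℤ) (hv : v ∈ pts n (m - 1)) :
    mask n m v = Finset.univ ∨ ∃ k, mask n m v = {k, k + 3} := by
  obtain ⟨a, b⟩ := v
  rw [mem_pts] at hv
  simp only at hv
  have ext4 : ∀ A B : Finset (Fin 4), A = B ↔ ∀ k, (k ∈ A ↔ k ∈ B) := fun A B => Finset.ext_iff
  by_cases h1 : a = n
  · right; refine ⟨2, ?_⟩
    have : ({2, 2 + 3} : Finset (Fin 4)) = {1, 2} := by decide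
    rw [this, ext4, forall_fin4]
    simp [mem_mask, cc, mem_cells]; omega
  by_cases h2 : a = -n
  · right; refine ⟨0, ?_⟩
    rw [ext4, forall_fin4]
    simp [mem_mask, cc, mem_cells]; omega
  by_cases h3 : b = n
  · right; refine ⟨3, ?_⟩
    have : ({3, 3 + 3} : Finset (Fin 4)) = {2, 3} := by decide
    rw [this, ext4, forall_fin4]
    simp [mem_mask, cc, mem_cells]; omega
  by_cases h4 : b = -n
  · right; refine ⟨1, ?_⟩
    have : ({1, 1 + 3} : Finset (Fin 4)) = {0, 1} := by decide
    rw [this, ext4, forall_fin4]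
    simp [mem_mask, cc, mem_cells]; omega
  left
  rw [ext4, forall_fin4]
  simp [mem_mask, cc, mem_cells]; omega

/-! ### Part 5: the urban renewal step -/

/-- Edge weights from vertex labels. -/
def wt (ψ : ℤ × ℤ → ℚ) (e : ℤ × ℤ) : ℚ :=
  if e.1 % 2 = 1 then 1 / (ψ ((e.1 - 1) / 2, e.2 / 2) * ψ ((e.1 + 1) / 2, e.2 / 2))
  else 1 / (ψ (e.1 / 2, (e.2 - 1) / 2) * ψ (e.1 / 2, (e.2 + 1) / 2))

theorem wt_mk (ψ : ℤ × ℤ → ℚ) (x y : ℤ) : wt ψ (x, y) =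
    if x % 2 = 1 then 1 / (ψ ((x - 1) / 2, y / 2) * ψ ((x + 1) / 2, y / 2))
    else 1 / (ψ (x / 2, (y - 1) / 2) * ψ (x / 2, (y + 1) / 2)) := rfl

theorem wt_ee (ψ : ℤ × ℤ → ℚ) (v : ℤ × ℤ) (k : Fin 4) :
    wt ψ (ee v k) = 1 / (ψ v * ψ (v + dd k)) := by
  obtain ⟨a, b⟩ := v
  rcases fin4_cases k with rfl | rfl | rfl | rfl
  · simp only [ee, dd, Prod.mk_add_mk]
    rw [wt_mk, if_pos (by omega), show (2 * a + 1 - 1) / 2 = a by omega,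
      show (2 * a + 1 + 1) / 2 = a + 1 by omega, show (2 * b + 0) / 2 = b by omega, add_zero]
  · simp only [ee, dd, Prod.mk_add_mk]
    rw [wt_mk, if_neg (by omega), show (2 * b + 1 - 1) / 2 = b by omega,
      show (2 * b + 1 + 1) / 2 = b + 1 by omega, show (2 * a + 0) / 2 = a by omega, add_zero]
  · simp only [ee, dd, Prod.mk_add_mk]
    rw [wt_mk, if_pos (by omega), show (2 * a + -1 - 1) / 2 = a + -1 by omega,
      show (2 * a + -1 + 1) / 2 = a by omega, show (2 * b + 0) / 2 = b by omega, add_zero,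
      mul_comm]
  · simp only [ee, dd, Prod.mk_add_mk]
    rw [wt_mk, if_neg (by omega), show (2 * b + -1 - 1) / 2 = b + -1 by omega,
      show (2 * b + -1 + 1) / 2 = b by omega, show (2 * a + 0) / 2 = a by omega, add_zero,
      mul_comm]

/-- The gauge factor of a cell. -/
def gg (ψ : ℤ × ℤ → ℚ) (m : ℤ) (c : ℤ × ℤ) : ℚ :=
  ∏ k : Fin 4, if ((corner c k).1 + (corner c k).2 - m) % 2 = 0 then (ψ (corner c k))⁻¹ else 1

theorem gg_cc (ψ : ℤ × ℤ → ℚ) (m : ℤ) (v : ℤ × ℤ) (hv : (v.1 + v.2 - (m - 1)) % 2 = 0)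
    (j : Fin 4) : gg ψ m (cc v j) = 1 / (ψ (v + dd j) * ψ (v + dd (j + 1))) := by
  obtain ⟨a, b⟩ := v
  simp only at hv
  have h1 : ∀ x : ℤ, (2 * x + 1 - 1) / 2 = x := by intro x; omega
  have h2 : ∀ x : ℤ, (2 * x + 1 + 1) / 2 = x + 1 := by intro x; omega
  have h3 : ∀ x : ℤ, (2 * x - 1 - 1) / 2 = x + -1 := by intro x; omega
  have h4 : ∀ x : ℤ, (2 * x - 1 + 1) / 2 = x := by intro x; omega
  unfold gg
  rw [Fin.prod_univ_four, one_div, mul_inv]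
  rcases fin4_cases j with rfl | rfl | rfl | rfl
  · rw [show (0 : Fin 4) + 1 = 1 from rfl]
    simp only [corner, cc, dd, Prod.mk_add_mk, h1, h2, h3, h4, add_zero]
    rw [if_neg (by omega), if_pos (by omega), if_neg (by omega), if_pos (by omega)]; ring
  · rw [show (1 : Fin 4) + 1 = 2 from rfl]
    simp only [corner, cc, dd, Prod.mk_add_mk, h1, h2, h3, h4, add_zero]
    rw [if_pos (by omega), if_neg (by omega), if_pos (by omega), if_neg (by omega)]; ring
  · rw [show (2 : Fin 4) + 1 = 3 from rfl]
    simp only [corner, cc, dd, Prod.mk_add_mk, h1, h2, h3, h4, add_zero]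
    rw [if_neg (by omega), if_pos (by omega), if_neg (by omega), if_pos (by omega)]; ring
  · rw [show (3 : Fin 4) + 1 = 0 from rfl]
    simp only [corner, cc, dd, Prod.mk_add_mk, h1, h2, h3, h4, add_zero]
    rw [if_pos (by omega), if_neg (by omega), if_pos (by omega), if_neg (by omega)]; ring

theorem valid_prod (V R : Finset (ℤ × ℤ)) (S : V → Finset (Fin 4)) (h : Valid V R S)
    (g : ℤ × ℤ → ℚ) : ∏ v : V, ∏ j ∈ S v, g (cc v j) = ∏ c ∈ R, g c := by
  rw [Finset.prod_sigma']
  refine Finset.prod_bij (fun x _ => cc x.1 x.2) ?_ ?_ ?_ ?_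
  · rintro ⟨v, j⟩ hj
    simp only [Finset.mem_sigma, Finset.mem_univ, true_and] at hj
    exact h.1 v j hj
  · rintro ⟨v, j⟩ hj ⟨v', j'⟩ hj' e
    simp only [Finset.mem_sigma, Finset.mem_univ, true_and] at hj hj' e
    have hu := (h.2 _ (h.1 v j hj)).unique (y₁ := (v, j)) (y₂ := (v', j')) ⟨hj, rfl⟩ ⟨hj', e.symm⟩
    cases hu; rfl
  · intro c hc
    obtain ⟨⟨v, j⟩, ⟨hj, e⟩, _⟩ := h.2 c hc
    exact ⟨⟨v, j⟩, by simpa using hj, e⟩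
  · intros; rfl

/-- The local constant. -/
noncomputable def kap (n m : ℤ) (ψ ψ' : ℤ × ℤ → ℚ) (v : ℤ × ℤ) : ℚ :=
  ψ' v * (∏ k, if k ∈ mask n m v ∧ k + 3 ∈ mask n m v then ψ (v + dd k) else 1) /
          (if mask n m v = Finset.univ then ψ v else 1)

theorem mask_or (n m : ℤ) (hm : m ≤ 2 * n - 1) (v : ℤ × ℤ) (hv : v ∈ pts n (m - 1)) (k : Fin 4) :
    (k ∈ mask n m v ∨ k + 3 ∈ mask n m v) ↔ v + dd k ∈ pts n m := by
  obtain ⟨a, b⟩ := v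
  rw [mem_pts] at hv
  simp only at hv
  rcases fin4_cases k with rfl | rfl | rfl | rfl
  · rw [show (0 : Fin 4) + 3 = 3 from rfl]
    simp only [mem_mask, mem_pts, mem_cells, cc, dd, Prod.mk_add_mk]; omega
  · rw [show (1 : Fin 4) + 3 = 0 from rfl]
    simp only [mem_mask, mem_pts, mem_cells, cc, dd, Prod.mk_add_mk]; omega
  · rw [show (2 : Fin 4) + 3 = 1 from rfl]
    simp only [mem_mask, mem_pts, mem_cells, cc, dd, Prod.mk_add_mk]; omega
  · rw [show (3 : Fin 4) + 3 = 2 from rfl]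
    simp only [mem_mask, mem_pts, mem_cells, cc, dd, Prod.mk_add_mk]; omega

theorem par_dd (m : ℤ) (v : ℤ × ℤ) (hv : (v.1 + v.2 - (m - 1)) % 2 = 0) (k : Fin 4) :
    ((v + dd k).1 + (v + dd k).2 - m) % 2 = 0 := by
  obtain ⟨a, b⟩ := v
  simp only at hv
  rcases fin4_cases k with rfl | rfl | rfl | rfl <;> simp only [dd, Prod.mk_add_mk] <;> omega

theorem pts_of_sq (n m : ℤ) (v : ℤ × ℤ) (hv : v ∈ pts n (m - 1)) (k : Fin 4)
    (h : v + dd k ∉ pts n m) :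
    ¬ ((-n ≤ (v + dd k).1 ∧ (v + dd k).1 ≤ n) ∧ (-n ≤ (v + dd k).2 ∧ (v + dd k).2 ≤ n)) := by
  obtain ⟨a, b⟩ := v
  rw [mem_pts] at hv h
  simp only at hv
  rcases fin4_cases k with rfl | rfl | rfl | rfl <;>
    simp only [dd, Prod.mk_add_mk] at h ⊢ <;> omega

theorem tz_step (n m : ℤ) (hm : m ≤ 2 * n - 1) (ψ ψ' : ℤ × ℤ → ℚ)
    (hpar : ∀ u : ℤ × ℤ, (u.1 + u.2 - m) % 2 = 0 → ψ' u = ψ u)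
    (hpos : ∀ u ∈ pts n m, ψ u ≠ 0)
    (hposv : ∀ v ∈ pts n (m - 1), ψ v ≠ 0 ∧ ψ' v ≠ 0)
    (hzero : ∀ u : ℤ × ℤ, (u.1 + u.2 - m) % 2 = 0 →
      ¬ ((-n ≤ u.1 ∧ u.1 ≤ n) ∧ (-n ≤ u.2 ∧ u.2 ≤ n)) → ψ u = 0)
    (hrec : ∀ v ∈ pts n (m - 1),
      ψ v * ψ' v = ψ (v + dd 0) * ψ (v + dd 2) + ψ (v + dd 1) * ψ (v + dd 3)) :
    tz (cells n m) (wt ψ) = (∏ v ∈ pts n (m - 1), kap n m ψ ψ' v) *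
      (∏ c ∈ cells n m, gg ψ m c) * tz (cells n (m - 1)) (wt ψ') := by
  classical
  have hp : ∀ v ∈ pts n (m - 1), (v.1 + v.2 - (m - 1)) % 2 = 0 := by
    intro v hv; rw [mem_pts] at hv; exact hv.2.1
  have odd : ∀ m, ∀ c ∈ cells n m, c.1 % 2 = 1 ∧ c.2 % 2 = 1 := by
    intro m c hc; rw [mem_cells] at hc; exact ⟨hc.2.1, hc.2.2.1⟩
  rw [tz_group (pts n (m - 1)) (cells n m) (wt ψ) (m - 1) hp (odd m) (cells_hcov n m),
    tz_group (pts n (m - 1)) (cells n (m - 1)) (wt ψ') (m - 1) hp (odd (m - 1))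
      (fun e he => cells_hcov n m e (edgeOK_mono (cells_mono n m) he))]
  rw [← Finset.sum_filter, ← Finset.sum_filter, Finset.mul_sum]
  have sub1 : ∀ S, Valid (pts n (m - 1)) (cells n m) S → ∀ v, S v ⊆ mask n m v := by
    intro S h v k hk
    exact mem_mask.2 (h.1 v k hk)
  have sub2 : ∀ S, Valid (pts n (m - 1)) (cells n (m - 1)) S → ∀ v, S v ⊆ mask n m v := by
    intro S h v k hk
    exact mem_mask.2 (cells_mono n m (h.1 v k hk))
  refine Finset.sum_bij' (i := fun S _ => fun v => mask n m v \ S v)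
    (j := fun S _ => fun v => mask n m v \ S v) ?_ ?_ ?_ ?_ ?_
  · intro S hS
    simp only [Finset.mem_filter, Finset.mem_univ, true_and] at hS ⊢
    exact (valid_compl n m S (sub1 S hS)).1 hS
  · intro S hS
    simp only [Finset.mem_filter, Finset.mem_univ, true_and] at hS ⊢
    rw [valid_compl n m _ (fun v => Finset.sdiff_subset)]
    have : (fun v : pts n (m - 1) => mask n m v \ (mask n m v \ S v)) = S := by
      funext v; exact Finset.sdiff_sdiff_eq_self (sub2 S hS v)
    rw [this]; exact hS
  · intro S hS
    simp only [Finset.mem_filter, Finset.mem_univ, true_and] at hS ⊢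
    funext v; exact Finset.sdiff_sdiff_eq_self (sub1 S hS v)
  · intro S hS
    simp only [Finset.mem_filter, Finset.mem_univ, true_and] at hS ⊢
    funext v; exact Finset.sdiff_sdiff_eq_self (sub2 S hS v)
  · intro S hS
    simp only [Finset.mem_filter, Finset.mem_univ, true_and] at hS
    rw [← valid_prod _ _ S hS (gg ψ m), ← Finset.prod_coe_sort (pts n (m - 1)) (kap n m ψ ψ'),
      ← Finset.prod_mul_distrib, ← Finset.prod_mul_distrib]
    apply Finset.prod_congr rfl
    rintro ⟨v, hv⟩ _
    have key := local_id (mask n m v) (mask_cases n m hm v hv) (fun k => ψ (v + dd k)) (ψ v) (ψ' v)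
      (fun k hk => hpos _ ((mask_or n m hm v hv k).1 hk))
      (fun k hk => hzero _ (par_dd m v (hp v hv) k)
        (pts_of_sq n m v hv k (fun h => hk ((mask_or n m hm v hv k).2 h))))
      (hposv v hv).1 (hposv v hv).2 (hrec v hv) (S ⟨v, hv⟩) (sub1 S hS ⟨v, hv⟩)
    simp only [wt_ee, kap]
    have e1 : ∀ k, ψ' (v + dd k) = ψ (v + dd k) := fun k => hpar _ (par_dd m v (hp v hv) k)
    simp only [e1, gg_cc ψ m v (hp v hv)]
    exact key

/-! ### Part 6: the constant -/

theorem cc_shift1 (v : ℤ × ℤ) (k : Fin 4) : cc (v + dd k) (k + 2) = cc v (k + 3) := by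
  obtain ⟨a, b⟩ := v
  rcases fin4_cases k with rfl | rfl | rfl | rfl <;> simp [cc, dd] <;> omega

theorem cc_shift2 (v : ℤ × ℤ) (k : Fin 4) : cc (v + dd k) (k + 2 + 3) = cc v k := by
  obtain ⟨a, b⟩ := v
  rcases fin4_cases k with rfl | rfl | rfl | rfl <;> simp [cc, dd] <;> omega

theorem dd_back (v : ℤ × ℤ) (k : Fin 4) : v + dd k + dd (k + 2) = v := by
  obtain ⟨a, b⟩ := v
  rcases fin4_cases k with rfl | rfl | rfl | rfl <;> simp [dd]

theorem fin4_back : ∀ k : Fin 4, k + 2 + 2 = k := by decide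

theorem shift_mem1 (n m : ℤ) (v : ℤ × ℤ) (k : Fin 4) (hv : v ∈ pts n (m - 1))
    (h1 : cc v k ∈ cells n m) (h2 : cc v (k + 3) ∈ cells n m) : v + dd k ∈ pts n m := by
  obtain ⟨a, b⟩ := v
  rw [mem_pts] at hv
  simp only at hv
  rcases fin4_cases k with rfl | rfl | rfl | rfl
  · rw [show (0 : Fin 4) + 3 = 3 from rfl] at h2
    simp only [mem_pts, mem_cells, cc, dd, Prod.mk_add_mk] at *; omega
  · rw [show (1 : Fin 4) + 3 = 0 from rfl] at h2
    simp only [mem_pts, mem_cells, cc, dd, Prod.mk_add_mk] at *; omega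
  · rw [show (2 : Fin 4) + 3 = 1 from rfl] at h2
    simp only [mem_pts, mem_cells, cc, dd, Prod.mk_add_mk] at *; omega
  · rw [show (3 : Fin 4) + 3 = 2 from rfl] at h2
    simp only [mem_pts, mem_cells, cc, dd, Prod.mk_add_mk] at *; omega

theorem shift_mem2 (n m : ℤ) (v : ℤ × ℤ) (k : Fin 4) (hv : v ∈ pts n m)
    (h1 : cc v k ∈ cells n m) (h2 : cc v (k + 3) ∈ cells n m) : v + dd k ∈ pts n (m - 1) := by
  obtain ⟨a, b⟩ := v
  rw [mem_pts] at hv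
  simp only at hv
  rcases fin4_cases k with rfl | rfl | rfl | rfl
  · rw [show (0 : Fin 4) + 3 = 3 from rfl] at h2
    simp only [mem_pts, mem_cells, cc, dd, Prod.mk_add_mk] at *; omega
  · rw [show (1 : Fin 4) + 3 = 0 from rfl] at h2
    simp only [mem_pts, mem_cells, cc, dd, Prod.mk_add_mk] at *; omega
  · rw [show (2 : Fin 4) + 3 = 1 from rfl] at h2
    simp only [mem_pts, mem_cells, cc, dd, Prod.mk_add_mk] at *; omega
  · rw [show (3 : Fin 4) + 3 = 2 from rfl] at h2
    simp only [mem_pts, mem_cells, cc, dd, Prod.mk_add_mk] at *; omega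

theorem prod_edges (n m : ℤ) (X : ℤ × ℤ → ℚ) :
    (∏ v ∈ pts n (m - 1), ∏ k, if k ∈ mask n m v ∧ k + 3 ∈ mask n m v then X (v + dd k) else 1) =
    ∏ u ∈ pts n m, ∏ k, if k ∈ mask n m u ∧ k + 3 ∈ mask n m u then X u else 1 := by
  rw [← Finset.prod_product', ← Finset.prod_product', ← Finset.prod_filter, ← Finset.prod_filter]
  refine Finset.prod_bij' (fun p _ => (p.1 + dd p.2, p.2 + 2)) (fun p _ => (p.1 + dd p.2, p.2 + 2))
    ?_ ?_ ?_ ?_ ?_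
  · rintro ⟨v, k⟩ h
    simp only [Finset.mem_filter, Finset.mem_product, Finset.mem_univ, and_true, mem_mask] at h ⊢
    rw [cc_shift1, cc_shift2]
    exact ⟨shift_mem1 n m v k h.1 h.2.1 h.2.2, h.2.2, h.2.1⟩
  · rintro ⟨v, k⟩ h
    simp only [Finset.mem_filter, Finset.mem_product, Finset.mem_univ, and_true, mem_mask] at h ⊢
    rw [cc_shift1, cc_shift2]
    exact ⟨shift_mem2 n m v k h.1 h.2.1 h.2.2, h.2.2, h.2.1⟩
  · rintro ⟨v, k⟩ h
    simp only [dd_back, fin4_back]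
  · rintro ⟨v, k⟩ h
    simp only [dd_back, fin4_back]
  · rintro ⟨v, k⟩ h
    rfl

theorem corner_mem (n m : ℤ) (c : ℤ × ℤ) (hc : c ∈ cells n m) (k : Fin 4)
    (h : ((corner c k).1 + (corner c k).2 - m) % 2 = 0) : corner c k ∈ pts n m := by
  obtain ⟨a, b⟩ := c
  rw [mem_cells] at hc
  simp only at hc
  rcases fin4_cases k with rfl | rfl | rfl | rfl <;>
    simp only [mem_pts, corner] at h ⊢ <;> omega

theorem prod_gauge (n m : ℤ) (X : ℤ × ℤ → ℚ) :
    (∏ c ∈ cells n m, gg X m c) =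
    ∏ u ∈ pts n m, ∏ k, if k ∈ mask n m u then (X u)⁻¹ else 1 := by
  unfold gg
  rw [← Finset.prod_product', ← Finset.prod_product', ← Finset.prod_filter, ← Finset.prod_filter]
  refine Finset.prod_bij' (fun p _ => (corner p.1 p.2, p.2)) (fun p _ => (cc p.1 p.2, p.2))
    ?_ ?_ ?_ ?_ ?_
  · rintro ⟨c, k⟩ h
    simp only [Finset.mem_filter, Finset.mem_product, Finset.mem_univ, and_true, mem_mask] at h ⊢
    have ho := mem_cells.1 h.1
    rw [cc_corner c ho.2.1 ho.2.2.1]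
    exact ⟨corner_mem n m c h.1 k h.2, h.1⟩
  · rintro ⟨v, k⟩ h
    simp only [Finset.mem_filter, Finset.mem_product, Finset.mem_univ, and_true, mem_mask] at h ⊢
    rw [corner_cc]
    exact ⟨h.2, (mem_pts.1 h.1).2.1⟩
  · rintro ⟨c, k⟩ h
    simp only [Finset.mem_filter, Finset.mem_product, Finset.mem_univ, and_true, mem_mask] at h ⊢
    have ho := mem_cells.1 h.1
    rw [cc_corner c ho.2.1 ho.2.2.1]
  · rintro ⟨c, k⟩ h
    simp only [corner_cc]
  · rintro ⟨v, k⟩ h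
    rfl

/-- Interior points of the square. -/
def inn (n : ℤ) (v : ℤ × ℤ) : Prop :=
  (-(n - 1) ≤ v.1 ∧ v.1 ≤ n - 1) ∧ (-(n - 1) ≤ v.2 ∧ v.2 ≤ n - 1)

instance (n : ℤ) (v : ℤ × ℤ) : Decidable (inn n v) := by unfold inn; infer_instance

theorem local_const (b0 b1 b2 b3 : Prop) [Decidable b0] [Decidable b1] [Decidable b2]
    [Decidable b3] (x : ℚ) (hx : x ≠ 0) (h : b0 ∨ b1 ∨ b2 ∨ b3)
    (h02 : b0 ∧ b2 → b1 ∨ b3) (h13 : b1 ∧ b3 → b0 ∨ b2) :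
    x * ((if b0 ∧ b3 then x else 1) * (if b1 ∧ b0 then x else 1) * (if b2 ∧ b1 then x else 1) *
      (if b3 ∧ b2 then x else 1)) *
      ((if b0 then x⁻¹ else 1) * (if b1 then x⁻¹ else 1) * (if b2 then x⁻¹ else 1) *
      (if b3 then x⁻¹ else 1)) = if b0 ∧ b1 ∧ b2 ∧ b3 then x else 1 := by
  by_cases k0 : b0 <;> by_cases k1 : b1 <;> by_cases k2 : b2 <;> by_cases k3 : b3 <;>
    simp [k0, k1, k2, k3] at h h02 h13 ⊢ <;> field_simp

theorem const_id (n m : ℤ) (hm1 : 1 ≤ m) (hm : m ≤ 2 * n - 1) (X : ℤ × ℤ → ℚ)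
    (hX : ∀ u ∈ pts n m, X u ≠ 0) :
    (∏ u ∈ pts n m, X u) *
      (∏ v ∈ pts n (m - 1),
        ∏ k, if k ∈ mask n m v ∧ k + 3 ∈ mask n m v then X (v + dd k) else 1) *
      (∏ c ∈ cells n m, gg X m c) = ∏ u ∈ (pts n (m - 1 - 1)).filter (inn n), X u := by
  rw [prod_edges, prod_gauge, ← Finset.prod_mul_distrib, ← Finset.prod_mul_distrib]
  have : (pts n (m - 1 - 1)).filter (inn n) = (pts n m).filter
      (fun u => 0 ∈ mask n m u ∧ 1 ∈ mask n m u ∧ 2 ∈ mask n m u ∧ 3 ∈ mask n m u) := by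
    ext ⟨a, b⟩
    simp only [Finset.mem_filter, mem_pts, mem_mask, mem_cells, cc, inn]
    omega
  rw [this, Finset.prod_filter]
  apply Finset.prod_congr rfl
  intro u hu
  rw [Fin.prod_univ_four, Fin.prod_univ_four]
  simp only [show (0 : Fin 4) + 3 = 3 from rfl, show (1 : Fin 4) + 3 = 0 from rfl,
    show (2 : Fin 4) + 3 = 1 from rfl, show (3 : Fin 4) + 3 = 2 from rfl]
  have hxu := hX u hu
  obtain ⟨a, b⟩ := u
  rw [mem_pts] at hu
  simp only at hu
  apply local_const _ _ _ _ _ hxu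
  · simp only [mem_mask, mem_cells, cc]; omega
  · simp only [mem_mask, mem_cells, cc]; omega
  · simp only [mem_mask, mem_cells, cc]; omega

theorem mask_univ (n m : ℤ) (v : ℤ × ℤ) (hv : v ∈ pts n (m - 1)) :
    mask n m v = Finset.univ ↔ inn n v := by
  obtain ⟨a, b⟩ := v
  rw [mem_pts] at hv
  simp only at hv
  rw [Finset.ext_iff, forall_fin4]
  simp only [mem_mask, mem_cells, cc, inn, Finset.mem_univ, iff_true]
  omega

/-- The normalizing product. -/
noncomputable def EE (n m : ℤ) (ψ : ℤ × ℤ → ℚ) : ℚ :=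
  (∏ u ∈ pts n m, ψ u) * ∏ v ∈ (pts n (m - 1)).filter (inn n), ψ v

theorem full_step (n m : ℤ) (hm1 : 1 ≤ m) (hm : m ≤ 2 * n - 1) (ψ ψ' : ℤ × ℤ → ℚ)
    (hpar : ∀ u : ℤ × ℤ, (u.1 + u.2 - m) % 2 = 0 → ψ' u = ψ u)
    (hpos : ∀ u ∈ pts n m, ψ u ≠ 0)
    (hposv : ∀ v ∈ pts n (m - 1), ψ v ≠ 0 ∧ ψ' v ≠ 0)
    (hzero : ∀ u : ℤ × ℤ, (u.1 + u.2 - m) % 2 = 0 →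
      ¬ ((-n ≤ u.1 ∧ u.1 ≤ n) ∧ (-n ≤ u.2 ∧ u.2 ≤ n)) → ψ u = 0)
    (hrec : ∀ v ∈ pts n (m - 1),
      ψ v * ψ' v = ψ (v + dd 0) * ψ (v + dd 2) + ψ (v + dd 1) * ψ (v + dd 3)) :
    tz (cells n m) (wt ψ) * EE n m ψ = tz (cells n (m - 1)) (wt ψ') * EE n (m - 1) ψ' := by
  rw [tz_step n m hm ψ ψ' hpar hpos hposv hzero hrec]
  unfold EE
  have e1 : ∏ u ∈ (pts n (m - 1 - 1)).filter (inn n), ψ' u =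
      ∏ u ∈ (pts n (m - 1 - 1)).filter (inn n), ψ u := by
    apply Finset.prod_congr rfl
    intro u hu
    apply hpar
    have := (mem_pts.1 (Finset.mem_filter.1 hu).1).2.1
    omega
  rw [e1, ← const_id n m hm1 hm ψ hpos]
  have e2 : (∏ v ∈ pts n (m - 1), kap n m ψ ψ' v) * (∏ v ∈ (pts n (m - 1)).filter (inn n), ψ v) =
      (∏ v ∈ pts n (m - 1), ψ' v) * ∏ v ∈ pts n (m - 1),
        ∏ k, if k ∈ mask n m v ∧ k + 3 ∈ mask n m v then ψ (v + dd k) else 1 := by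
    rw [Finset.prod_filter, ← Finset.prod_mul_distrib, ← Finset.prod_mul_distrib]
    apply Finset.prod_congr rfl
    intro v hv
    unfold kap
    have := (hposv v hv).1
    by_cases h : inn n v
    · rw [if_pos h, if_pos ((mask_univ n m v hv).2 h), div_mul_cancel₀ _ this]
    · rw [if_neg h, if_neg (fun h' => h ((mask_univ n m v hv).1 h'))]; ring
  linear_combination (∏ c ∈ cells n m, gg ψ m c) * tz (cells n (m - 1)) (wt ψ') *
    (∏ u ∈ pts n m, ψ u) * e2

/-! ### Part 7: the induction -/

/-- The labels at stage `s`. -/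
noncomputable def psi (n : ℤ) (s : ℕ) (v : ℤ × ℤ) : ℚ :=
  if (v.1 + v.2 - (2 * n - 1 - s)) % 2 = 0 then oct n (s + 1) v.1 v.2 else oct n s v.1 v.2

theorem psi_pos_par (n : ℤ) (s : ℕ) (v : ℤ × ℤ) (h : (v.1 + v.2 - (2 * n - 1 - s)) % 2 = 0) :
    psi n s v = oct n (s + 1) v.1 v.2 := by
  unfold psi; rw [if_pos h]

theorem psi_neg_par (n : ℤ) (s : ℕ) (v : ℤ × ℤ) (h : ¬ (v.1 + v.2 - (2 * n - 1 - s)) % 2 = 0) :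
    psi n s v = oct n s v.1 v.2 := by
  unfold psi; rw [if_neg h]

theorem one_step (n : ℤ) (s : ℕ) (hs : (s : ℤ) + 1 ≤ 2 * n - 1) :
    tz (cells n (2 * n - 1 - s)) (wt (psi n s)) * EE n (2 * n - 1 - s) (psi n s) =
    tz (cells n (2 * n - 1 - (s + 1 : ℕ))) (wt (psi n (s + 1))) *
      EE n (2 * n - 1 - (s + 1 : ℕ)) (psi n (s + 1)) := by
  have e : (2 * n - 1 - ((s + 1 : ℕ) : ℤ)) = 2 * n - 1 - s - 1 := by push_cast; ring
  have hp1 : ∀ v ∈ pts n (2 * n - 1 - s - 1), 0 < oct n s v.1 v.2 := by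
    intro v hv
    rw [mem_pts] at hv
    apply oct_pos <;> omega
  have hp2 : ∀ v ∈ pts n (2 * n - 1 - s - 1), 0 < oct n (s + 2) v.1 v.2 := by
    intro v hv
    rw [mem_pts] at hv
    apply oct_pos <;> push_cast <;> omega
  have q1 : ∀ v ∈ pts n (2 * n - 1 - s - 1), psi n s v = oct n s v.1 v.2 := by
    intro v hv
    rw [mem_pts] at hv
    apply psi_neg_par; omega
  have q2 : ∀ v ∈ pts n (2 * n - 1 - s - 1), psi n (s + 1) v = oct n (s + 2) v.1 v.2 := by
    intro v hv
    rw [mem_pts] at hv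
    apply psi_pos_par; rw [e]; omega
  rw [e]
  apply full_step n _ (by omega) (by omega)
  · intro u hu
    rw [psi_pos_par _ _ _ hu, psi_neg_par]
    rw [e]; omega
  · intro u hu
    rw [mem_pts] at hu
    rw [psi_pos_par _ _ _ hu.2.1]
    apply ne_of_gt
    apply oct_pos <;> push_cast <;> omega
  · intro v hv
    rw [q1 v hv, q2 v hv]
    exact ⟨(hp1 v hv).ne', (hp2 v hv).ne'⟩
  · intro u hu h
    rw [psi_pos_par _ _ _ hu]
    exact oct_zero _ _ _ _ (by omega) h
  · intro v hv
    have hpv : (v.1 + v.2 - (2 * n - 1 - s - 1)) % 2 = 0 := (mem_pts.1 hv).2.1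
    have hq : ∀ k, psi n s (v + dd k) = oct n (s + 1) (v + dd k).1 (v + dd k).2 :=
      fun k => psi_pos_par _ _ _ (par_dd _ v hpv k)
    rw [q1 v hv, q2 v hv, hq, hq, hq, hq]
    have h0 := (hp1 v hv).ne'
    rw [oct, mul_div_cancel₀ _ h0]
    simp only [dd, Prod.fst_add, Prod.snd_add, add_zero, ← sub_eq_add_neg]
    ring

theorem all_steps (n : ℤ) (s : ℕ) (hs : (s : ℤ) ≤ 2 * n - 1) :
    tz (cells n (2 * n - 1)) (wt (psi n 0)) * EE n (2 * n - 1) (psi n 0) =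
    tz (cells n (2 * n - 1 - s)) (wt (psi n s)) * EE n (2 * n - 1 - s) (psi n s) := by
  induction s with
  | zero => simp
  | succ s ih =>
    rw [ih (by push_cast at hs; omega)]
    exact one_step n s (by push_cast at hs; omega)

theorem psi_zero (n : ℤ) (v : ℤ × ℤ) (h : (-n ≤ v.1 ∧ v.1 ≤ n) ∧ (-n ≤ v.2 ∧ v.2 ≤ n)) :
    psi n 0 v = 1 := by
  unfold psi
  split_ifs
  · simp only [oct]; rw [if_pos h]
  · simp only [oct]

theorem start_val (n : ℤ) :
    tz (cells n (2 * n - 1)) (wt (psi n 0)) * EE n (2 * n - 1) (psi n 0) =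
      (tilings (cells n (2 * n - 1))).card := by
  have e1 : EE n (2 * n - 1) (psi n 0) = 1 := by
    unfold EE
    rw [Finset.prod_eq_one, Finset.prod_eq_one, one_mul]
    · intro v hv
      exact psi_zero n v (mem_pts.1 (Finset.mem_filter.1 hv).1).1
    · intro v hv
      exact psi_zero n v (mem_pts.1 hv).1
  rw [e1, mul_one]
  unfold tz
  rw [Finset.sum_congr rfl (g := fun _ => (1 : ℚ)), Finset.sum_const, nsmul_eq_mul, mul_one]
  intro M hM
  rw [mem_tilings] at hM
  apply Finset.prod_eq_one
  intro x hx
  have hx' := hM.1 x hx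
  obtain ⟨v, hv, k, rfl⟩ := cells_hcov n _ x hx'
  rw [edgeOK_ee] at hx'
  rw [wt_ee, psi_zero n v (mem_pts.1 hv).1,
    psi_zero n _ (mem_pts.1 (shift_mem1 n _ v k hv hx'.1 hx'.2)).1]
  norm_num

theorem tz_empty (w : ℤ × ℤ → ℚ) : tz ∅ w = 1 := by
  have : tilings ∅ = {∅} := by
    ext M
    rw [mem_tilings, Finset.mem_singleton]
    constructor
    · intro h
      rw [Finset.eq_empty_iff_forall_notMem]
      intro x hx
      have := h.1 x hx
      simp [edgeOK] at this
    · rintro rfl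
      simp [IsTiling]
  unfold tz
  rw [this]; simp

theorem end_val (n : ℕ) (hn : 1 ≤ n) :
    tz (cells n (2 * n - 1)) (wt (psi n 0)) * EE n (2 * n - 1) (psi n 0) = oct n (2 * n) 0 0 := by
  rw [all_steps n (2 * n - 1) (by omega)]
  have e : (2 * (n : ℤ) - 1 - ((2 * n - 1 : ℕ) : ℤ)) = 0 := by omega
  have c0 : cells n 0 = ∅ := by
    rw [Finset.eq_empty_iff_forall_notMem]
    intro c hc
    rw [mem_cells] at hc
    omega
  have p0 : pts n 0 = {(0, 0)} := by
    ext ⟨a, b⟩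
    rw [mem_pts, Finset.mem_singleton, Prod.mk.injEq]
    simp only
    omega
  have p1 : pts n (0 - 1) = ∅ := by
    rw [Finset.eq_empty_iff_forall_notMem]
    intro c hc
    rw [mem_pts] at hc
    omega
  rw [e, c0, tz_empty, EE, p0, p1, Finset.prod_singleton, Finset.filter_empty, Finset.prod_empty,
    psi_pos_par _ _ _ (by rw [e]; norm_num)]
  rw [show 2 * n - 1 + 1 = 2 * n by omega]
  ring

theorem oct_eq_tilings (n : ℕ) (hn : 1 ≤ n) :
    oct n (2 * n) 0 0 = (tilings (cells n (2 * n - 1))).card := by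
  rw [← end_val n hn, start_val]

/-! ### Part 8: comparison with tilings of the square as involutions -/

/-- The position of a cell of the square in doubled centered coordinates. -/
def pos (n : ℕ) (v : Fin (2 * n) × Fin (2 * n)) : ℤ × ℤ :=
  (2 * ((v.1 : ℕ) : ℤ) + 1 - 2 * n, 2 * ((v.2 : ℕ) : ℤ) + 1 - 2 * n)

/-- The midpoint of two cells. -/
def mid (n : ℕ) (v w : Fin (2 * n) × Fin (2 * n)) : ℤ × ℤ :=
  (((v.1 : ℕ) : ℤ) + ((w.1 : ℕ) : ℤ) + 1 - 2 * n, ((v.2 : ℕ) : ℤ) + ((w.2 : ℕ) : ℤ) + 1 - 2 * n)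

theorem pos_inj {n : ℕ} {v w : Fin (2 * n) × Fin (2 * n)} (h : pos n v = pos n w) : v = w := by
  simp only [pos, Prod.mk.injEq] at h
  apply Prod.ext <;> apply Fin.ext <;> omega

theorem pos_odd (n : ℕ) (v : Fin (2 * n) × Fin (2 * n)) :
    (pos n v).1 % 2 = 1 ∧ (pos n v).2 % 2 = 1 := by
  simp only [pos]; omega

theorem pos_mem (n : ℕ) (v : Fin (2 * n) × Fin (2 * n)) : pos n v ∈ cells n (2 * n - 1) := by
  have h1 := v.1.2
  have h2 := v.2.2
  simp only [mem_cells, pos]; omega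

theorem pos_surj (n : ℕ) (c : ℤ × ℤ) (h : c ∈ cells n (2 * n - 1)) : ∃ v, pos n v = c := by
  obtain ⟨a, b⟩ := c
  simp only [mem_cells] at h
  refine ⟨(⟨((a + 2 * n - 1) / 2).toNat, by omega⟩, ⟨((b + 2 * n - 1) / 2).toNat, by omega⟩), ?_⟩
  simp only [pos, Prod.mk.injEq]; omega

theorem adj_iff (n : ℕ) (v w : Fin (2 * n) × Fin (2 * n)) :
    gridAdj v w ↔ ∃ k, pos n w = pos n v + (dd k + dd k) := by
  constructor
  · intro h
    simp only [gridAdj, Fin.ext_iff] at h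
    rcases h with ⟨h1, h2 | h2⟩ | ⟨h1, h2 | h2⟩
    · refine ⟨1, ?_⟩
      simp only [pos, dd, Prod.mk_add_mk, Prod.mk.injEq]; omega
    · refine ⟨3, ?_⟩
      simp only [pos, dd, Prod.mk_add_mk, Prod.mk.injEq]; omega
    · refine ⟨0, ?_⟩
      simp only [pos, dd, Prod.mk_add_mk, Prod.mk.injEq]; omega
    · refine ⟨2, ?_⟩
      simp only [pos, dd, Prod.mk_add_mk, Prod.mk.injEq]; omega
  · rintro ⟨k, h⟩
    simp only [gridAdj, Fin.ext_iff]
    rcases fin4_cases k with rfl | rfl | rfl | rfl <;>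
      simp only [pos, dd, Prod.mk_add_mk, Prod.mk.injEq] at h <;> omega

theorem mid_eq (n : ℕ) (v w : Fin (2 * n) × Fin (2 * n)) (k : Fin 4)
    (h : pos n w = pos n v + (dd k + dd k)) : mid n v w = pos n v + dd k := by
  rcases fin4_cases k with rfl | rfl | rfl | rfl <;>
    simp only [pos, mid, dd, Prod.mk_add_mk, Prod.mk.injEq] at h ⊢ <;> omega

theorem two_dd_inj (x : ℤ × ℤ) (k j : Fin 4) (h : x + (dd k + dd k) = x + (dd j + dd j)) :
    k = j := by
  have key : ∀ k j : Fin 4, dd k + dd k = dd j + dd j → k = j := by decide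
  exact key k j (add_left_cancel h)

theorem edge_two (x y : ℤ × ℤ) (hx : x.1 % 2 = 1 ∧ x.2 % 2 = 1) (hy : y.1 % 2 = 1 ∧ y.2 % 2 = 1)
    (k j : Fin 4) (h : x + dd k = y + dd j) :
    (x = y ∧ k = j) ∨ (x = y + (dd j + dd j) ∧ y = x + (dd k + dd k)) := by
  obtain ⟨a, b⟩ := x
  obtain ⟨c, d⟩ := y
  rcases fin4_cases k with rfl | rfl | rfl | rfl <;>
  rcases fin4_cases j with rfl | rfl | rfl | rfl <;>
  simp [dd] at h hx hy ⊢ <;> omega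

theorem edgeOK_mid (R : Finset (ℤ × ℤ)) (x : ℤ × ℤ) (hx : x.1 % 2 = 1 ∧ x.2 % 2 = 1) (k : Fin 4)
    (hR : x ∈ R) : edgeOK R (x + dd k) ↔ x + (dd k + dd k) ∈ R := by
  obtain ⟨a, b⟩ := x
  simp only at hx
  obtain ⟨h1, h2⟩ := hx
  rcases fin4_cases k with rfl | rfl | rfl | rfl
  · have q : (a + 1) % 2 = 0 := by omega
    have q1 : a + 1 - 1 = a := by ring
    simp [edgeOK, dd, q, q1, h2, hR, add_assoc]
  · have q : (b + 1) % 2 = 0 := by omega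
    have q1 : b + 1 - 1 = b := by ring
    simp [edgeOK, dd, q, q1, h1, hR, add_assoc]
  · have q : (a + -1) % 2 = 0 := by omega
    have q1 : a + -1 + 1 = a := by ring
    have q2 : a + -1 - 1 = a + -2 := by ring
    simp [edgeOK, dd, q, q2, h2, hR]
  · have q : (b + -1) % 2 = 0 := by omega
    have q1 : b + -1 + 1 = b := by ring
    have q2 : b + -1 - 1 = b + -2 := by ring
    simp [edgeOK, dd, q, q2, h1, hR]

theorem edge_has_cell (R : Finset (ℤ × ℤ)) (e : ℤ × ℤ) (h : edgeOK R e) :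
    ∃ c ∈ R, ∃ k, c + dd k = e := by
  rcases h with ⟨_, _, h1, _⟩ | ⟨_, _, h1, _⟩
  · exact ⟨_, h1, 3, by simp [dd]⟩
  · exact ⟨_, h1, 2, by simp [dd]⟩

/-- The domino set of an involution. -/
noncomputable def toM (n : ℕ) (f : Fin (2 * n) × Fin (2 * n) → Fin (2 * n) × Fin (2 * n)) :
    Finset (ℤ × ℤ) := Finset.univ.image fun v => mid n v (f v)

theorem mem_toM (n : ℕ) (f : Fin (2 * n) × Fin (2 * n) → Fin (2 * n) × Fin (2 * n))
    (hf : ∀ v, f (f v) = v ∧ f v ≠ v ∧ gridAdj v (f v)) (v : Fin (2 * n) × Fin (2 * n))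
    (k : Fin 4) : pos n v + dd k ∈ toM n f ↔ pos n (f v) = pos n v + (dd k + dd k) := by
  simp only [toM, Finset.mem_image, Finset.mem_univ, true_and]
  constructor
  · rintro ⟨u, hu⟩
    obtain ⟨j, hj⟩ := (adj_iff n _ _).1 (hf u).2.2
    rw [mid_eq n _ _ j hj] at hu
    rcases edge_two _ _ (pos_odd n u) (pos_odd n v) _ _ hu with ⟨h1, rfl⟩ | ⟨h1, h2⟩
    · have := pos_inj h1
      subst this
      exact hj
    · rw [← hj] at h2
      have := pos_inj h2
      subst this
      rw [(hf u).1]; exact h1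
  · intro h
    exact ⟨v, mid_eq n _ _ k h⟩

theorem count_eq (n : ℕ) : squareTilingCount (2 * n) = (tilings (cells n (2 * n - 1))).card := by
  unfold squareTilingCount
  refine Finset.card_bij (fun f _ => toM n f) ?_ ?_ ?_
  · intro f hf
    simp only [Finset.mem_filter, Finset.mem_univ, true_and] at hf
    rw [mem_tilings]
    constructor
    · intro e he
      simp only [toM, Finset.mem_image, Finset.mem_univ, true_and] at he
      obtain ⟨u, rfl⟩ := he
      obtain ⟨j, hj⟩ := (adj_iff n _ _).1 (hf u).2.2
      rw [mid_eq n _ _ j hj, edgeOK_mid _ _ (pos_odd n u) _ (pos_mem n u), ← hj]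
      exact pos_mem n _
    · intro c hc
      obtain ⟨v, rfl⟩ := pos_surj n c hc
      obtain ⟨j, hj⟩ := (adj_iff n _ _).1 (hf v).2.2
      refine ⟨j, (mem_toM n f hf v j).2 hj, ?_⟩
      intro k hk
      have := (mem_toM n f hf v k).1 hk
      rw [hj] at this
      exact (two_dd_inj _ _ _ this).symm
  · intro f hf g hg e
    simp only [Finset.mem_filter, Finset.mem_univ, true_and] at hf hg
    funext v
    obtain ⟨j, hj⟩ := (adj_iff n _ _).1 (hf v).2.2
    have h1 := (mem_toM n f hf v j).2 hj
    rw [e] at h1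
    have h2 := (mem_toM n g hg v j).1 h1
    exact pos_inj (hj.trans h2.symm)
  · intro M hM
    rw [mem_tilings] at hM
    obtain ⟨hM1, hM2⟩ := hM
    have ex : ∀ v : Fin (2 * n) × Fin (2 * n), ∃ k : Fin 4, ∃ w : Fin (2 * n) × Fin (2 * n),
        pos n v + dd k ∈ M ∧ (∀ j, pos n v + dd j ∈ M → j = k) ∧
        pos n w = pos n v + (dd k + dd k) := by
      intro v
      obtain ⟨k, hk, hu⟩ := hM2 _ (pos_mem n v)
      have := hM1 _ hk
      rw [edgeOK_mid _ _ (pos_odd n v) _ (pos_mem n v)] at this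
      obtain ⟨w, hw⟩ := pos_surj n _ this
      exact ⟨k, w, hk, hu, hw⟩
    choose kf f h1 h2 h3 using ex
    have hf : ∀ v, f (f v) = v ∧ f v ≠ v ∧ gridAdj v (f v) := by
      intro v
      refine ⟨?_, ?_, (adj_iff n _ _).2 ⟨_, h3 v⟩⟩
      · have b1 : pos n (f v) + dd (kf v + 2) = pos n v + dd (kf v) := by
          rw [h3 v, ← add_assoc, dd_back]
        have b2 := h2 (f v) (kf v + 2) (by rw [b1]; exact h1 v)
        apply pos_inj
        rw [h3 (f v), ← b2, ← add_assoc, b1, dd_back]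
      · intro e
        have := h3 v
        rw [e] at this
        have h0 : dd (kf v) + dd (kf v) = 0 := by
          have h' : pos n v + 0 = pos n v + (dd (kf v) + dd (kf v)) := by rw [add_zero]; exact this
          exact (add_left_cancel h').symm
        revert h0
        generalize kf v = k
        revert k
        decide
    refine ⟨f, by simpa using hf, ?_⟩
    ext x
    constructor
    · intro hx
      simp only [toM, Finset.mem_image, Finset.mem_univ, true_and] at hx
      obtain ⟨u, rfl⟩ := hx
      rw [mid_eq n _ _ _ (h3 u)]
      exact h1 u
    · intro hx
      obtain ⟨c, hc, k, rfl⟩ := edge_has_cell _ _ (hM1 x hx)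
      obtain ⟨v, rfl⟩ := pos_surj n c hc
      have := h2 v k hx
      subst this
      exact (mem_toM n f hf v _).2 (h3 v)

/-- The `(+1)`-determinant (Robbins–Rumsey recursion at `λ = 1`, with `0/0 = 0`) of
the `2n×2n` 0,1-matrix whose 1's form the Aztec diamond of order `n` (entry `(i,j)`
is `1` iff `|2i−2n−1| + |2j−2n−1| ≤ 2n`, indices `1`-based) equals the number of
domino tilings of the `2n×2n` square. -/
theorem onesDet_eq_tilingCount (n : ℕ) :
    lamDet (1 : ℚ) (2 * n)
      (fun i j =>
        if |2 * ((i : ℕ) : ℤ) + 1 - 2 * n| + |2 * ((j : ℕ) : ℤ) + 1 - 2 * n| ≤ 2 * n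
        then 1 else 0) = (squareTilingCount (2 * n) : ℚ) := by
  rcases Nat.eq_zero_or_pos n with rfl | hn
  · have h : squareTilingCount (2 * 0) = 1 := by decide
    rw [h]
    simp [lamDet]
  · rw [count_eq, ← oct_eq_tilings n hn]
    have h := lamDet_window n (2 * n) 0 0
    have e : (0 : ℤ) + 0 + ((2 * n : ℕ) : ℤ) - 2 * n = 0 := by push_cast; ring
    rw [e, sub_zero] at h
    rw [← h]
    simp only [zero_add, aztecEntry]
end
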